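/- arXiv:math/0505323 — 3 statements merged into one kernel-verified Lean document; each statement's English description precedes it below -/
import Mathlib

section
/- Let R be a complete Cohen–Macaulay local ring of finite Cohen–Macaulay type, viewed via Cohen's structure theorem as a finitely generated module over a complete regular local ring T. Then the representation dimension of R, defined as the infimum of gldim End_R(R ⊕ Hom_T(R,T) ⊕ N) over finitely generated R-modules N that are free over T, is at most max{2, dim R}. -/
set_option synthInstance.maxHeartbeats 1000000
set_option maxHeartbeats 1000000

universe u

/-- Projective dimension at most `n` over a (possibly noncommutative) ring `A`. -/
def PDLE (A : Type u) [Ring A] : ℕ → (M : Type u) → [AddCommGroup M] → [Module A M] → Prop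
  | 0, M, _, _ => Module.Projective A M
  | n + 1, M, _, _ => Module.Projective A M ∨
      ∃ (ι : Type u) (f : (ι →₀ A) →ₗ[A] M), Function.Surjective f ∧ PDLE A n (LinearMap.ker f)

/-- Global dimension at most `n`: every finitely generated left `A`-module has projective
dimension at most `n`. -/
def GlobalDimLE (A : Type u) [Ring A] (n : ℕ) : Prop :=
  ∀ (M : Type u) [AddCommGroup M] [Module A M], Module.Finite A M → PDLE A n M

/-- `X` is a direct summand of `M`. -/
def IsDirectSummand (R : Type u) [CommRing R] (X M : Type u) [AddCommGroup X] [Module R X]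
    [AddCommGroup M] [Module R M] : Prop :=
  ∃ (i : X →ₗ[R] M) (p : M →ₗ[R] X), p ∘ₗ i = LinearMap.id

/-- `N` is a maximal Cohen–Macaulay module over the `d`-dimensional local ring `R`:
finitely generated, with an `N`-regular sequence of length `d` in the maximal ideal
(equivalently, depth `N = d`; the zero module is allowed by convention). -/
def IsMCM (R : Type u) [CommRing R] [IsLocalRing R] (d : ℕ) (N : Type u) [AddCommGroup N]
    [Module R N] : Prop :=
  Module.Finite R N ∧ ∃ rs : List R, rs.length = d ∧
    (∀ r ∈ rs, r ∈ IsLocalRing.maximalIdeal R) ∧ RingTheory.Sequence.IsWeaklyRegular N rs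

/-- `R` is a Cohen–Macaulay local ring of dimension `d`. -/
def IsCMLocal (R : Type u) [CommRing R] [IsLocalRing R] (d : ℕ) : Prop :=
  ringKrullDim R = d ∧ IsMCM R d R

/-- An indecomposable module. -/
def IndecomposableModule (R : Type u) [CommRing R] (N : Type u) [AddCommGroup N]
    [Module R N] : Prop :=
  Nontrivial N ∧ ∀ (A B : Submodule R N), IsCompl A B → A = ⊥ ∨ B = ⊥

/-- `R` has finite Cohen–Macaulay type: up to isomorphism there are only finitely many
indecomposable maximal Cohen–Macaulay `R`-modules. -/
def FiniteCMType (R : Type u) [CommRing R] [IsLocalRing R] (d : ℕ) : Prop :=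
  ∃ (k : ℕ) (V : Fin k → ModuleCat.{u} R),
    ∀ (N : Type u) [AddCommGroup N] [Module R N],
      IsMCM R d N → IndecomposableModule R N → ∃ i, Nonempty (N ≃ₗ[R] V i)

/-- `M` is a representation generator: a finitely generated module containing `R` and every
indecomposable maximal Cohen–Macaulay `R`-module as a direct summand. -/
def IsRepGenerator (R : Type u) [CommRing R] [IsLocalRing R] (d : ℕ) (M : Type u)
    [AddCommGroup M] [Module R M] : Prop :=
  Module.Finite R M ∧ IsDirectSummand R R M ∧
    ∀ (N : Type u) [AddCommGroup N] [Module R N],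
      IsMCM R d N → IndecomposableModule R N → IsDirectSummand R N M

/-- A regular local ring: the maximal ideal is generated by `d = dim T` elements. -/
def IsRegularLocal (T : Type u) [CommRing T] [IsLocalRing T] : Prop :=
  ∃ (d : ℕ) (s : Finset T), ringKrullDim T = d ∧ s.card = d ∧
    Ideal.span (s : Set T) = IsLocalRing.maximalIdeal T

/-- For `T → R` an algebra, `Hom_T(R, T)` is an `R`-module via the domain:
`(r • f) x = f (r * x)`. -/
noncomputable instance dualIsModule (T R : Type u) [CommRing T] [CommRing R] [Algebra T R] :
    Module R (R →ₗ[T] T) where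
  smul r f := f ∘ₗ (LinearMap.mul T R r)
  one_smul f := by ext x; show f ((1 : R) * x) = f x; rw [one_mul]
  mul_smul r s f := by
    ext x; show f (r * s * x) = f (s * (r * x)); rw [show r * s * x = s * (r * x) by ring]
  smul_zero r := by ext x; rfl
  smul_add r f g := by ext x; rfl
  add_smul r s f := by
    ext x; show f ((r + s) * x) = f (r * x) + f (s * x); rw [add_mul, map_add]
  zero_smul f := by ext x; show f (0 * x) = 0; rw [zero_mul, map_zero]

open scoped Pointwise

open IsLocalRing RingTheory.Sequence Function

/-- Exchange: an element of the maximal ideal outside its square can replace one of the members of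
a generating set of the maximal ideal. -/
theorem exists_span_insert_erase_eq_maximalIdeal {T : Type u} [CommRing T] [IsLocalRing T]
    {s : Finset T} (hs : Ideal.span (s : Set T) = maximalIdeal T) {x : T}
    (hx : x ∈ maximalIdeal T) (hx2 : x ∉ maximalIdeal T ^ 2) :
    ∃ t : Finset T, t.card + 1 = s.card ∧
      Ideal.span (insert x (t : Set T)) = maximalIdeal T := by
  classical
  have hsm : ∀ y ∈ s, y ∈ maximalIdeal T := fun y hy => hs ▸ Ideal.subset_span hy
  obtain ⟨f, -, hf⟩ := Submodule.mem_span_finset.mp (hs ▸ hx : x ∈ Ideal.span (s : Set T))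
  have : ∃ y ∈ s, IsUnit (f y) := by
    by_contra! h
    apply hx2
    rw [← hf, pow_two]
    exact Ideal.sum_mem _ fun y hy => Ideal.mul_mem_mul (h y hy) (hsm y hy)
  obtain ⟨y, hy, hu⟩ := this
  refine ⟨s.erase y, Finset.card_erase_add_one hy, le_antisymm ?_ ?_⟩
  · rw [Ideal.span_le]
    rintro z (rfl | hz)
    · exact hx
    · exact hsm z (Finset.mem_of_mem_erase hz)
  · rw [← hs, Ideal.span_le]
    intro z hz
    by_cases hzy : z = y
    · subst hzy
      rw [← Finset.add_sum_erase _ _ hy] at hf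
      rw [SetLike.mem_coe, ← Ideal.unit_mul_mem_iff_mem _ hu]
      have : f z * z = x - ∑ a ∈ s.erase z, f a • a := by
        rw [← hf, smul_eq_mul]; ring
      rw [this]
      refine Ideal.sub_mem _ (Ideal.subset_span (Set.mem_insert _ _)) (Ideal.sum_mem _ ?_)
      intro a ha
      exact Ideal.mul_mem_left _ _ (Ideal.subset_span (Set.mem_insert_of_mem _ ha))
    · exact Ideal.subset_span (Set.mem_insert_of_mem _ (Finset.mem_erase.mpr ⟨hzy, hz⟩))

theorem exists_mem_maximalIdeal_notMem_sq {T : Type u} [CommRing T] [IsLocalRing T]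
    [IsNoetherianRing T] (hT : 0 < ringKrullDim T) :
    ∃ x ∈ maximalIdeal T, x ∉ maximalIdeal T ^ 2 ∧ ∀ p ∈ minimalPrimes T, x ∉ p := by
  classical
  by_contra! h
  have hfin : (minimalPrimes T).Finite := minimalPrimes.finite_of_isNoetherianRing T
  have hmin : ∀ p ∈ minimalPrimes T, ¬ maximalIdeal T ≤ p := by
    intro p hp hle
    have hpp : p.IsPrime := hp.1.1
    have hpm : p = maximalIdeal T := le_antisymm (le_maximalIdeal hpp.ne_top) hle
    have h0 : (maximalIdeal T).height = 0 := by
      rw [← hpm]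
      exact Ideal.height_eq_zero_iff.mpr hp
    rw [← maximalIdeal_height_eq_ringKrullDim, h0] at hT
    exact lt_irrefl _ hT
  have hsub : ((maximalIdeal T : Ideal T) : Set T) ⊆
      ⋃ i ∈ ((insert (maximalIdeal T ^ 2) hfin.toFinset : Finset (Ideal T)) : Set (Ideal T)),
        ((id i : Ideal T) : Set T) := by
    intro x hx
    simp only [Finset.coe_insert, Set.mem_iUnion]
    by_cases h2 : x ∈ maximalIdeal T ^ 2
    · exact ⟨_, Set.mem_insert _ _, h2⟩
    · obtain ⟨p, hp, hxp⟩ := h x hx h2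
      exact ⟨p, Set.mem_insert_of_mem _ (by simpa using hp), hxp⟩
  rw [Ideal.subset_union_prime (maximalIdeal T ^ 2) (maximalIdeal T ^ 2)] at hsub
  · obtain ⟨i, hi, hle⟩ := hsub
    rcases Finset.mem_insert.mp hi with rfl | hi
    · have : maximalIdeal T = ⊥ := by
        refine Submodule.eq_bot_of_le_smul_of_le_jacobson_bot (maximalIdeal T) _
          (IsNoetherian.noetherian _) ?_ (maximalIdeal_le_jacobson _)
        simpa [pow_two] using hle
      obtain ⟨p, hp, hp'⟩ := Ideal.exists_minimalPrimes_le (I := (⊥ : Ideal T))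
        (J := maximalIdeal T) bot_le
      exact hmin p hp (this ▸ bot_le)
    · exact hmin i (by simpa using hi) hle
  · intro i hi hne _
    rcases Finset.mem_insert.mp hi with rfl | hi
    · exact absurd rfl hne
    · exact (show i ∈ minimalPrimes T by simpa using hi).1.1

theorem isDomain_of_isPrime_span_singleton {T : Type u} [CommRing T] [IsLocalRing T]
    [IsNoetherianRing T] {x : T} (hx : x ∈ maximalIdeal T)
    (hxp : ∀ p ∈ minimalPrimes T, x ∉ p) (h : (Ideal.span {x}).IsPrime) : IsDomain T := by
  obtain ⟨p, hp, hle⟩ := Ideal.exists_minimalPrimes_le (I := (⊥ : Ideal T))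
    (J := Ideal.span {x}) bot_le
  have hpp : p.IsPrime := hp.1.1
  have : p = ⊥ := by
    refine Submodule.eq_bot_of_le_smul_of_le_jacobson_bot (maximalIdeal T) _
      (IsNoetherian.noetherian _) ?_ (maximalIdeal_le_jacobson _)
    intro z hz
    obtain ⟨w, rfl⟩ := Ideal.mem_span_singleton.mp (hle hz)
    exact Ideal.mul_mem_mul hx ((hpp.mem_or_mem hz).resolve_left (hxp p hp))
  subst this
  exact IsDomain.of_bot_isPrime T

/-- A local ring whose maximal ideal is generated by at most `dim T` elements is a domain, and its
maximal ideal is generated by a regular sequence of length `dim T`. -/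
theorem isDomain_and_exists_isWeaklyRegular (n : ℕ) : ∀ (T : Type u) [CommRing T] [IsLocalRing T]
    [IsNoetherianRing T] (s : Finset T), Ideal.span (s : Set T) = maximalIdeal T →
    s.card ≤ n → (n : WithBot ℕ∞) ≤ ringKrullDim T →
    IsDomain T ∧ ∃ xs : List T, xs.length = n ∧ Ideal.ofList xs = maximalIdeal T ∧
      IsWeaklyRegular T xs := by
  classical
  induction n with
  | zero =>
    intro T _ _ _ s hs hn _
    have : s = ∅ := by simpa using hn
    subst this
    have hbot : maximalIdeal T = ⊥ := by rw [← hs]; simp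
    refine ⟨(isField_iff_maximalIdeal_eq.mpr hbot).isDomain, [], rfl, ?_, .nil _ _⟩
    rw [hbot, Ideal.ofList_nil]
  | succ n ih =>
    intro T _ _ _ s hs hn hdim
    obtain ⟨x, hx, hx2, hxp⟩ := exists_mem_maximalIdeal_notMem_sq (T := T)
      (lt_of_lt_of_le (by exact_mod_cast n.succ_pos) hdim)
    obtain ⟨t, ht, hspan⟩ := exists_span_insert_erase_eq_maximalIdeal hs hx hx2
    have hne : Ideal.span {x} ≠ ⊤ := by
      rw [ne_eq, Ideal.span_singleton_eq_top]; exact hx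
    have : Nontrivial (T ⧸ Ideal.span {x}) := Ideal.Quotient.nontrivial_iff.mpr hne
    have : IsLocalRing (T ⧸ Ideal.span {x}) :=
      IsLocalRing.of_surjective' (Ideal.Quotient.mk _) Ideal.Quotient.mk_surjective
    have hmax : maximalIdeal (T ⧸ Ideal.span {x}) =
        (maximalIdeal T).map (Ideal.Quotient.mk (Ideal.span {x})) :=
      (IsLocalRing.map_maximalIdeal_of_surjective _ Ideal.Quotient.mk_surjective).symm
    have hmk : Ideal.Quotient.mk (Ideal.span {x}) x = 0 :=
      Ideal.Quotient.eq_zero_iff_mem.mpr (Ideal.mem_span_singleton_self x)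
    obtain ⟨hdom, ys, hlen, hys, hreg⟩ := ih (T ⧸ Ideal.span {x})
      (t.image (Ideal.Quotient.mk (Ideal.span {x})))
      (by
        rw [hmax, ← hspan, Ideal.map_span, Set.image_insert_eq, hmk, Ideal.span_insert_zero]
        simp)
      (Finset.card_image_le.trans (by lia))
      (by
        have h1 := hdim.trans (ringKrullDim_le_ringKrullDim_quotSMulTop_succ hx)
        have h : x • (⊤ : Ideal T) = Ideal.span {x} := by
          simp [← Submodule.ideal_span_singleton_smul]
        rw [h] at h1
        push_cast at h1
        exact ENat.WithBot.add_le_add_one_right_iff.mp h1)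
    have hdomT : IsDomain T := isDomain_of_isPrime_span_singleton hx hxp
      ((Ideal.Quotient.isDomain_iff_prime _).mp hdom)
    have hx0 : x ≠ 0 := fun h => hx2 (h ▸ zero_mem _)
    obtain ⟨zs, rfl⟩ : ∃ zs : List T, zs.map (Ideal.Quotient.mk (Ideal.span {x})) = ys :=
      List.map_surjective_iff.mpr Ideal.Quotient.mk_surjective ys
    refine ⟨hdomT, x :: zs, by simpa using hlen, ?_, ?_⟩
    · rw [← Ideal.map_ofList, hmax] at hys
      have := congrArg (Ideal.comap (Ideal.Quotient.mk (Ideal.span {x}))) hys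
      rw [Ideal.comap_map_of_surjective' _ Ideal.Quotient.mk_surjective,
        Ideal.comap_map_of_surjective' _ Ideal.Quotient.mk_surjective, Ideal.mk_ker] at this
      rw [Ideal.ofList_cons, sup_comm, this]
      exact sup_eq_left.mpr (le_maximalIdeal hne)
    · rw [isWeaklyRegular_cons_iff']
      refine ⟨IsSMulRegular.of_ne_zero hx0, ?_⟩
      have e : QuotSMulTop x T ≃ₗ[T] T ⧸ Ideal.span {x} := Submodule.quotEquivOfEq _ _
        (by simp [← Submodule.ideal_span_singleton_smul])
      exact ((LinearEquiv.extendScalarsOfSurjective Ideal.Quotient.mk_surjective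
        e).isWeaklyRegular_congr _).mpr hreg

/-- A finite module on which some sequence generating the maximal ideal is regular is free. -/
theorem free_of_isWeaklyRegular {T K : Type u} [CommRing T] [IsLocalRing T]
    [IsNoetherianRing T] [AddCommGroup K] [Module T K] [Module.Finite T K] {xs : List T}
    (hxs : Ideal.ofList xs = maximalIdeal T) (h : IsWeaklyRegular K xs) : Module.Free T K := by
  classical
  let w := Module.Free.chooseBasis (ResidueField T) (TensorProduct T (ResidueField T) K)
  obtain ⟨v, hv⟩ := (TensorProduct.mk_surjective T K (ResidueField T)
    Ideal.Quotient.mk_surjective).comp_left w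
  let g := Fintype.linearCombination T v
  have hg : Surjective g := by
    rw [← LinearMap.range_eq_top, Fintype.range_linearCombination]
    exact span_eq_top_of_tmul_eq_basis v w (congrFun hv)
  have hker : LinearMap.ker g ≤ maximalIdeal T • ⊤ := by
    intro c hc
    have h0 : ∑ i, (residue T (c i)) • w i = 0 := by
      have : (TensorProduct.mk T (ResidueField T) K 1) (g c) = 0 := by
        rw [LinearMap.mem_ker.mp hc, map_zero]
      rw [Fintype.linearCombination_apply, map_sum] at this
      rw [← this]
      refine Finset.sum_congr rfl fun i _ => ?_
      rw [map_smul, ← congrFun hv i]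
      exact algebraMap_smul (ResidueField T) (c i) (TensorProduct.mk T (ResidueField T) K 1 (v i))
    rw [pi_eq_sum_univ c]
    refine Submodule.sum_mem _ fun i _ => Submodule.smul_mem_smul ?_ trivial
    exact (residue_eq_zero_iff _).mp (Fintype.linearIndependent_iff.mp w.linearIndependent _ h0 i)
  have hL : LinearMap.ker g = ⊥ := by
    have h12 : Exact (0 : PUnit.{u+1} →ₗ[T] LinearMap.ker g) (LinearMap.ker g).subtype := by
      rw [LinearMap.exact_iff]
      simp
    have hex := map_first_exact_on_four_term_right_exact_of_isSMulRegular_last h12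
      (LinearMap.exact_subtype_ker_map g) hg h
    have hle : (⊤ : Submodule T (LinearMap.ker g)) ≤ maximalIdeal T • ⊤ := by
      intro z _
      have h1 : Submodule.mapQ _ _ _ (Submodule.smul_top_le_comap_smul_top (Ideal.ofList xs)
          (LinearMap.ker g).subtype) (Submodule.Quotient.mk z) = 0 := by
        rw [Submodule.mapQ_apply, Submodule.Quotient.mk_eq_zero, hxs]
        exact hker z.2
      obtain ⟨y, hy⟩ := (hex _).mp h1
      obtain ⟨y, rfl⟩ := Submodule.Quotient.mk_surjective _ y
      rw [Submodule.mapQ_apply, LinearMap.zero_apply, Submodule.Quotient.mk_zero] at hy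
      rw [← hxs]
      exact (Submodule.Quotient.mk_eq_zero _).mp hy.symm
    have := Submodule.eq_bot_of_le_smul_of_le_jacobson_bot (maximalIdeal T) _
      (IsNoetherian.noetherian _) hle (maximalIdeal_le_jacobson _)
    rw [Submodule.eq_bot_iff]
    intro z hz
    exact congrArg Subtype.val ((Submodule.eq_bot_iff _).mp this ⟨z, hz⟩ trivial)
  exact Module.Free.of_equiv (LinearEquiv.ofBijective g ⟨LinearMap.ker_eq_bot.mp hL, hg⟩)

theorem isWeaklyRegular_of_free {T F : Type u} [CommRing T] [AddCommGroup F] [Module T F]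
    [Module.Flat T F] {xs : List T} (h : IsWeaklyRegular T xs) : IsWeaklyRegular F xs :=
  ((TensorProduct.lid T F).isWeaklyRegular_congr xs).mp (h.isWeaklyRegular_rTensor (M₂ := F))

/-- Depth lemma: in a short exact sequence `0 → K → F → Z → 0` with `F` regular for `xs`, the depth of
`K` exceeds that of `Z` by one, as long as `xs` is not exhausted. -/
theorem isWeaklyRegular_take_succ_of_exact {T : Type u} [CommRing T] (xs : List T) : ∀ (j : ℕ)
    {K F Z : Type u} [AddCommGroup K] [Module T K] [AddCommGroup F] [Module T F]
    [AddCommGroup Z] [Module T Z] {f : K →ₗ[T] F} {g : F →ₗ[T] Z},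
    Injective f → Exact f g → Surjective g → IsWeaklyRegular F xs →
    IsWeaklyRegular Z (xs.take j) → IsWeaklyRegular K (xs.take (j + 1)) := by
  induction xs with
  | nil => intros; simp
  | cons x xs ih =>
    intro j K F Z _ _ _ _ _ _ f g hf hfg hg hF hZ
    rw [isWeaklyRegular_cons_iff] at hF
    rw [List.take_succ_cons, isWeaklyRegular_cons_iff]
    refine ⟨hF.1.of_injective f hf, ?_⟩
    cases j with
    | zero => simp
    | succ j =>
      rw [List.take_succ_cons, isWeaklyRegular_cons_iff] at hZ
      refine ih j (f := QuotSMulTop.map x f) (g := QuotSMulTop.map x g) ?_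
        (QuotSMulTop.map_exact x hfg hg) (QuotSMulTop.map_surjective x hg) hF.2 hZ.2
      have h0 : Exact (0 : PUnit.{u+1} →ₗ[T] K) f := by
        rw [LinearMap.exact_iff]
        simpa using LinearMap.ker_eq_bot.mpr hf
      have := QuotSMulTop.map_first_exact_on_four_term_exact_of_isSMulRegular_last h0 hfg hZ.1
      rw [injective_iff_map_eq_zero]
      intro a ha
      obtain ⟨b, rfl⟩ := (this a).mp ha
      obtain ⟨b, rfl⟩ := Submodule.Quotient.mk_surjective _ b
      simp

section Duality

variable {T R : Type u} [CommRing T] [CommRing R] [Algebra T R]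

theorem dual_smul_apply (r x : R) (f : R →ₗ[T] T) : (r • f) x = f (r * x) := rfl

instance dual_isScalarTower : IsScalarTower T R (R →ₗ[T] T) where
  smul_assoc t r f := by
    ext x
    simp [dual_smul_apply]

/-- Adjunction between restriction of scalars and coextension: `Hom_R(C, Hom_T(R, T))` is the
`T`-dual of `C`. -/
noncomputable def homDualEquiv (T R C : Type u) [CommRing T] [CommRing R] [Algebra T R]
    [AddCommGroup C] [Module R C] [Module T C] [IsScalarTower T R C] :
    (C →ₗ[R] (R →ₗ[T] T)) ≃ₗ[T] (C →ₗ[T] T) where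
  toFun f :=
    { toFun := fun c => f c 1
      map_add' := fun a b => by simp
      map_smul' := fun t c => by
        rw [← algebraMap_smul R t c, map_smul, algebraMap_smul]; rfl }
  map_add' f g := rfl
  map_smul' t f := rfl
  invFun φ :=
    { toFun := fun c =>
        { toFun := fun r => φ (r • c)
          map_add' := fun a b => by rw [add_smul, map_add]
          map_smul' := fun t r => by rw [smul_assoc, map_smul]; rfl }
      map_add' := fun a b => by ext r; simp
      map_smul' := fun s c => by
        ext r
        simp [dual_smul_apply, mul_comm s r, mul_smul] }
  left_inv f := by
    ext c r
    simp [dual_smul_apply]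
  right_inv φ := by
    ext c
    simp

theorem homDualEquiv_symm_apply_apply {C : Type u}
    [AddCommGroup C] [Module R C] [Module T C] [IsScalarTower T R C] (φ : C →ₗ[T] T) (c : C)
    (r : R) : (homDualEquiv T R C).symm φ c r = φ (r • c) := rfl

theorem homDualEquiv_apply {C : Type u}
    [AddCommGroup C] [Module R C] [Module T C] [IsScalarTower T R C] (f : C →ₗ[R] (R →ₗ[T] T))
    (c : C) : homDualEquiv T R C f c = f c 1 := rfl

section

variable (T R) (C : Type u) [AddCommGroup C] [Module R C]

instance free_homDual [Module T C] [IsScalarTower T R C] [Module.Finite T C] [Module.Free T C] :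
    Module.Free T (C →ₗ[R] (R →ₗ[T] T)) :=
  Module.Free.of_equiv (homDualEquiv T R C).symm

instance finite_homDual [Module T C] [IsScalarTower T R C] [Module.Finite T C] [Module.Free T C] :
    Module.Finite T (C →ₗ[R] (R →ₗ[T] T)) :=
  Module.Finite.equiv (homDualEquiv T R C).symm

theorem bijective_applyₗ_dual [Module T C] [IsScalarTower T R C] [Module.Finite T C]
    [Module.Free T C] :
    Bijective (LinearMap.applyₗ : C →ₗ[R] (C →ₗ[R] (R →ₗ[T] T)) →ₗ[R] (R →ₗ[T] T)) := by
  let e := homDualEquiv T R (C →ₗ[R] (R →ₗ[T] T)) ≪≫ₗ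
    LinearEquiv.congrLeft T T (homDualEquiv T R C)
  have h : ∀ c : C, e (LinearMap.applyₗ c) = Module.Dual.eval T C c := by
    intro c
    ext φ
    simp [e, homDualEquiv_symm_apply_apply, homDualEquiv_apply]
  have h2 := Module.bijective_dual_eval T C
  have h3 : (LinearMap.applyₗ : C →ₗ[R] (C →ₗ[R] (R →ₗ[T] T)) →ₗ[R] (R →ₗ[T] T)) =
      fun c => e.symm (Module.Dual.eval T C c) := by
    ext1 c
    rw [← h, LinearEquiv.symm_apply_apply]
  rw [h3]
  exact e.symm.bijective.comp h2

end

/-- If the dual of `C` is free over `T`, homomorphisms from `C` to a `T`-free module extend uniquely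
to the double dual of `C`. -/
theorem bijective_comp_applyₗ_dual (T R : Type u) [CommRing T] [CommRing R] [Algebra T R]
    (C M : Type u) [AddCommGroup C] [Module R C] [AddCommGroup M] [Module R M]
    [Module T M] [IsScalarTower T R M] [Module.Finite T M] [Module.Free T M]
    [Module.Finite T (C →ₗ[R] (R →ₗ[T] T))] [Module.Free T (C →ₗ[R] (R →ₗ[T] T))] :
    Bijective fun ψ : ((C →ₗ[R] (R →ₗ[T] T)) →ₗ[R] (R →ₗ[T] T)) →ₗ[R] M =>
      ψ ∘ₗ LinearMap.applyₗ := by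
  constructor
  · intro ψ₁ ψ₂ h
    ext1 δ
    apply (bijective_applyₗ_dual T R M).1
    ext1 f
    have key : ∀ ψ : ((C →ₗ[R] (R →ₗ[T] T)) →ₗ[R] (R →ₗ[T] T)) →ₗ[R] M,
        ∃ g, ∀ δ, f (ψ δ) = δ g := by
      intro ψ
      obtain ⟨g, hg⟩ := (bijective_applyₗ_dual T R (C →ₗ[R] (R →ₗ[T] T))).2 (f ∘ₗ ψ)
      exact ⟨g, fun δ => (LinearMap.congr_fun hg δ).symm⟩
    obtain ⟨g₁, hg₁⟩ := key ψ₁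
    obtain ⟨g₂, hg₂⟩ := key ψ₂
    have : g₁ = g₂ := by
      ext1 c
      have h1 := hg₁ (LinearMap.applyₗ c)
      have h2 := hg₂ (LinearMap.applyₗ c)
      have hc : ψ₁ (LinearMap.applyₗ c) = ψ₂ (LinearMap.applyₗ c) := LinearMap.congr_fun h c
      rw [hc, h2] at h1
      exact h1.symm
    change f (ψ₁ δ) = f (ψ₂ δ)
    rw [hg₁, hg₂, this]
  · intro φ
    let e := LinearEquiv.ofBijective _ (bijective_applyₗ_dual T R M)
    refine ⟨e.symm.toLinearMap ∘ₗ
      (LinearMap.lcomp R (R →ₗ[T] T) (LinearMap.lcomp R (R →ₗ[T] T) φ)), ?_⟩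
    ext1 c
    apply e.injective
    simp only [LinearMap.comp_apply, LinearEquiv.coe_coe, LinearEquiv.apply_symm_apply]
    rfl

end Duality

section ProjectiveDimension

theorem PDLE.of_equiv {A : Type u} [Ring A] {n : ℕ} {X Y : Type u} [AddCommGroup X] [Module A X]
    [AddCommGroup Y] [Module A Y] (e : X ≃ₗ[A] Y) (h : PDLE A n X) : PDLE A n Y := by
  cases n with
  | zero =>
    have : Module.Projective A X := h
    exact Module.Projective.of_equiv e
  | succ n =>
    refine h.imp (fun h : Module.Projective A X => Module.Projective.of_equiv e) ?_
    rintro ⟨ι, f, hf, h⟩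
    refine ⟨ι, e.toLinearMap ∘ₗ f, e.surjective.comp hf, ?_⟩
    rw [LinearEquiv.ker_comp]
    exact h

end ProjectiveDimension

section EndomorphismRing

variable {R : Type u} [CommRing R] {M : Type u} [AddCommGroup M] [Module R M]

/-- Homomorphisms `M ^ κ → M` form a free module over the endomorphism ring of `M`. -/
noncomputable def finsuppEndEquiv (R M : Type u) [CommRing R] [AddCommGroup M] [Module R M]
    (κ : Type*) [Fintype κ] [DecidableEq κ] :
    (κ →₀ Module.End R M) ≃ₗ[Module.End R M] ((κ → M) →ₗ[R] M) where
  toFun c := ∑ i, c i ∘ₗ LinearMap.proj i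
  map_add' a b := by simp [LinearMap.add_comp, Finset.sum_add_distrib]
  map_smul' a b := by
    refine LinearMap.ext fun x => ?_
    simp only [LinearMap.sum_apply, LinearMap.smul_apply, LinearMap.comp_apply, Finset.smul_sum,
      Finsupp.smul_apply, RingHom.id_apply]
  invFun f := Finsupp.equivFunOnFinite.symm fun i => f ∘ₗ LinearMap.single R (fun _ => M) i
  left_inv c := by
    ext i x
    simp [Pi.single_apply, apply_ite]
  right_inv f := by
    ext i x
    simp [Pi.single_apply, apply_ite]

theorem finsuppEndEquiv_comp_pi {κ : Type u} [Fintype κ] [DecidableEq κ] {C : Type u}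
    [AddCommGroup C] [Module R C] (φ : κ → (C →ₗ[R] M)) (c : κ →₀ Module.End R M) :
    finsuppEndEquiv R M κ c ∘ₗ LinearMap.pi φ = Finsupp.linearCombination (Module.End R M) φ c := by
  ext x
  simp [finsuppEndEquiv, Finsupp.linearCombination_apply, Finsupp.sum_fintype,
    LinearMap.sum_apply]

theorem nonempty_ker_linearCombination_equiv {κ : Type u} [Finite κ] {C : Type u}
    [AddCommGroup C] [Module R C] (φ : κ → (C →ₗ[R] M)) :
    Nonempty ((((κ → M) ⧸ LinearMap.range (LinearMap.pi φ)) →ₗ[R] M) ≃ₗ[Module.End R M]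
      LinearMap.ker (Finsupp.linearCombination (Module.End R M) φ)) := by
  classical
  cases nonempty_fintype κ
  let E := finsuppEndEquiv R M κ
  let G : (((κ → M) ⧸ LinearMap.range (LinearMap.pi φ)) →ₗ[R] M) →ₗ[Module.End R M]
      (κ → M) →ₗ[R] M :=
    { toFun := fun g => g ∘ₗ Submodule.mkQ _
      map_add' := fun a b => rfl
      map_smul' := fun a b => rfl }
  have hG : Injective (E.symm.toLinearMap ∘ₗ G) := by
    refine E.symm.injective.comp fun a b h => ?_
    exact LinearMap.cancel_right (Submodule.mkQ_surjective _) |>.mp h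
  refine ⟨LinearEquiv.ofInjective _ hG ≪≫ₗ LinearEquiv.ofEq _ _ ?_⟩
  ext c
  rw [LinearMap.mem_ker, ← finsuppEndEquiv_comp_pi]
  constructor
  · rintro ⟨g, rfl⟩
    ext x
    simp only [LinearMap.comp_apply, LinearEquiv.coe_coe]
    change E (E.symm (G g)) _ = _
    rw [LinearEquiv.apply_symm_apply]
    change g (Submodule.mkQ _ _) = _
    rw [Submodule.mkQ_apply, (Submodule.Quotient.mk_eq_zero _).mpr (LinearMap.mem_range_self _ x),
      map_zero]
    rfl
  · intro h
    refine ⟨Submodule.liftQ _ (E c) ?_, ?_⟩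
    · rintro _ ⟨x, rfl⟩
      exact LinearMap.congr_fun h x
    · change E.symm (G _) = c
      rw [LinearEquiv.symm_apply_eq]
      exact Submodule.liftQ_mkQ _ _ _

/-- One syzygy over the endomorphism ring of `M`: a submodule of `Hom(C, M)` generated by a
finite family `φ` has the module `Hom(C', M)` as syzygy, where `C'` is the cokernel of the map
with components `φ`. -/
theorem PDLE.succ_of_range_eq {κ : Type u} [Finite κ] {C : Type u}
    [AddCommGroup C] [Module R C] (φ : κ → (C →ₗ[R] M)) {m : ℕ} {X : Type u} [AddCommGroup X]
    [Module (Module.End R M) X] {u : X →ₗ[Module.End R M] (C →ₗ[R] M)} (hu : Injective u)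
    (hX : LinearMap.range u = Submodule.span (Module.End R M) (Set.range φ))
    (h : PDLE (Module.End R M) m (((κ → M) ⧸ LinearMap.range (LinearMap.pi φ)) →ₗ[R] M)) :
    PDLE (Module.End R M) (m + 1) X := by
  obtain ⟨e⟩ := nonempty_ker_linearCombination_equiv φ
  have hr : LinearMap.range (Finsupp.linearCombination (Module.End R M) φ) = LinearMap.range u := by
    rw [hX, Finsupp.range_linearCombination]
  let v := LinearEquiv.ofEq _ _ hr ≪≫ₗ (LinearEquiv.ofInjective u hu).symm
  refine Or.inr ⟨κ, v.toLinearMap ∘ₗ LinearMap.rangeRestrict _,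
    v.surjective.comp (LinearMap.surjective_rangeRestrict _), ?_⟩
  rw [LinearEquiv.ker_comp, LinearMap.ker_rangeRestrict]
  exact h.of_equiv e

theorem projective_linearMap_of_isDirectSummand {l : ℕ} {D : Type u}
    [AddCommGroup D] [Module R D] (h : IsDirectSummand R D (Fin l → M)) :
    Module.Projective (Module.End R M) (D →ₗ[R] M) := by
  obtain ⟨i, p, hpi⟩ := h
  let I : (D →ₗ[R] M) →ₗ[Module.End R M] ((Fin l → M) →ₗ[R] M) :=
    { toFun := fun g => g ∘ₗ p
      map_add' := fun a b => rfl
      map_smul' := fun a b => rfl }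
  let P : ((Fin l → M) →ₗ[R] M) →ₗ[Module.End R M] (D →ₗ[R] M) :=
    { toFun := fun g => g ∘ₗ i
      map_add' := fun a b => rfl
      map_smul' := fun a b => rfl }
  have : Module.Projective (Module.End R M) ((Fin l → M) →ₗ[R] M) :=
    Module.Projective.of_equiv (finsuppEndEquiv R M (Fin l))
  refine Module.Projective.of_split I P ?_
  ext1 g
  change (g ∘ₗ p) ∘ₗ i = g
  rw [LinearMap.comp_assoc, hpi, LinearMap.comp_id]

theorem finite_linearMap_end [IsNoetherianRing R] [Module.Finite R M] (C : Type u)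
    [AddCommGroup C] [Module R C] [Module.Finite R C] :
    Module.Finite (Module.End R M) (C →ₗ[R] M) :=
  Module.Finite.of_restrictScalars_finite R _ _

theorem isNoetherianRing_end [IsNoetherianRing R] [Module.Finite R M] :
    IsNoetherianRing (Module.End R M) :=
  IsNoetherianRing.of_finite R _

end EndomorphismRing

section Syzygies

/-- Precomposition with an `R`-linear map, as a map linear over `T`. -/
def lcompTower (T W : Type u) {R : Type u} [CommRing T] [CommRing R] [AddCommGroup W] [Module R W]
    [Module T W] [SMulCommClass R T W] {C F : Type u} [AddCommGroup C] [Module R C]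
    [AddCommGroup F] [Module R F] (Φ : C →ₗ[R] F) : (F →ₗ[R] W) →ₗ[T] (C →ₗ[R] W) where
  toFun g := g ∘ₗ Φ
  map_add' _ _ := rfl
  map_smul' _ _ := rfl

theorem isWeaklyRegular_linearMap_coker {T R : Type u} [CommRing T] [CommRing R] {W : Type u}
    [AddCommGroup W] [Module R W] [Module T W] [SMulCommClass R T W]
    {xs : List T} {j : ℕ} {C F : Type u} [AddCommGroup C] [Module R C] [AddCommGroup F] [Module R F]
    (Φ : C →ₗ[R] F) (hF : IsWeaklyRegular (F →ₗ[R] W) xs)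
    (hZ : IsWeaklyRegular
      (LinearMap.range (lcompTower T W Φ)) (xs.take j)) :
    IsWeaklyRegular ((F ⧸ LinearMap.range Φ) →ₗ[R] W) (xs.take (j + 1)) := by
  refine isWeaklyRegular_take_succ_of_exact xs j
    (f := lcompTower T W (LinearMap.range Φ).mkQ)
    (g := (lcompTower T W Φ).rangeRestrict) ?_ ?_
    (LinearMap.surjective_rangeRestrict _) hF hZ
  · intro a b h
    exact LinearMap.cancel_right (Submodule.mkQ_surjective _) |>.mp h
  · intro g
    rw [← LinearMap.mem_ker, LinearMap.ker_rangeRestrict, LinearMap.mem_ker]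
    constructor
    · intro h
      refine ⟨Submodule.liftQ _ g ?_, Submodule.liftQ_mkQ _ _ _⟩
      rintro _ ⟨x, rfl⟩
      exact LinearMap.congr_fun h x
    · rintro ⟨g, rfl⟩
      ext1 x
      change g (Submodule.mkQ _ _) = _
      rw [Submodule.mkQ_apply, (Submodule.Quotient.mk_eq_zero _).mpr (LinearMap.mem_range_self _ x),
        map_zero]
      rfl

theorem isWeaklyRegular_linearMap_coker_two {T R : Type u} [CommRing T] [CommRing R] {W : Type u}
    [AddCommGroup W] [Module R W] [Module T W] [SMulCommClass R T W]
    {xs : List T} {C F : Type u} [AddCommGroup C] [Module R C] [AddCommGroup F] [Module R F]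
    (Φ : C →ₗ[R] F) (hC : IsWeaklyRegular (C →ₗ[R] W) xs) (hF : IsWeaklyRegular (F →ₗ[R] W) xs) :
    IsWeaklyRegular ((F ⧸ LinearMap.range Φ) →ₗ[R] W) (xs.take 2) := by
  refine isWeaklyRegular_linearMap_coker Φ hF ?_
  refine isWeaklyRegular_take_succ_of_exact xs 0 (Submodule.subtype_injective _)
    (LinearMap.exact_subtype_mkQ _) (Submodule.mkQ_surjective _) hC ?_
  simp

section

variable {T R : Type u} [CommRing T] [IsLocalRing T] [IsNoetherianRing T] [CommRing R]
  [IsNoetherianRing R] [Algebra T R] [Module.Finite T R] [Module.Free T R]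
  {M : Type u} [AddCommGroup M] [Module R M] [Module T M] [IsScalarTower T R M]
  [Module.Finite T M] [Module.Free T M]

theorem finite_homDual_of_finite (T R C : Type u) [CommRing T] [CommRing R]
    [IsNoetherianRing R] [Algebra T R] [Module.Finite T R] [Module.Free T R]
    [AddCommGroup C] [Module R C] [Module.Finite R C] :
    Module.Finite T (C →ₗ[R] (R →ₗ[T] T)) := by
  have : Module.Finite R (R →ₗ[T] T) := Module.Finite.of_restrictScalars_finite T R _
  exact Module.Finite.trans R _

theorem pdle_linearMap {xs : List T} (hxs : Ideal.ofList xs = maximalIdeal T)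
    (hreg : IsWeaklyRegular T xs) (hω : IsDirectSummand R (R →ₗ[T] T) M)
    (hgen : ∀ (D : Type u) [AddCommGroup D] [Module R D] [Module T D] [IsScalarTower T R D],
      Module.Finite T D → Module.Free T D → ∃ l : ℕ, IsDirectSummand R D (Fin l → M)) (m : ℕ) :
    ∀ (j : ℕ) (C : Type u) [AddCommGroup C] [Module R C], Module.Finite R C →
      IsWeaklyRegular (C →ₗ[R] (R →ₗ[T] T)) (xs.take j) → xs.length ≤ m + j →
      PDLE (Module.End R M) m (C →ₗ[R] M) := by
  induction m with
  | zero =>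
    intro j C _ _ hC hj hlen
    have := finite_homDual_of_finite T R C
    rw [List.take_of_length_le (by omega)] at hj
    have := free_of_isWeaklyRegular hxs hj
    have hD := free_homDual T R (C →ₗ[R] (R →ₗ[T] T))
    have hD' := finite_homDual T R (C →ₗ[R] (R →ₗ[T] T))
    obtain ⟨l, hl⟩ := hgen ((C →ₗ[R] (R →ₗ[T] T)) →ₗ[R] (R →ₗ[T] T)) hD' hD
    have := projective_linearMap_of_isDirectSummand hl
    let ρ : (((C →ₗ[R] (R →ₗ[T] T)) →ₗ[R] (R →ₗ[T] T)) →ₗ[R] M) →ₗ[Module.End R M]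
        (C →ₗ[R] M) :=
      { toFun := fun ψ => ψ ∘ₗ LinearMap.applyₗ
        map_add' := fun a b => rfl
        map_smul' := fun a b => rfl }
    exact Module.Projective.of_equiv
      (LinearEquiv.ofBijective ρ (bijective_comp_applyₗ_dual T R C M))
  | succ m ih =>
    intro j C _ _ hC hj hlen
    have : Module.Finite R M := Module.Finite.of_restrictScalars_finite T R M
    have := finite_linearMap_end (R := R) (M := M) C
    obtain ⟨S, hS⟩ := Module.Finite.fg_top (R := Module.End R M) (M := C →ₗ[R] M)
    let φ : S → (C →ₗ[R] M) := Subtype.val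
    have hφ : Submodule.span (Module.End R M) (Set.range φ) = ⊤ := by
      rw [← hS, Subtype.range_coe]
    refine PDLE.succ_of_range_eq φ (u := LinearMap.id) injective_id
      (by rw [hφ, LinearMap.range_id]) ?_
    refine ih (j + 1) _ inferInstance ?_ (by omega)
    refine isWeaklyRegular_linearMap_coker _ (isWeaklyRegular_of_free hreg) ?_
    refine (LinearEquiv.isWeaklyRegular_congr (LinearEquiv.ofTop _ ?_) _).mpr hj
    rw [LinearMap.range_eq_top]
    intro f
    classical
    obtain ⟨i, p, hpi⟩ := hω
    have hf : i ∘ₗ f ∈ Submodule.span (Module.End R M) (Set.range φ) := hφ ▸ trivial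
    rw [← Finsupp.range_linearCombination] at hf
    obtain ⟨c, hc⟩ := hf
    rw [← finsuppEndEquiv_comp_pi] at hc
    refine ⟨p ∘ₗ finsuppEndEquiv R M S c, ?_⟩
    change (p ∘ₗ _) ∘ₗ _ = f
    rw [LinearMap.comp_assoc, hc, ← LinearMap.comp_assoc, hpi, LinearMap.id_comp]

theorem globalDimLE_end {xs : List T} (hxs : Ideal.ofList xs = maximalIdeal T)
    (hreg : IsWeaklyRegular T xs) (hω : IsDirectSummand R (R →ₗ[T] T) M)
    (hgen : ∀ (D : Type u) [AddCommGroup D] [Module R D] [Module T D] [IsScalarTower T R D],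
      Module.Finite T D → Module.Free T D → ∃ l : ℕ, IsDirectSummand R D (Fin l → M))
    {n : ℕ} (hn : 2 ≤ n) (hlen : xs.length ≤ n) : GlobalDimLE (Module.End R M) n := by
  intro X _ _ hX
  classical
  obtain ⟨m, rfl⟩ := Nat.exists_eq_add_of_le' hn
  have : Module.Finite R M := Module.Finite.of_restrictScalars_finite T R M
  have := isNoetherianRing_end (R := R) (M := M)
  obtain ⟨S, hS⟩ := Module.Finite.fg_top (R := Module.End R M) (M := X)
  let q : (S →₀ Module.End R M) →ₗ[Module.End R M] X :=
    Finsupp.linearCombination (Module.End R M) Subtype.val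
  have hq : Surjective q := by
    rw [← LinearMap.range_eq_top, Finsupp.range_linearCombination, Subtype.range_coe]
    exact hS
  refine Or.inr ⟨S, q, hq, ?_⟩
  let u : LinearMap.ker q →ₗ[Module.End R M] ((S → M) →ₗ[R] M) :=
    (finsuppEndEquiv R M S).toLinearMap ∘ₗ (LinearMap.ker q).subtype
  have := Module.Finite.equiv (finsuppEndEquiv R M S)
  obtain ⟨G, hG⟩ := IsNoetherian.noetherian (LinearMap.range u)
  let φ : G → ((S → M) →ₗ[R] M) := Subtype.val
  refine PDLE.succ_of_range_eq φ (u := u)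
    ((finsuppEndEquiv R M S).injective.comp Subtype.val_injective)
    (by rw [← hG, Subtype.range_coe]) ?_
  refine pdle_linearMap hxs hreg hω hgen m 2 _ inferInstance ?_ (by omega)
  exact isWeaklyRegular_linearMap_coker_two _ (isWeaklyRegular_of_free hreg)
    (isWeaklyRegular_of_free hreg)

end

end Syzygies

section DirectSummand

variable {R : Type u} [CommRing R] {X Y Z W : Type u} [AddCommGroup X] [Module R X]
  [AddCommGroup Y] [Module R Y] [AddCommGroup Z] [Module R Z] [AddCommGroup W] [Module R W]

theorem IsDirectSummand.of_equiv (e : X ≃ₗ[R] Y) : IsDirectSummand R X Y :=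
  ⟨e, e.symm, by ext; simp⟩

theorem IsDirectSummand.trans (h : IsDirectSummand R X Y) (h' : IsDirectSummand R Y Z) :
    IsDirectSummand R X Z := by
  obtain ⟨i, p, hpi⟩ := h
  obtain ⟨i', p', hpi'⟩ := h'
  refine ⟨i' ∘ₗ i, p ∘ₗ p', ?_⟩
  rw [LinearMap.comp_assoc, ← LinearMap.comp_assoc i, hpi', LinearMap.id_comp, hpi]

theorem IsDirectSummand.prodMap (h : IsDirectSummand R X Y) (h' : IsDirectSummand R Z W) :
    IsDirectSummand R (X × Z) (Y × W) := by
  obtain ⟨i, p, hpi⟩ := h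
  obtain ⟨i', p', hpi'⟩ := h'
  refine ⟨i.prodMap i', p.prodMap p', ?_⟩
  rw [LinearMap.prodMap_comp, hpi, hpi', LinearMap.prodMap_id]

theorem IsDirectSummand.prod_left : IsDirectSummand R X (X × Y) :=
  ⟨LinearMap.inl R X Y, LinearMap.fst R X Y, LinearMap.fst_comp_inl ..⟩

theorem IsDirectSummand.prod_right : IsDirectSummand R Y (X × Y) :=
  ⟨LinearMap.inr R X Y, LinearMap.snd R X Y, LinearMap.snd_comp_inr ..⟩

theorem IsDirectSummand.pi {ι : Type} (V : ι → Type u) [∀ i, AddCommGroup (V i)]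
    [∀ i, Module R (V i)] (i : ι) : IsDirectSummand R (V i) (∀ i, V i) := by
  classical
  exact ⟨LinearMap.single R V i, LinearMap.proj i, LinearMap.proj_comp_single_same ..⟩

theorem IsDirectSummand.of_isCompl {A B : Submodule R X} (h : IsCompl A B) {a b : ℕ}
    (ha : IsDirectSummand R A (Fin a → Y)) (hb : IsDirectSummand R B (Fin b → Y)) :
    IsDirectSummand R X (Fin (a + b) → Y) :=
  (of_equiv (A.prodEquivOfIsCompl B h).symm).trans ((ha.prodMap hb).trans
    (of_equiv ((LinearEquiv.sumArrowLequivProdArrow (Fin a) (Fin b) R Y).symm ≪≫ₗ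
      LinearEquiv.funCongrLeft R Y finSumFinEquiv.symm)))

end DirectSummand

section Decomposition

variable {T R : Type u} [CommRing T] [IsLocalRing T] [CommRing R] [Algebra T R]

theorem IsCompl.finite_and_free {D : Type u} [AddCommGroup D] [Module R D] [Module T D]
    [IsScalarTower T R D] [Module.Finite T D] [Module.Free T D] {A B : Submodule R D}
    (h : IsCompl A B) : Module.Finite T A ∧ Module.Free T A := by
  let p := (A.projectionOnto B h).restrictScalars T
  have hp : p ∘ₗ A.subtype.restrictScalars T = LinearMap.id := by
    ext x
    simp [p]
  have hfin : Module.Finite T A :=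
    Module.Finite.of_surjective p fun x => ⟨x, LinearMap.congr_fun hp x⟩
  have : Module.Projective T A := Module.Projective.of_split _ p hp
  exact ⟨hfin, Module.free_of_flat_of_isLocalRing⟩

theorem exists_isDirectSummand_pow {M : Type u} [AddCommGroup M] [Module R M]
    (hM : ∀ (D : Type u) [AddCommGroup D] [Module R D] [Module T D] [IsScalarTower T R D],
      Module.Finite T D → Module.Free T D → IndecomposableModule R D → IsDirectSummand R D M)
    (n : ℕ) : ∀ (D : Type u) [AddCommGroup D] [Module R D] [Module T D] [IsScalarTower T R D],
      Module.finrank T D = n → Module.Finite T D → Module.Free T D →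
      ∃ l : ℕ, IsDirectSummand R D (Fin l → M) := by
  induction n using Nat.strong_induction_on with
  | _ n ih =>
    intro D _ _ _ _ hn hfin hfree
    by_cases hD : IndecomposableModule R D
    · exact ⟨1, (hM D hfin hfree hD).trans (.of_equiv (LinearEquiv.funUnique (Fin 1) R M).symm)⟩
    cases subsingleton_or_nontrivial D with
    | inl h => exact ⟨0, 0, 0, Subsingleton.elim _ _⟩
    | inr h =>
      simp only [IndecomposableModule, h, true_and, not_forall, not_or] at hD
      obtain ⟨A, B, hAB, hA, hB⟩ := hD
      obtain ⟨hAfin, hAfree⟩ := hAB.finite_and_free (T := T)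
      obtain ⟨hBfin, hBfree⟩ := hAB.symm.finite_and_free (T := T)
      have hrank := ((A.prodEquivOfIsCompl B hAB).restrictScalars T).finrank_eq
      rw [Module.finrank_prod, hn] at hrank
      have hpos : ∀ A : Submodule R D, Module.Finite T A → Module.Free T A → A ≠ ⊥ →
          0 < Module.finrank T A := by
        intro A _ _ hA
        have := Submodule.nontrivial_iff_ne_bot.mpr hA
        exact (Module.finrank_pos_iff_of_free T A).mpr this
      have := hpos A hAfin hAfree hA
      have := hpos B hBfin hBfree hB
      obtain ⟨a, ha⟩ := ih _ (by omega) A rfl hAfin hAfree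
      obtain ⟨b, hb⟩ := ih _ (by omega) B rfl hBfin hBfree
      exact ⟨a + b, .of_isCompl hAB ha hb⟩

theorem isMCM_of_free [IsLocalRing R] [Module.Finite T R] [FaithfulSMul T R] {xs : List T}
    (hxs : Ideal.ofList xs = maximalIdeal T) (hreg : IsWeaklyRegular T xs) (D : Type u)
    [AddCommGroup D] [Module R D] [Module T D] [IsScalarTower T R D] [Module.Finite T D]
    [Module.Free T D] : IsMCM R xs.length D := by
  refine ⟨Module.Finite.of_restrictScalars_finite T R D, xs.map (algebraMap T R), by simp, ?_, ?_⟩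
  · intro r hr
    obtain ⟨t, ht, rfl⟩ := List.mem_map.mp hr
    have hloc : IsLocalHom (algebraMap T R) := inferInstance
    have : t ∈ maximalIdeal T := hxs ▸ Ideal.subset_span ht
    exact (mem_maximalIdeal _).mpr fun h => (mem_maximalIdeal t).mp this (hloc.map_nonunit t h)
  · rw [isWeaklyRegular_map_algebraMap_iff]
    exact isWeaklyRegular_of_free hreg

end Decomposition

section Assembly

theorem ringKrullDim_eq_length_of_finite_free {T R : Type u} [CommRing T] [IsLocalRing T]
    [CommRing R] [IsLocalRing R] [IsNoetherianRing R] [Algebra T R] [Module.Finite T R]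
    [Module.Free T R] {xs : List T} (hxs : Ideal.ofList xs = maximalIdeal T)
    (hreg : IsWeaklyRegular T xs) : ringKrullDim R = xs.length := by
  have hmap : Ideal.ofList (xs.map (algebraMap T R)) = (maximalIdeal T).map (algebraMap T R) := by
    rw [← Ideal.map_ofList, hxs]
  have hloc : IsLocalHom (algebraMap T R) := inferInstance
  have hle : (maximalIdeal T).map (algebraMap T R) ≤ maximalIdeal R :=
    ((local_hom_TFAE (algebraMap T R)).out 0 2).mp hloc
  have hR : IsRegular R (xs.map (algebraMap T R)) := by
    refine ⟨(isWeaklyRegular_map_algebraMap_iff R R xs).mpr (isWeaklyRegular_of_free hreg), ?_⟩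
    rw [smul_eq_mul, Ideal.mul_top, hmap]
    exact fun h => (maximalIdeal.isMaximal R).ne_top (top_le_iff.mp (h.trans_le hle))
  rw [← ringKrullDim_add_length_eq_ringKrullDim_of_isRegular _ hR, hmap, List.length_map]
  have : Nontrivial (R ⧸ (maximalIdeal T).map (algebraMap T R)) :=
    Ideal.Quotient.nontrivial_iff.mpr (ne_top_of_le_ne_top (maximalIdeal.isMaximal R).ne_top hle)
  have : IsArtinianRing (T ⧸ maximalIdeal T) :=
    inferInstanceAs (IsArtinianRing (ResidueField T))
  have : Module.Finite (T ⧸ maximalIdeal T) (R ⧸ (maximalIdeal T).map (algebraMap T R)) :=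
    Module.Finite.of_restrictScalars_finite T _ _
  have : IsArtinianRing (R ⧸ (maximalIdeal T).map (algebraMap T R)) :=
    IsArtinianRing.of_finite (T ⧸ maximalIdeal T) _
  rw [ringKrullDimZero_iff_ringKrullDim_eq_zero.mp inferInstance, zero_add]

theorem exists_isWeaklyRegular_of_isRegularLocal {T : Type u} [CommRing T] [IsLocalRing T]
    [IsNoetherianRing T] (h : IsRegularLocal T) :
    ∃ xs : List T, Ideal.ofList xs = maximalIdeal T ∧ IsWeaklyRegular T xs := by
  obtain ⟨n, s, hn, hs, hspan⟩ := h
  obtain ⟨_, xs, _, h1, h2⟩ := isDomain_and_exists_isWeaklyRegular n T s hspan hs.le hn.ge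
  exact ⟨xs, h1, h2⟩

theorem free_restrictScalars_of_equiv {T R D E : Type u} [CommRing T] [CommRing R] [Algebra T R]
    [AddCommGroup D] [Module R D] [Module T D] [IsScalarTower T R D] [AddCommGroup E] [Module R E]
    [Module.Free T D] (e : D ≃ₗ[R] E) : Module.Free T (RestrictScalars T R E) := by
  let _ : Module R (RestrictScalars T R E) := RestrictScalars.moduleOrig T R E
  let e' : D ≃ₗ[R] RestrictScalars T R E := e
  exact Module.Free.of_equiv (e'.restrictScalars T)

end Assembly

/-- Let `R` be a complete Cohen–Macaulay local ring of finite
Cohen–Macaulay type, viewed via Cohen's structure theorem as a finitely generated free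
module over a complete regular local ring `T`.  Then the representation dimension of `R`
— the infimum of `gldim End_R(R ⊕ Hom_T(R,T) ⊕ N)` over finitely generated `R`-modules
`N` that are free over `T` — is at most `max {2, dim R}`. -/
theorem repdim_le_of_finiteCMType
    (T : Type u) [CommRing T] [IsLocalRing T] [IsNoetherianRing T]
    (hTreg : IsRegularLocal T)
    (hTcomp : IsAdicComplete (IsLocalRing.maximalIdeal T) T)
    (R : Type u) [CommRing R] [IsLocalRing R] [IsNoetherianRing R] [Algebra T R]
    (hRT : Module.Finite T R) (hRTfree : Module.Free T R)
    (hRcomp : IsAdicComplete (IsLocalRing.maximalIdeal R) R)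
    (d : ℕ) (hCM : IsCMLocal R d) (hfcm : FiniteCMType R d) :
    ∃ N : ModuleCat.{u} R, Module.Finite R N ∧
      Module.Free T (RestrictScalars T R N) ∧
      GlobalDimLE (Module.End R (R × (R →ₗ[T] T) × N)) (max 2 d) := by
  obtain ⟨xs, hxs, hreg⟩ := exists_isWeaklyRegular_of_isRegularLocal hTreg
  have hlen : xs.length = d := by
    have h := (ringKrullDim_eq_length_of_finite_free (R := R) hxs hreg).symm.trans hCM.1
    exact_mod_cast h
  obtain ⟨k, V, hV⟩ := hfcm
  let I := {i : Fin k // Module.Finite R (V i) ∧ Module.Free T (RestrictScalars T R (V i))}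
  let N : Type u := ∀ i : I, V i
  have hVfin : ∀ i : I, Module.Finite R (V i) := fun i => i.2.1
  let tV : ∀ i : I, Module T (V i) := fun i => Module.compHom (V i) (algebraMap T R)
  have hVtower : ∀ i : I, IsScalarTower T R (V i) :=
    fun i => IsScalarTower.of_algebraMap_smul fun _ _ => rfl
  have hVfree : ∀ i : I, Module.Free T (V i) := fun i => i.2.2
  have hVfin' : ∀ i : I, Module.Finite T (V i) := fun i => Module.Finite.trans R (V i)
  refine ⟨ModuleCat.of R N, inferInstanceAs (Module.Finite R N),
    free_restrictScalars_of_equiv (LinearEquiv.refl R N), ?_⟩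
  change GlobalDimLE (Module.End R (R × (R →ₗ[T] T) × N)) (max 2 d)
  refine globalDimLE_end hxs hreg (IsDirectSummand.prod_left.trans .prod_right) ?_
    (le_max_left 2 d) (hlen.le.trans (le_max_right 2 d))
  intro D _ _ _ _ hD hD'
  refine exists_isDirectSummand_pow (T := T) ?_ _ D rfl hD hD'
  intro D _ _ _ _ hD hD' hind
  obtain ⟨i, ⟨e⟩⟩ := hV D (hlen ▸ isMCM_of_free hxs hreg D) hind
  have : Module.Finite R D := Module.Finite.of_restrictScalars_finite T R D
  let j : I := ⟨i, Module.Finite.equiv e, free_restrictScalars_of_equiv e⟩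
  exact (IsDirectSummand.of_equiv e).trans ((IsDirectSummand.pi (fun i : I => V i) j).trans
    (IsDirectSummand.prod_right.trans .prod_right))
end

section
/- Let R be a Gorenstein Cohen–Macaulay local normal domain of dimension d ≥ 2 with finite Cohen–Macaulay type, and let M be a representation generator. If A = End_R(M) is a maximal Cohen–Macaulay R-module, then A is a non-commutative crepant resolution of R: A = End_R(M) with M finitely generated reflexive, A MCM over R, and gldim A_p = dim R_p for all primes p. -/
set_option synthInstance.maxHeartbeats 1000000
set_option maxHeartbeats 1000000

universe u

/-- Injective dimension at most `n` over a ring `A`. -/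
def IDLE (A : Type u) [Ring A] : ℕ → (M : Type u) → [AddCommGroup M] → [Module A M] → Prop
  | 0, M, _, _ => Module.Injective A M
  | n + 1, M, _, _ => Module.Injective A M ∨
      ∃ (I : ModuleCat.{u} A) (f : M →ₗ[A] I), Module.Injective A I ∧ Function.Injective f ∧
        IDLE A n (I ⧸ LinearMap.range f)

/-- A Gorenstein local ring: a Noetherian local ring of finite self-injective dimension. -/
def IsGorensteinLocal (R : Type u) [CommRing R] [IsLocalRing R] : Prop :=
  IsNoetherianRing R ∧ ∃ n : ℕ, IDLE R n R

section

open CategoryTheory Abelian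

/-- Vanishing of `Ext^i_S(X, S)`. -/
def ExtVanish (S : Type u) [CommRing S] (i : ℕ) (X : Type u) [AddCommGroup X] [Module S X] :
    Prop :=
  Subsingleton (Ext (ModuleCat.of S X) (ModuleCat.of S S) i)

section ExtVanish

variable {S : Type u} [CommRing S]
variable {X Y Z : Type u} [AddCommGroup X] [Module S X] [AddCommGroup Y] [Module S Y]
  [AddCommGroup Z] [Module S Z]

/-- The short exact sequence in `ModuleCat` attached to a short exact sequence of modules. -/
abbrev shortComplexOfExact {A : Type u} [Ring A] {X Y Z : Type u} [AddCommGroup X] [Module A X]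
    [AddCommGroup Y] [Module A Y] [AddCommGroup Z] [Module A Z]
    {f : X →ₗ[A] Y} {g : Y →ₗ[A] Z} (h : Function.Exact f g) : ShortComplex (ModuleCat.{u} A) :=
  ShortComplex.mk (ModuleCat.ofHom f) (ModuleCat.ofHom g)
    (by ext x; exact h.apply_apply_eq_zero x)

lemma shortExact_shortComplexOfExact {A : Type u} [Ring A] {X Y Z : Type u} [AddCommGroup X]
    [Module A X] [AddCommGroup Y] [Module A Y] [AddCommGroup Z] [Module A Z]
    {f : X →ₗ[A] Y} {g : Y →ₗ[A] Z} (h : Function.Exact f g) (hf : Function.Injective f)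
    (hg : Function.Surjective g) : (shortComplexOfExact h).ShortExact :=
  ModuleCat.shortComplex_shortExact _ h hf hg

lemma ExtVanish.of_projective [Module.Projective S X] {i : ℕ} (hi : 1 ≤ i) : ExtVanish S i X := by
  have : Projective (ModuleCat.of S X) := inferInstance
  obtain ⟨j, rfl⟩ : ∃ j, i = j + 1 := ⟨i - 1, by omega⟩
  exact Ext.subsingleton_of_projective _ _ j

lemma ExtVanish.of_retract {i : ℕ} (hY : ExtVanish S i Y) (f : X →ₗ[S] Y) (g : Y →ₗ[S] X)
    (h : g ∘ₗ f = LinearMap.id) : ExtVanish S i X := by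
  refine ⟨fun a b ↦ ?_⟩
  have key (c : Ext (ModuleCat.of S X) (ModuleCat.of S S) i) : c = 0 := by
    have h1 : (Ext.mk₀ (ModuleCat.ofHom f)).comp
        ((Ext.mk₀ (ModuleCat.ofHom g)).comp c (zero_add i)) (zero_add i) = c := by
      rw [Ext.mk₀_comp_mk₀_assoc, ← ModuleCat.ofHom_comp, h]
      exact Ext.mk₀_id_comp c
    rw [← h1, hY.elim ((Ext.mk₀ (ModuleCat.ofHom g)).comp c (zero_add i)) 0, Ext.comp_zero]
  rw [key a, key b]

lemma ExtVanish.of_equiv {i : ℕ} (hY : ExtVanish S i Y) (e : X ≃ₗ[S] Y) : ExtVanish S i X :=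
  hY.of_retract e.toLinearMap e.symm.toLinearMap (by ext; simp)

variable {f : X →ₗ[S] Y} {g : Y →ₗ[S] Z}

lemma ExtVanish.of_left_of_middle (h : Function.Exact f g) (hf : Function.Injective f)
    (hg : Function.Surjective g) {i : ℕ} (hX : ExtVanish S i X) (hY : ExtVanish S (i + 1) Y) :
    ExtVanish S (i + 1) Z := by
  refine ⟨fun a b ↦ ?_⟩
  have key (c : Ext (ModuleCat.of S Z) (ModuleCat.of S S) (i + 1)) : c = 0 := by
    obtain ⟨x, hx⟩ := Ext.contravariant_sequence_exact₃
      (shortExact_shortComplexOfExact h hf hg) _ c (hY.elim _ _) (add_comm 1 i)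
    rw [← hx, hX.elim x 0, Ext.comp_zero]
  rw [key a, key b]

lemma ExtVanish.of_middle_of_right (h : Function.Exact f g) (hf : Function.Injective f)
    (hg : Function.Surjective g) {i : ℕ} (hY : ExtVanish S i Y) (hZ : ExtVanish S (i + 1) Z) :
    ExtVanish S i X := by
  refine ⟨fun a b ↦ ?_⟩
  have key (c : Ext (ModuleCat.of S X) (ModuleCat.of S S) i) : c = 0 := by
    obtain ⟨x, hx⟩ := Ext.contravariant_sequence_exact₁
      (shortExact_shortComplexOfExact h hf hg) _ c (add_comm 1 i) (hZ.elim _ _)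
    rw [← hx, hY.elim x 0, Ext.comp_zero]
  rw [key a, key b]

lemma ExtVanish.of_left_of_right (h : Function.Exact f g) (hf : Function.Injective f)
    (hg : Function.Surjective g) {i : ℕ} (hX : ExtVanish S i X) (hZ : ExtVanish S i Z) :
    ExtVanish S i Y := by
  refine ⟨fun a b ↦ ?_⟩
  have key (c : Ext (ModuleCat.of S Y) (ModuleCat.of S S) i) : c = 0 := by
    obtain ⟨x, hx⟩ := Ext.contravariant_sequence_exact₂
      (shortExact_shortComplexOfExact h hf hg) _ c (hX.elim _ _)
    rw [← hx, hZ.elim x 0, Ext.comp_zero]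
  rw [key a, key b]

lemma ExtVanish.of_subsingleton [Subsingleton X] (i : ℕ) : ExtVanish S i X := by
  refine ⟨fun a b ↦ ?_⟩
  have key (c : Ext (ModuleCat.of S X) (ModuleCat.of S S) i) : c = 0 := by
    rw [← Ext.mk₀_id_comp c, show (𝟙 (ModuleCat.of S X)) = 0 from
      ModuleCat.hom_ext (LinearMap.ext fun x ↦ Subsingleton.elim (α := X) _ _)]
    simp
  rw [key a, key b]

lemma ExtVanish.pi {i : ℕ} (hX : ExtVanish S i X) (n : ℕ) : ExtVanish S i (Fin n → X) := by
  induction n with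
  | zero => exact ExtVanish.of_subsingleton i
  | succ n ih =>
    refine ExtVanish.of_equiv (Y := X × (Fin n → X)) ?_ (Fin.consLinearEquiv S fun _ ↦ X).symm
    exact ExtVanish.of_left_of_right (f := LinearMap.inl S X (Fin n → X))
      (g := LinearMap.snd S X (Fin n → X)) .inl_snd LinearMap.inl_injective
      LinearMap.snd_surjective hX ih

lemma ExtVanish.exists_extend (h : Function.Exact f g) (hf : Function.Injective f)
    (hg : Function.Surjective g) (hZ : ExtVanish S 1 Z) (φ : X →ₗ[S] S) :
    ∃ ψ : Y →ₗ[S] S, ψ ∘ₗ f = φ := by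
  obtain ⟨x, hx⟩ := Ext.contravariant_sequence_exact₁
      (shortExact_shortComplexOfExact h hf hg) _ (Ext.mk₀ (ModuleCat.ofHom φ)) (add_comm 1 0)
      (hZ.elim _ _)
  obtain ⟨ψ, rfl⟩ := (Ext.mk₀_bijective _ _).2 x
  rw [Ext.mk₀_comp_mk₀, (Ext.mk₀_bijective _ _).1.eq_iff] at hx
  exact ⟨ψ.hom, by simpa using congrArg ModuleCat.Hom.hom hx⟩

lemma ExtVanish.one_of_extend (h : Function.Exact f g) (hf : Function.Injective f)
    (hg : Function.Surjective g) (hY : ExtVanish S 1 Y)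
    (hext : ∀ φ : X →ₗ[S] S, ∃ ψ : Y →ₗ[S] S, ψ ∘ₗ f = φ) : ExtVanish S 1 Z := by
  refine ⟨fun a b ↦ ?_⟩
  have key (c : Ext (ModuleCat.of S Z) (ModuleCat.of S S) 1) : c = 0 := by
    obtain ⟨x, hx⟩ := Ext.contravariant_sequence_exact₃
      (shortExact_shortComplexOfExact h hf hg) _ c (hY.elim _ _) (add_comm 1 0)
    obtain ⟨φ, rfl⟩ := (Ext.mk₀_bijective _ _).2 x
    obtain ⟨ψ, hψ⟩ := hext φ.hom
    have : φ = (shortComplexOfExact h).f ≫ ModuleCat.ofHom ψ := by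
      ext x
      exact congrArg (fun k : X →ₗ[S] S ↦ k x) hψ.symm
    rw [← hx, this, ← Ext.mk₀_comp_mk₀,
      (shortExact_shortComplexOfExact h hf hg).extClass_comp_assoc]
  rw [key a, key b]

open scoped Pointwise in
/-- Nakayama's lemma for `Ext^i(X, S)` along multiplication by an element of the maximal ideal
that is regular on `X`. -/
lemma ExtVanish.of_quotient_smul [IsLocalRing S] [IsNoetherianRing S] [Module.Finite S X] {r : S}
    (hr : r ∈ IsLocalRing.maximalIdeal S) (hreg : IsSMulRegular X r) {i : ℕ}
    (h : ExtVanish S (i + 1) (QuotSMulTop r X)) : ExtVanish S i X := by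
  have hex : Function.Exact (LinearMap.lsmul S X r) (Submodule.mkQ (r • ⊤ : Submodule S X)) :=
    LinearMap.exact_lsmul_mkQ_smul_top X r
  have hsurj (c : Ext (ModuleCat.of S X) (ModuleCat.of S S) i) : ∃ c', r • c' = c := by
    obtain ⟨x, hx⟩ := Ext.contravariant_sequence_exact₁
      (shortExact_shortComplexOfExact hex hreg (Submodule.mkQ_surjective _)) _ c (add_comm 1 i)
      (h.elim _ _)
    refine ⟨x, ?_⟩
    rw [← hx]
    have : ModuleCat.ofHom (LinearMap.lsmul S X r) = r • 𝟙 (ModuleCat.of S X) := rfl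
    change _ = (Ext.mk₀ (ModuleCat.ofHom (LinearMap.lsmul S X r))).comp x _
    rw [this, Ext.mk₀_smul, Ext.smul_comp, Ext.mk₀_id_comp]
  have hfin : Module.Finite S (Ext (ModuleCat.of S X) (ModuleCat.of S S) i) := inferInstance
  have : (⊤ : Submodule S (Ext (ModuleCat.of S X) (ModuleCat.of S S) i)) = ⊥ := by
    refine Submodule.eq_bot_of_le_smul_of_le_jacobson_bot (IsLocalRing.maximalIdeal S) _
      hfin.fg_top ?_ (IsLocalRing.maximalIdeal_le_jacobson _)
    intro c _
    obtain ⟨c', rfl⟩ := hsurj c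
    exact Submodule.smul_mem_smul hr trivial
  exact (Submodule.subsingleton_iff S).mp (subsingleton_of_bot_eq_top this.symm)

end ExtVanish

end

section

open CategoryTheory Abelian IsLocalRing RingTheory.Sequence
open scoped Pointwise

/-- `Ext^i_S(X, S)` vanishes for all `i > n` and all finitely generated `X`. -/
def ExtVanishAbove (S : Type u) [CommRing S] (n : ℕ) : Prop :=
  ∀ (X : Type u) [AddCommGroup X] [Module S X], Module.Finite S X → ∀ i, n < i → ExtVanish S i X

variable {S : Type u} [CommRing S]

lemma ext_of_isWeaklyRegular (X : Type u) [AddCommGroup X] [Module S X] (ys : List S) :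
    ∀ (N : Type u) [AddCommGroup N] [Module S N], (∀ y ∈ ys, ∀ x : X, y • x = 0) →
      IsWeaklyRegular N ys →
      (∀ j < ys.length, Subsingleton (Ext (ModuleCat.of S X) (ModuleCat.of S N) j)) ∧
      (Nontrivial (X →ₗ[S] (N ⧸ (Ideal.ofList ys • ⊤ : Submodule S N))) →
        Nontrivial (Ext (ModuleCat.of S X) (ModuleCat.of S N) ys.length)) := by
  induction ys with
  | nil =>
    intro N _ _ _ _
    refine ⟨by simp, fun h ↦ ?_⟩
    have e : (N ⧸ (Ideal.ofList ([] : List S) • ⊤ : Submodule S N)) ≃ₗ[S] N :=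
      Submodule.quotEquivOfEqBot _ (by simp)
    have e2 := (Ext.linearEquiv₀ (R := S) (X := ModuleCat.of S X) (Y := ModuleCat.of S N)).trans
      ModuleCat.homLinearEquiv
    have e3 := e2.trans (LinearEquiv.congrRight (R := S) (M := X) e.symm)
    exact e3.toEquiv.nontrivial
  | cons y ys ih =>
    intro N _ _ hann hreg
    rw [isWeaklyRegular_cons_iff] at hreg
    obtain ⟨ih1, ih2⟩ := ih (QuotSMulTop y N) (fun z hz ↦ hann z (List.mem_cons_of_mem _ hz)) hreg.2
    have hex : Function.Exact (LinearMap.lsmul S N y) (Submodule.mkQ (y • ⊤ : Submodule S N)) :=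
      LinearMap.exact_lsmul_mkQ_smul_top N y
    have hS := shortExact_shortComplexOfExact hex hreg.1 (Submodule.mkQ_surjective _)
    have hmono : Mono (shortComplexOfExact hex).f := hS.mono_f
    have hzero (j : ℕ) (c : Ext (ModuleCat.of S X) (ModuleCat.of S N) j) :
        c.comp (Ext.mk₀ (shortComplexOfExact hex).f) (add_zero j) = 0 := by
      have h1 : (shortComplexOfExact hex).f = y • 𝟙 (ModuleCat.of S N) := rfl
      have h2 : y • 𝟙 (ModuleCat.of S X) = 0 :=
        ModuleCat.hom_ext (LinearMap.ext fun x ↦ hann y List.mem_cons_self x)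
      have h3 : y • c = 0 := by
        rw [← Ext.mk₀_id_comp c, ← Ext.smul_comp, ← Ext.mk₀_smul, h2]
        simp
      rw [h1, Ext.mk₀_smul, Ext.comp_smul, Ext.comp_mk₀_id, h3]
    have hvan : ∀ j < (y :: ys).length,
        Subsingleton (Ext (ModuleCat.of S X) (ModuleCat.of S N) j) := by
      intro j hj
      refine subsingleton_of_forall_eq 0 fun c ↦ ?_
      cases j with
      | zero =>
        apply Ext.postcomp_mk₀_injective_of_mono (ModuleCat.of S X) (shortComplexOfExact hex).f
        simpa using hzero 0 c
      | succ j =>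
        obtain ⟨x, hx⟩ := Ext.covariant_sequence_exact₁ _ hS c (hzero _ c) rfl
        have := ih1 j (by simpa using hj)
        rw [← hx, this.elim x 0, Ext.zero_comp]
    refine ⟨hvan, fun h ↦ ?_⟩
    have h' : Nontrivial (X →ₗ[S] (QuotSMulTop y N ⧸
        (Ideal.ofList ys • ⊤ : Submodule S (QuotSMulTop y N)))) :=
      (LinearEquiv.congrRight (R := S) (M := X)
        (Submodule.quotOfListConsSMulTopEquivQuotSMulTopInner N y ys)).symm.toEquiv.nontrivial
    have := ih2 h'
    obtain ⟨x3, hx3⟩ := exists_ne (0 : Ext (ModuleCat.of S X) (ModuleCat.of S (QuotSMulTop y N))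
      ys.length)
    refine ⟨x3.comp hS.extClass rfl, 0, fun h0 ↦ hx3 ?_⟩
    obtain ⟨x2, hx2⟩ := Ext.covariant_sequence_exact₃ _ hS x3 rfl h0
    have := hvan ys.length (by simp)
    rw [← hx2, this.elim x2 0, Ext.zero_comp]

variable [IsLocalRing S] [IsNoetherianRing S]

/-- Over a Noetherian local ring, either the maximal ideal contains a regular element on `W`, or
the residue field embeds in `W`. -/
lemma exists_isSMulRegular_or_maximalIdeal_mem_associatedPrimes (W : Type u) [AddCommGroup W]
    [Module S W] [Module.Finite S W] :
    (∃ r ∈ maximalIdeal S, IsSMulRegular W r) ∨ maximalIdeal S ∈ associatedPrimes S W := by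
  by_contra! h
  obtain ⟨h1, h2⟩ := h
  have hsub : (maximalIdeal S : Set S) ⊆ ⋃ p ∈ associatedPrimes S W, (p : Set S) := by
    rw [biUnion_associatedPrimes_eq_compl_regular]
    exact fun r hr ↦ h1 r hr
  rw [Ideal.subset_union_prime_finite (associatedPrimes.finite S W) ⊥ ⊥
    (fun p hp _ _ ↦ hp.isPrime)] at hsub
  obtain ⟨p, hp, hle⟩ := hsub
  have := (maximalIdeal.isMaximal S).eq_of_le hp.isPrime.ne_top hle
  exact h2 (this ▸ hp)

lemma exists_ringKrullDim_eq_nat : ∃ n : ℕ, ringKrullDim S = n := by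
  have h1 := ringKrullDim_ne_top (R := S)
  have h2 := ringKrullDim_ne_bot (R := S)
  cases h : ringKrullDim S with
  | bot => exact absurd h h2
  | coe a =>
    cases a with
    | top => exact absurd h h1
    | coe a => exact ⟨a, rfl⟩

lemma exists_isRegular_maximalIdeal_mem_associatedPrimes : ∃ ys : List S, IsRegular S ys ∧
    (∀ y ∈ ys, y ∈ maximalIdeal S) ∧
    maximalIdeal S ∈ associatedPrimes S (S ⧸ (Ideal.ofList ys • ⊤ : Submodule S S)) := by
  by_contra! h
  have key (n : ℕ) : ∃ ys : List S, ys.length = n ∧ IsRegular S ys ∧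
      (∀ y ∈ ys, y ∈ maximalIdeal S) := by
    induction n with
    | zero => exact ⟨[], rfl, IsRegular.nil S S, by simp⟩
    | succ n ih =>
      obtain ⟨ys, hl, hreg, hm⟩ := ih
      obtain ⟨r, hr, hr'⟩ := (exists_isSMulRegular_or_maximalIdeal_mem_associatedPrimes
        (S ⧸ (Ideal.ofList ys • ⊤ : Submodule S S))).resolve_right (h ys hreg hm)
      have hmem : ∀ y ∈ ys ++ [r], y ∈ maximalIdeal S := by
        simp only [List.mem_append, List.mem_singleton]
        rintro y (hy | rfl)
        exacts [hm y hy, hr]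
      refine ⟨ys ++ [r], by simp [hl], ?_, hmem⟩
      apply IsRegular.of_isWeaklyRegular_of_mem_maximalIdeal
      · exact hmem
      · rw [isWeaklyRegular_append_iff, isWeaklyRegular_singleton_iff]
        exact ⟨hreg.1, hr'⟩
  obtain ⟨n, hn⟩ := exists_ringKrullDim_eq_nat (S := S)
  obtain ⟨ys, hl, hreg, -⟩ := key (n + 1)
  have := ringKrullDim_add_length_eq_ringKrullDim_of_isRegular ys hreg
  rw [hl, hn] at this
  have : Nontrivial (S ⧸ Ideal.ofList ys) := by
    refine Ideal.Quotient.nontrivial_iff.mpr fun h ↦ hreg.2 ?_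
    rw [h, Submodule.top_smul]
  have h0 := ringKrullDim_nonneg_of_nontrivial (R := S ⧸ Ideal.ofList ys)
  have h1 : (0 : WithBot ℕ∞) + ((n + 1 : ℕ) : WithBot ℕ∞) ≤ (n : WithBot ℕ∞) := by
    rw [← ‹_ = (n : WithBot ℕ∞)›]
    gcongr
  rw [zero_add] at h1
  norm_cast at h1
  omega

/-- Descending step: if `Ext^{i+1}(-, S)` vanishes on finitely generated modules and `Ext^i(W, S)`
vanishes for some `W` having the maximal ideal as associated prime, then `Ext^i(-, S)` vanishes. -/
lemma extVanish_of_succ_of_mem_associatedPrimes {i : ℕ}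
    (h : ∀ (X : Type u) [AddCommGroup X] [Module S X], Module.Finite S X → ExtVanish S (i + 1) X)
    (W : Type u) [AddCommGroup W] [Module S W] [Module.Finite S W] (hW : ExtVanish S i W)
    (hass : maximalIdeal S ∈ associatedPrimes S W)
    (X : Type u) [AddCommGroup X] [Module S X] (hX : Module.Finite S X) : ExtVanish S i X := by
  induction hX using IsNoetherianRing.induction_on_isQuotientEquivQuotientPrime S with
  | subsingleton N => exact ExtVanish.of_subsingleton i
  | quotient N p e =>
    refine ExtVanish.of_equiv ?_ e
    by_cases hp : p.1 = maximalIdeal S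
    · rw [hp]
      obtain ⟨w, hw⟩ := (isAssociatedPrime_iff_exists_injective_linearMap _ _).mp hass |>.2
      exact ExtVanish.of_middle_of_right (LinearMap.exact_map_mkQ_range w) hw
        (Submodule.mkQ_surjective _) hW (h _ inferInstance)
    · obtain ⟨r, hr, hrp⟩ : ∃ r ∈ maximalIdeal S, r ∉ p.1 := by
        by_contra! hle
        exact hp (le_antisymm (le_maximalIdeal p.2.ne_top) hle)
      refine ExtVanish.of_quotient_smul hr ?_ (h _ inferInstance)
      have := p.2
      have hr0 : Ideal.Quotient.mk p.1 r ≠ 0 := by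
        rwa [Ne, Ideal.Quotient.eq_zero_iff_mem]
      intro a b hab
      refine mul_left_cancel₀ hr0 ?_
      simpa [Algebra.smul_def] using hab
  | exact N₁ N₂ N₃ f g hf hg hex h₁ h₃ => exact ExtVanish.of_left_of_right hex hf hg h₁ h₃

/-- A Noetherian local ring with finite self-injective dimension: the injective dimension equals
the Krull dimension `t`, and `Ext^t(k, S) ≠ 0`. -/
lemma exists_ringKrullDim_eq_and_extVanishAbove {N : ℕ} (hN : ExtVanishAbove S N) :
    ∃ t : ℕ, ringKrullDim S = t ∧ ExtVanishAbove S t ∧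
      ¬ ExtVanish S t (S ⧸ maximalIdeal S) := by
  obtain ⟨ys, hreg, hm, hass⟩ := exists_isRegular_maximalIdeal_mem_associatedPrimes (S := S)
  set W := S ⧸ (Ideal.ofList ys • ⊤ : Submodule S S) with hWdef
  have hWpd : ∀ i, ys.length < i → ExtVanish S i W := by
    intro i hi
    have h1 := ModuleCat.projectiveDimension_quotient_eq_add_length_of_isWeaklyRegular
      (ModuleCat.of S S) ys hreg.1 hm
    have h0 : projectiveDimension (ModuleCat.of S S) = 0 :=
      ModuleCat.projectiveDimension_eq_zero_of_projective _
    rw [h0, zero_add] at h1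
    have h2 : HasProjectiveDimensionLE (ModuleCat.of S W) ys.length :=
      (projectiveDimension_le_iff _ _).mp h1.le
    exact HasProjectiveDimensionLT.subsingleton (ModuleCat.of S W) (ys.length + 1) i hi _
  have habove : ExtVanishAbove S ys.length := by
    have key (m : ℕ) : ∀ (X : Type u) [AddCommGroup X] [Module S X], Module.Finite S X →
        ∀ i, ys.length < i → N < i + m → ExtVanish S i X := by
      induction m with
      | zero => exact fun X _ _ hX i _ hi ↦ hN X hX i hi
      | succ m ih =>
        intro X _ _ hX i hi hi'
        exact extVanish_of_succ_of_mem_associatedPrimes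
          (fun X _ _ hX ↦ ih X hX (i + 1) (by omega) (by omega)) W (hWpd i hi) hass X hX
    exact fun X _ _ hX i hi ↦ key (N + 1) X hX i hi (by omega)
  have hne (q : Ideal S) (hle : Ideal.ofList ys ≤ q) (hq : q ∈ associatedPrimes S W) :
      ¬ ExtVanish S ys.length (S ⧸ q) := by
    intro hv
    obtain ⟨w, hw⟩ := (isAssociatedPrime_iff_exists_injective_linearMap _ _).mp hq |>.2
    have hnt : Nontrivial ((S ⧸ q) →ₗ[S] W) := by
      refine ⟨w, 0, fun h0 ↦ ?_⟩
      have := Ideal.Quotient.nontrivial_iff.mpr hq.isPrime.ne_top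
      obtain ⟨a, ha⟩ := exists_ne (0 : S ⧸ q)
      exact ha (hw (by simp [h0]))
    have := (ext_of_isWeaklyRegular (S ⧸ q) ys S (fun y hy x ↦ ?_) hreg.1).2 hnt
    · exact not_subsingleton _ hv
    · obtain ⟨x, rfl⟩ := Ideal.Quotient.mk_surjective x
      rw [Algebra.smul_def]
      have : algebraMap S (S ⧸ q) y = 0 :=
        Ideal.Quotient.eq_zero_iff_mem.mpr (hle (Ideal.subset_span hy))
      rw [this, zero_mul]
  have hlem : Ideal.ofList ys ≤ maximalIdeal S := Ideal.span_le.mpr hm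
  refine ⟨ys.length, le_antisymm ?_ ?_, habove, hne _ hlem hass⟩
  · have hmin : maximalIdeal S ∈ (Ideal.ofList ys).minimalPrimes := by
      obtain ⟨q, hq, hqm⟩ := Ideal.exists_minimalPrimes_le hlem
      have hq' : q ∈ associatedPrimes S W := by
        apply Module.associatedPrimes.minimalPrimes_annihilator_subset_associatedPrimes
        have : Module.annihilator S W = Ideal.ofList ys := by
          have h := Ideal.annihilator_quotient (I := (Ideal.ofList ys • ⊤ : Ideal S))
          refine h.trans ?_
          rw [smul_eq_mul, Ideal.mul_top]
        rwa [this]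
      have hqp := hq.1.1
      suffices q = maximalIdeal S by rwa [← this]
      by_contra hqne
      obtain ⟨r, hr, hrq⟩ : ∃ r ∈ maximalIdeal S, r ∉ q := by
        by_contra! hle
        exact hqne (le_antisymm hqm hle)
      refine hne q hq.1.2 hq' (ExtVanish.of_quotient_smul hr ?_ (habove _ inferInstance _
        (Nat.lt_succ_self _)))
      have hr0 : Ideal.Quotient.mk q r ≠ 0 := by
        rwa [Ne, Ideal.Quotient.eq_zero_iff_mem]
      intro a b hab
      refine mul_left_cancel₀ hr0 ?_
      simpa [Algebra.smul_def] using hab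
    have hh : (maximalIdeal S).height ≤ ys.length := by
      classical
      refine (Ideal.height_le_card_of_mem_minimalPrimes_span_finset (s := ys.toFinset) ?_).trans ?_
      · convert hmin using 2
        ext; simp [Ideal.ofList]
      · exact_mod_cast ys.toFinset_card_le
    rw [← maximalIdeal_height_eq_ringKrullDim]
    exact_mod_cast hh
  · have := ringKrullDim_add_length_eq_ringKrullDim_of_isRegular ys hreg
    have : Nontrivial (S ⧸ Ideal.ofList ys) :=
      Ideal.Quotient.nontrivial_iff.mpr fun h ↦ (maximalIdeal.isMaximal S).ne_top
        (top_le_iff.mp (h ▸ hlem))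
    have h0 := ringKrullDim_nonneg_of_nontrivial (R := S ⧸ Ideal.ofList ys)
    rw [← ringKrullDim_add_length_eq_ringKrullDim_of_isRegular ys hreg]
    exact le_add_of_nonneg_left h0

omit [IsLocalRing S] [IsNoetherianRing S] in
lemma hasInjectiveDimensionLE_of_IDLE {A : Type u} [Ring A] (n : ℕ) :
    ∀ (M : Type u) [AddCommGroup M] [Module A M], IDLE A n M →
      HasInjectiveDimensionLE (ModuleCat.of A M) n := by
  have hinj (n : ℕ) (M : Type u) [AddCommGroup M] [Module A M] (h : Module.Injective A M) :
      HasInjectiveDimensionLE (ModuleCat.of A M) n := by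
    have : Injective (ModuleCat.of A M) := (Module.injective_iff_injective_object A M).mp h
    have h1 : HasInjectiveDimensionLT (ModuleCat.of A M) 1 := inferInstance
    exact hasInjectiveDimensionLT_of_ge _ 1 (n + 1) (by omega)
  induction n with
  | zero => exact fun M _ _ h ↦ hinj 0 M h
  | succ n ih =>
    rintro M _ _ (h | ⟨I, f, hI, hf, h⟩)
    · exact hinj _ M h
    · have hS := shortExact_shortComplexOfExact (LinearMap.exact_map_mkQ_range f) hf
        (Submodule.mkQ_surjective _)
      exact hS.hasInjectiveDimensionLT_X₁ (n + 1) (ih _ h) (hinj (n + 1) I hI)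

omit [IsLocalRing S] [IsNoetherianRing S] in
lemma extVanishAbove_of_hasInjectiveDimensionLE {n : ℕ}
    (h : HasInjectiveDimensionLE (ModuleCat.of S S) n) : ExtVanishAbove S n :=
  fun _ _ _ _ i hi ↦ HasInjectiveDimensionLT.subsingleton (ModuleCat.of S S) (n + 1) i hi _

omit [IsLocalRing S] in
lemma extVanishAbove_localization {n : ℕ}
    (h : HasInjectiveDimensionLE (ModuleCat.of S S) n) (p : Ideal S) [p.IsPrime] :
    ExtVanishAbove (Localization.AtPrime p) n := by
  apply extVanishAbove_of_hasInjectiveDimensionLE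
  have hloc := ModuleCat.localizedModule_hasInjectiveDimensionLE n p.primeCompl (ModuleCat.of S S)
  have := ModuleCat.localizedModule_isLocalizedModule (ModuleCat.of S S) p.primeCompl
  have e : (ModuleCat.of S S).localizedModule p.primeCompl ≃ₗ[Localization.AtPrime p]
      ModuleCat.of (Localization.AtPrime p) (Localization.AtPrime p) :=
    (IsLocalizedModule.linearEquiv p.primeCompl
      ((ModuleCat.of S S).localizedModuleMkLinearMap p.primeCompl)
      (Algebra.linearMap S (Localization.AtPrime p))).extendScalarsOfIsLocalization
        p.primeCompl (Localization.AtPrime p)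
  exact (ModuleCat.hasInjectiveDimensionLE_iff_of_linearEquiv e n).mp hloc

end

section

open RingTheory.Sequence
open scoped Pointwise

/-- `X` is (relative to a ring of finite self-injective dimension) Gorenstein projective:
`Ext^i(X, S)` vanishes for all `i ≥ 1`. -/
def IsGP (S : Type u) [CommRing S] (X : Type u) [AddCommGroup X] [Module S X] : Prop :=
  ∀ i, 1 ≤ i → ExtVanish S i X

section

variable {S : Type u} [CommRing S]
variable {X Y Z : Type u} [AddCommGroup X] [Module S X] [AddCommGroup Y] [Module S Y]
  [AddCommGroup Z] [Module S Z]

lemma IsGP.of_projective [Module.Projective S X] : IsGP S X := fun _ hi ↦ .of_projective hi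

lemma IsGP.of_equiv (h : IsGP S Y) (e : X ≃ₗ[S] Y) : IsGP S X := fun i hi ↦ (h i hi).of_equiv e

lemma IsGP.of_retract (h : IsGP S Y) (f : X →ₗ[S] Y) (g : Y →ₗ[S] X)
    (hfg : g ∘ₗ f = LinearMap.id) : IsGP S X := fun i hi ↦ (h i hi).of_retract f g hfg

lemma IsGP.pi (h : IsGP S X) (n : ℕ) : IsGP S (Fin n → X) := fun i hi ↦ (h i hi).pi n

lemma IsGP.of_middle_of_right {f : X →ₗ[S] Y} {g : Y →ₗ[S] Z} (h : Function.Exact f g)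
    (hf : Function.Injective f) (hg : Function.Surjective g) (hY : IsGP S Y) (hZ : IsGP S Z) :
    IsGP S X :=
  fun i hi ↦ ExtVanish.of_middle_of_right h hf hg (hY i hi) (hZ (i + 1) (by omega))

lemma exact_dualMap {f : X →ₗ[S] Y} {g : Y →ₗ[S] Z} (h : Function.Exact f g)
    (hg : Function.Surjective g) : Function.Exact g.dualMap f.dualMap :=
  LinearMap.exact_lcomp_of_exact_of_surjective S h hg

lemma ExtVanish.dualMap_surjective {f : X →ₗ[S] Y} {g : Y →ₗ[S] Z} (h : Function.Exact f g)
    (hf : Function.Injective f) (hg : Function.Surjective g) (hZ : ExtVanish S 1 Z) :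
    Function.Surjective f.dualMap :=
  fun φ ↦ ExtVanish.exists_extend h hf hg hZ φ

variable [IsNoetherianRing S]

lemma IsGP.dual {n : ℕ} (hn : ExtVanishAbove S n) [Module.Finite S X] (h : IsGP S X) :
    IsGP S (Module.Dual S X) := by
  have key (m : ℕ) : ∀ (X : Type u) [AddCommGroup X] [Module S X], Module.Finite S X → IsGP S X →
      ∀ i, 1 ≤ i → n < i + m → ExtVanish S i (Module.Dual S X) := by
    induction m with
    | zero => exact fun X _ _ hX _ i _ hi ↦ hn _ inferInstance i hi
    | succ m ih =>
      intro X _ _ hX h i hi him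
      obtain ⟨k, π, hπ⟩ := Module.Finite.exists_fin' S X
      have hex := LinearMap.exact_subtype_ker_map π
      have hK : IsGP S (LinearMap.ker π) :=
        .of_middle_of_right hex Subtype.val_injective hπ .of_projective h
      exact ExtVanish.of_middle_of_right (exact_dualMap hex hπ)
        (LinearMap.dualMap_injective_of_surjective hπ)
        (ExtVanish.dualMap_surjective hex Subtype.val_injective hπ (h 1 le_rfl))
        (.of_projective hi) (ih _ inferInstance hK (i + 1) (by omega) (by omega))
  exact fun i hi ↦ key (n + 1) X inferInstance h i hi (by omega)

lemma IsGP.isReflexive {n : ℕ} (hn : ExtVanishAbove S n) [Module.Finite S X] (h : IsGP S X) :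
    Module.IsReflexive S X := by
  have hsurj (X : Type u) [AddCommGroup X] [Module S X] [Module.Finite S X] (h : IsGP S X) :
      Function.Surjective (Module.Dual.eval S X) := by
    obtain ⟨k, π, hπ⟩ := Module.Finite.exists_fin' S X
    have hex := LinearMap.exact_subtype_ker_map π
    have hK : IsGP S (LinearMap.ker π) :=
      .of_middle_of_right hex Subtype.val_injective hπ .of_projective h
    have h1 := ExtVanish.dualMap_surjective hex Subtype.val_injective hπ (h 1 le_rfl)
    have h2 := ExtVanish.dualMap_surjective (exact_dualMap hex hπ)
      (LinearMap.dualMap_injective_of_surjective hπ) h1 (hK.dual hn 1 le_rfl)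
    intro ξ
    obtain ⟨η, rfl⟩ := h2 ξ
    obtain ⟨y, rfl⟩ := (Module.bijective_dual_eval S (Fin k → S)).2 η
    exact ⟨π y, rfl⟩
  refine ⟨⟨?_, hsurj X h⟩⟩
  obtain ⟨k, π, hπ⟩ := Module.Finite.exists_fin' S X
  have hex := LinearMap.exact_subtype_ker_map π
  have hK : IsGP S (LinearMap.ker π) :=
    .of_middle_of_right hex Subtype.val_injective hπ .of_projective h
  have h1 := ExtVanish.dualMap_surjective hex Subtype.val_injective hπ (h 1 le_rfl)
  have hex2 := exact_dualMap (exact_dualMap hex hπ) h1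
  rw [injective_iff_map_eq_zero]
  intro x hx
  obtain ⟨y, rfl⟩ := hπ x
  obtain ⟨ζ, hζ⟩ := (hex2 (Module.Dual.eval S (Fin k → S) y)).mp hx
  obtain ⟨z, rfl⟩ := hsurj _ hK ζ
  have : (z : Fin k → S) = y := (Module.bijective_dual_eval S (Fin k → S)).1 hζ
  rw [← this]
  exact z.2

/-- A Gorenstein projective module embeds in a free module with Gorenstein projective cokernel. -/
lemma IsGP.exists_embedding {n : ℕ} (hn : ExtVanishAbove S n) [Module.Finite S X] (h : IsGP S X) :
    ∃ (k : ℕ) (Z : Type u) (_ : AddCommGroup Z) (_ : Module S Z) (_ : Module.Finite S Z)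
      (f : X →ₗ[S] (Fin k → S)) (g : (Fin k → S) →ₗ[S] Z),
      Function.Exact f g ∧ Function.Injective f ∧ Function.Surjective g ∧ IsGP S Z := by
  have := h.isReflexive hn
  have hd := h.dual hn
  obtain ⟨k, π, hπ⟩ := Module.Finite.exists_fin' S (Module.Dual S X)
  have hex := LinearMap.exact_subtype_ker_map π
  have hK : IsGP S (LinearMap.ker π) :=
    .of_middle_of_right hex Subtype.val_injective hπ .of_projective hd
  have h1 := ExtVanish.dualMap_surjective hex Subtype.val_injective hπ (hd 1 le_rfl)
  let e : Module.Dual S (Fin k → S) ≃ₗ[S] (Fin k → S) := ((Pi.basisFun S (Fin k)).toDualEquiv).symm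
  let e' := Module.evalEquiv S X
  refine ⟨k, Module.Dual S (LinearMap.ker π), inferInstance, inferInstance, inferInstance,
    e.toLinearMap ∘ₗ π.dualMap ∘ₗ e'.toLinearMap,
    (LinearMap.ker π).subtype.dualMap ∘ₗ e.symm.toLinearMap, ?_, ?_, ?_, hK.dual hn⟩
  · intro y
    rw [LinearMap.comp_apply]
    refine (exact_dualMap hex hπ _).trans ⟨?_, ?_⟩
    · rintro ⟨z, hz⟩
      exact ⟨e'.symm z, by simp [hz]⟩
    · rintro ⟨z, rfl⟩
      exact ⟨e' z, by simp⟩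
  · exact e.injective.comp ((LinearMap.dualMap_injective_of_surjective hπ).comp e'.injective)
  · exact h1.comp e.symm.surjective

end

section

variable {S : Type u} [CommRing S]

/-- Depth lemma for a kernel. -/
lemma isWeaklyRegular_append_of_exact (xs : List S) (y : S) :
    ∀ (K L N : Type u) [AddCommGroup K] [Module S K] [AddCommGroup L] [Module S L]
      [AddCommGroup N] [Module S N] (f : K →ₗ[S] L) (g : L →ₗ[S] N), Function.Exact f g →
      Function.Injective f → Function.Surjective g → IsWeaklyRegular N xs →
      IsWeaklyRegular L (xs ++ [y]) → IsWeaklyRegular K (xs ++ [y]) := by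
  induction xs with
  | nil =>
    intro K L N _ _ _ _ _ _ f g _ hf _ _ hL
    simp only [List.nil_append, isWeaklyRegular_singleton_iff] at hL ⊢
    exact hL.of_injective f hf
  | cons x xs ih =>
    intro K L N _ _ _ _ _ _ f g hex hf hg hN hL
    rw [List.cons_append, isWeaklyRegular_cons_iff] at hL ⊢
    rw [isWeaklyRegular_cons_iff] at hN
    refine ⟨hL.1.of_injective f hf, ih _ _ _ (QuotSMulTop.map x f) (QuotSMulTop.map x g)
      (QuotSMulTop.map_exact x hex hg) ?_ (QuotSMulTop.map_surjective x hg) hN.2 hL.2⟩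
    have h0 : Function.Exact (0 : PUnit.{u + 1} →ₗ[S] K) f := by
      intro k
      rw [map_eq_zero_iff f hf]
      simp [eq_comm]
    have := QuotSMulTop.map_first_exact_on_four_term_exact_of_isSMulRegular_last h0 hex hN.1
    rw [injective_iff_map_eq_zero]
    intro a ha
    obtain ⟨b, rfl⟩ := (this a).mp ha
    obtain ⟨c, rfl⟩ := Submodule.Quotient.mk_surjective _ b
    rw [Subsingleton.elim c 0]
    simp

lemma isWeaklyRegular_of_flat (X : Type u) [AddCommGroup X] [Module S X] [Module.Flat S X]
    {rs : List S} (h : IsWeaklyRegular S rs) : IsWeaklyRegular X rs :=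
  ((TensorProduct.rid S X).isWeaklyRegular_congr rs).mp h.isWeaklyRegular_lTensor

lemma IsGP.isWeaklyRegular [IsNoetherianRing S] {n : ℕ} (hn : ExtVanishAbove S n) {rs : List S}
    (hrs : IsWeaklyRegular S rs) :
    ∀ (X : Type u) [AddCommGroup X] [Module S X], Module.Finite S X → IsGP S X →
      IsWeaklyRegular X rs := by
  induction rs using List.reverseRecOn with
  | nil => exact fun X _ _ _ _ ↦ IsWeaklyRegular.nil S X
  | append_singleton xs y ih =>
    intro X _ _ hX h
    obtain ⟨k, Z, _, _, _, f, g, hex, hf, hg, hZ⟩ := h.exists_embedding hn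
    exact isWeaklyRegular_append_of_exact xs y _ _ _ f g hex hf hg
      (ih ((isWeaklyRegular_append_iff _ _ _).mp hrs).1 Z inferInstance hZ)
      (isWeaklyRegular_of_flat _ hrs)

variable [IsLocalRing S] [IsNoetherianRing S]

lemma ExtVanishAbove.of_isWeaklyRegular {n : ℕ} (hn : ExtVanishAbove S n) (rs : List S)
    (hm : ∀ r ∈ rs, r ∈ IsLocalRing.maximalIdeal S) :
    ∀ (X : Type u) [AddCommGroup X] [Module S X], Module.Finite S X → IsWeaklyRegular X rs →
      ∀ i, n < i + rs.length → ExtVanish S i X := by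
  induction rs with
  | nil => exact fun X _ _ hX _ i hi ↦ hn X hX i hi
  | cons r rs ih =>
    intro X _ _ hX hreg i hi
    rw [isWeaklyRegular_cons_iff] at hreg
    refine ExtVanish.of_quotient_smul (hm r List.mem_cons_self) hreg.1
      (ih (fun x hx ↦ hm x (List.mem_cons_of_mem _ hx)) _ inferInstance hreg.2 (i + 1) ?_)
    rw [List.length_cons] at hi
    omega

lemma IsMCM.isGP {d : ℕ} (hd : ExtVanishAbove S d) {X : Type u} [AddCommGroup X] [Module S X]
    (h : IsMCM S d X) : IsGP S X := by
  obtain ⟨_, rs, hl, hm, hreg⟩ := h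
  exact fun i hi ↦ hd.of_isWeaklyRegular rs hm X inferInstance hreg i (by omega)

lemma IsGP.isMCM {d n : ℕ} (hn : ExtVanishAbove S n) (hS : IsMCM S d S) {X : Type u}
    [AddCommGroup X] [Module S X] [Module.Finite S X] (h : IsGP S X) : IsMCM S d X := by
  obtain ⟨_, rs, hl, hm, hreg⟩ := hS
  exact ⟨inferInstance, rs, hl, hm, IsGP.isWeaklyRegular hn hreg X inferInstance h⟩

end

section

variable {R : Type u} [CommRing R] [IsNoetherianRing R] (W : Submonoid R)

lemma ExtVanish.localizedModule {i : ℕ} :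
    ∀ (Y : Type u) [AddCommGroup Y] [Module R Y], Module.Finite R Y → ExtVanish R (i + 1) Y →
      ExtVanish (Localization W) (i + 1) (LocalizedModule W Y) := by
  induction i with
  | zero =>
    intro Y _ _ hY h
    obtain ⟨k, π, hπ⟩ := Module.Finite.exists_fin' R Y
    have hex := LinearMap.exact_subtype_ker_map π
    have hproj : Module.Projective (Localization W) (LocalizedModule W (Fin k → R)) :=
      Module.projective_of_isLocalizedModule W (LocalizedModule.mkLinearMap W (Fin k → R))
    have hexW : Function.Exact (LocalizedModule.map W (LinearMap.ker π).subtype)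
        (LocalizedModule.map W π) := LocalizedModule.map_exact W _ _ hex
    have hιW := LocalizedModule.map_injective W (LinearMap.ker π).subtype Subtype.val_injective
    have hπW := LocalizedModule.map_surjective W π hπ
    refine ExtVanish.one_of_extend (X := LocalizedModule W (LinearMap.ker π))
      (Y := LocalizedModule W (Fin k → R)) (f := LocalizedModule.map W (LinearMap.ker π).subtype)
      (g := LocalizedModule.map W π) hexW hιW hπW (.of_projective le_rfl) fun φ ↦ ?_
    have : Module.FinitePresentation R (LinearMap.ker π) :=
      Module.finitePresentation_of_finite R _
    obtain ⟨φ₀, s, hs⟩ := Module.FinitePresentation.exists_lift_of_isLocalizedModule W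
      (Algebra.linearMap R (Localization W))
      ((φ.restrictScalars R) ∘ₗ LocalizedModule.mkLinearMap W (LinearMap.ker π))
    obtain ⟨ψ₀, hψ₀⟩ := ExtVanish.exists_extend hex Subtype.val_injective hπ h φ₀
    let ψ := IsLocalizedModule.mapExtendScalars W (LocalizedModule.mkLinearMap W (Fin k → R))
      (Algebra.linearMap R (Localization W)) (Localization W) ψ₀
    refine ⟨IsLocalization.mk' (Localization W) 1 s • ψ, ?_⟩
    have h1 : ψ ∘ₗ LocalizedModule.map W (LinearMap.ker π).subtype = s • φ := by
      apply LinearMap.restrictScalars_injective R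
      apply IsLocalizedModule.ext W (LocalizedModule.mkLinearMap W (LinearMap.ker π))
        (IsLocalizedModule.map_units (Algebra.linearMap R (Localization W)))
      ext x
      have h2 := congrArg (algebraMap R (Localization W)) (LinearMap.congr_fun hψ₀ x)
      have h3 := LinearMap.congr_fun hs x
      have h4 : ψ (LocalizedModule.mkLinearMap W (Fin k → R) x) =
          algebraMap R (Localization W) (ψ₀ x) :=
        IsLocalizedModule.map_apply W _ _ _ _
      simp only [LinearMap.comp_apply, Algebra.linearMap_apply, LinearMap.restrictScalars_apply,
        LocalizedModule.mkLinearMap_apply, LocalizedModule.map_mk, Submodule.subtype_apply,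
        LinearMap.smul_apply] at h2 h3 h4 ⊢
      rw [h4, h2, h3]
    rw [LinearMap.smul_comp, h1, Submonoid.smul_def, ← algebraMap_smul (Localization W) (s : R) φ,
      smul_smul, IsLocalization.mk'_spec, map_one, one_smul]
  | succ i ih =>
    intro Y _ _ hY h
    obtain ⟨k, π, hπ⟩ := Module.Finite.exists_fin' R Y
    have hex := LinearMap.exact_subtype_ker_map π
    have hproj : Module.Projective (Localization W) (LocalizedModule W (Fin k → R)) :=
      Module.projective_of_isLocalizedModule W (LocalizedModule.mkLinearMap W (Fin k → R))
    have hexW : Function.Exact (LocalizedModule.map W (LinearMap.ker π).subtype)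
        (LocalizedModule.map W π) := LocalizedModule.map_exact W _ _ hex
    have hιW := LocalizedModule.map_injective W (LinearMap.ker π).subtype Subtype.val_injective
    have hπW := LocalizedModule.map_surjective W π hπ
    exact ExtVanish.of_left_of_middle (X := LocalizedModule W (LinearMap.ker π))
      (Y := LocalizedModule W (Fin k → R)) (f := LocalizedModule.map W (LinearMap.ker π).subtype)
      (g := LocalizedModule.map W π) hexW hιW hπW
      (ih _ inferInstance (ExtVanish.of_middle_of_right hex Subtype.val_injective hπ
        (.of_projective (by omega)) h)) (.of_projective (by omega))

lemma IsGP.localizedModule {Y : Type u} [AddCommGroup Y] [Module R Y] [Module.Finite R Y]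
    (h : IsGP R Y) : IsGP (Localization W) (LocalizedModule W Y) := by
  rintro (_ | i) hi
  · omega
  · exact ExtVanish.localizedModule W Y inferInstance (h (i + 1) hi)

end

end

section

open TensorProduct nonZeroDivisors

lemma isIntegral_trace_of_isIntegral {S K V : Type*} [CommRing S] [Field K] [Algebra S K]
    [AddCommGroup V] [Module K V] [Module S V] [IsScalarTower S K V] [FiniteDimensional K V]
    {f : Module.End K V} (hf : IsIntegral S f) : IsIntegral S (LinearMap.trace K V f) := by
  let L := AlgebraicClosure K
  let fL : Module.End L (L ⊗[K] V) := f.baseChange L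
  obtain ⟨q, hq, hq0⟩ := hf
  have hL : Polynomial.aeval fL (q.map (algebraMap S K)) = 0 := by
    have h1 : Polynomial.aeval f (q.map (algebraMap S K)) = 0 := by
      rw [Polynomial.aeval_map_algebraMap]; exact hq0
    have h2 := congrArg (Module.End.baseChangeHom K L V) h1
    rwa [← Polynomial.aeval_algHom_apply, map_zero] at h2
  rw [← isIntegral_algebraMap_iff (algebraMap K L).injective, ← LinearMap.trace_baseChange,
    Module.End.trace_eq_sum_roots_charpoly_of_splits (f := fL) (IsAlgClosed.splits _)]
  refine IsIntegral.multiset_sum fun μ hμ ↦ ?_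
  have hroot : Module.End.HasEigenvalue fL μ :=
    (Module.End.hasEigenvalue_iff_isRoot_charpoly _ _).mpr (Polynomial.isRoot_of_mem_roots hμ)
  obtain ⟨v, hv⟩ := hroot.exists_hasEigenvector
  refine ⟨q, hq, ?_⟩
  have h3 := Module.End.aeval_apply_of_hasEigenvector (p := (q.map (algebraMap S K)).map
    (algebraMap K L)) hv
  rw [Polynomial.aeval_map_algebraMap, hL, LinearMap.zero_apply, eq_comm, smul_eq_zero] at h3
  have := h3.resolve_right hv.2
  rw [Polynomial.map_map, ← IsScalarTower.algebraMap_eq, Polynomial.eval_map] at this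
  exact this

lemma exists_trace_eq {K V : Type*} [Field K] [AddCommGroup V] [Module K V]
    [FiniteDimensional K V] (Φ : Module.End K V →ₗ[K] K) :
    ∃ g : Module.End K V, ∀ F, Φ F = LinearMap.trace K V (F * g) := by
  let T : Module.End K V →ₗ[K] Module.Dual K (Module.End K V) :=
    LinearMap.mk₂ K (fun g F ↦ LinearMap.trace K V (F * g)) (by simp [mul_add]) (by simp)
      (by simp [add_mul]) (by simp)
  have hT : Function.Injective T := by
    rw [injective_iff_map_eq_zero]
    intro g hg
    ext v
    rw [LinearMap.zero_apply, ← Module.forall_dual_apply_eq_zero_iff K]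
    intro l
    have := LinearMap.congr_fun hg (l.smulRight v)
    have h2 : l.smulRight v * g = (l ∘ₗ g).smulRight v := by ext; simp
    simpa [T, h2, LinearMap.trace_smulRight] using this
  obtain ⟨g, hg⟩ := (LinearMap.injective_iff_surjective_of_finrank_eq_finrank
    Subspace.dual_finrank_eq.symm).mp hT Φ
  exact ⟨g, fun F ↦ by rw [← hg]; rfl⟩

/-- The trace form on the endomorphism ring of a reflexive module over a normal domain is
perfect. -/
theorem exists_trace_form (S M : Type u) [CommRing S] [IsDomain S] [IsNoetherianRing S]
    [IsIntegrallyClosed S] [AddCommGroup M] [Module S M] [Module.Finite S M]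
    [Module.IsReflexive S M] :
    ∃ τ : Module.End S M →ₗ[S] S, ∀ φ : Module.End S M →ₗ[S] S,
      ∃! c : Module.End S M, ∀ b, φ b = τ (b * c) := by
  let K := FractionRing S
  let V := K ⊗[S] M
  let j : M →ₗ[S] V := TensorProduct.mk S K M 1
  have hj : IsLocalizedModule S⁰ j := inferInstance
  have : Module.FinitePresentation S M := Module.finitePresentation_of_finite S M
  have hext {N : Type u} [AddCommGroup N] [Module S N] [Module K N] [IsScalarTower S K N]
      {F G : V →ₗ[K] N} (h : ∀ m, F (j m) = G (j m)) : F = G := by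
    refine TensorProduct.AlgebraTensorModule.curry_injective ?_
    ext m
    exact h m
  let E : Module.End S M →ₐ[S] Module.End K V := Module.End.baseChangeHom S K M
  have hE (b : Module.End S M) (m : M) : E b (j m) = j (b m) := LinearMap.baseChange_tmul _ _ _
  let ev (l : Module.Dual S M) : V →ₗ[K] K :=
    (TensorProduct.AlgebraTensorModule.rid S K K).toLinearMap ∘ₗ LinearMap.baseChange K l
  have hev (l : Module.Dual S M) (m : M) : ev l (j m) = algebraMap S K (l m) := by
    change TensorProduct.AlgebraTensorModule.rid S K K ((1 : K) ⊗ₜ[S] l m) = _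
    simp [Algebra.smul_def]
  have hinj : Function.Injective (algebraMap S K) := IsFractionRing.injective S K
  have hsep (v : V) (hv : ∀ l, ev l v = 0) : v = 0 := by
    obtain ⟨⟨m, s⟩, hs⟩ := IsLocalizedModule.surj S⁰ j v
    have hm : m = 0 := by
      apply (Module.bijective_dual_eval S M).1
      ext l
      apply hinj
      have h1 : ev l ((s : S) • v) = ev l (j m) := congrArg (ev l) hs
      have h2 : ev l ((s : S) • v) = 0 := by
        rw [← algebraMap_smul K (s : S) v, (ev l).map_smul, hv, smul_zero]
      have h3 := hev l m
      rw [← h1, h2] at h3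
      simp [← h3]
    have h2 : (s : S) • v = 0 := by rw [← Submonoid.smul_def, hs, hm, map_zero]
    rw [← algebraMap_smul K (s : S) v, smul_eq_zero] at h2
    exact h2.resolve_left (by simp)
  have hjinj : Function.Injective j := by
    rw [injective_iff_map_eq_zero]
    intro m hm
    apply (Module.bijective_dual_eval S M).1
    ext l
    apply hinj
    have := hev l m
    rw [hm, map_zero] at this
    simp [← this]
  have hsurj (F : Module.End K V) : ∃ (s : S⁰) (b : Module.End S M), (s : S) • F = E b := by
    obtain ⟨b, s, hs⟩ := Module.FinitePresentation.exists_lift_of_isLocalizedModule S⁰ j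
      (F.restrictScalars S ∘ₗ j)
    refine ⟨s, b, hext fun m ↦ ?_⟩
    rw [hE]
    exact (LinearMap.congr_fun hs m).symm
  have htr (b : Module.End S M) : ∃ s : S, algebraMap S K s = LinearMap.trace K V (E b) := by
    refine IsIntegrallyClosed.isIntegral_iff.mp (isIntegral_trace_of_isIntegral ?_)
    exact (Algebra.IsIntegral.isIntegral (R := S) b).map E
  choose t ht using htr
  let τ : Module.End S M →ₗ[S] S :=
    { toFun := t
      map_add' := fun a b ↦ hinj (by simp [ht])
      map_smul' := fun a b ↦ hinj (by
        rw [ht, map_smul E, ← algebraMap_smul K a (E b), LinearMap.map_smul, ← ht]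
        simp) }
  have hEinj : Function.Injective E := fun a b hab ↦ by
    ext m
    apply hjinj
    rw [← hE, ← hE, hab]
  have hEloc : IsLocalizedModule S⁰ E.toLinearMap :=
    { map_units := fun s ↦ by
        have h0 : algebraMap S K s ≠ 0 := by simp
        rw [Module.End.isUnit_iff]
        refine ⟨fun x y hxy ↦ ?_, fun y ↦ ⟨(algebraMap S K s)⁻¹ • y, ?_⟩⟩
        · rw [Module.algebraMap_end_apply, Module.algebraMap_end_apply,
            ← algebraMap_smul K (s : S) x, ← algebraMap_smul K (s : S) y] at hxy
          exact smul_right_injective _ h0 hxy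
        · rw [Module.algebraMap_end_apply, ← algebraMap_smul K (s : S), smul_smul,
            mul_inv_cancel₀ h0, one_smul]
      surj := fun F ↦ by
        obtain ⟨s, b, h⟩ := hsurj F
        exact ⟨(b, s), h⟩
      exists_of_eq := fun {a b} h ↦ ⟨1, by rw [hEinj h]⟩ }
  have hrank (b : Module.End S M) (l : Module.Dual S M) (m : M) (hb : b = l.smulRight m)
      (g : Module.End K V) : LinearMap.trace K V (E b * g) = ev l (g (j m)) := by
    have h1 : E b = (ev l).smulRight (j m) := hext fun m' ↦ by
      rw [hE, hb, LinearMap.smulRight_apply, LinearMap.smulRight_apply, hev, algebraMap_smul,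
        map_smul]
    have h2 : E b * g = (ev l ∘ₗ g).smulRight (j m) := by
      rw [h1]; ext; simp
    rw [h2, LinearMap.trace_smulRight]
    rfl
  have hτ (b : Module.End S M) : algebraMap S K (τ b) = LinearMap.trace K V (E b) := ht b
  have hev_inj (v w : V) (h : ∀ l, ev l v = ev l w) : v = w := by
    refine sub_eq_zero.mp (hsep _ fun l ↦ ?_)
    rw [map_sub, h, sub_self]
  refine ⟨τ, fun φ ↦ ?_⟩
  obtain ⟨g, hg⟩ : ∃ g : Module.End K V,
      ∀ b, algebraMap S K (φ b) = LinearMap.trace K V (E b * g) := by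
    let Φ := IsLocalizedModule.mapExtendScalars S⁰ E.toLinearMap (Algebra.linearMap S K) K φ
    obtain ⟨g, hg⟩ := exists_trace_eq Φ
    refine ⟨g, fun b ↦ ?_⟩
    rw [← hg]
    exact (IsLocalizedModule.map_apply S⁰ E.toLinearMap (Algebra.linearMap S K) φ b).symm
  have hc (m : M) : ∃ m', j m' = g (j m) := by
    let θ : Module.Dual S (Module.Dual S M) :=
      { toFun := fun l ↦ φ (l.smulRight m)
        map_add' := fun l l' ↦ by rw [← map_add]; congr 1; ext; simp [add_smul]
        map_smul' := fun a l ↦ by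
          rw [← map_smul]; congr 1; ext; simp [mul_smul] }
    obtain ⟨m', hm'⟩ := (Module.bijective_dual_eval S M).2 θ
    refine ⟨m', hev_inj _ _ fun l ↦ ?_⟩
    rw [hev, ← hrank _ l m rfl, ← hg]
    exact congrArg _ (LinearMap.congr_fun hm' l)
  choose c₀ hc₀ using hc
  let c : Module.End S M :=
    { toFun := c₀
      map_add' := fun a b ↦ hjinj (by simp [hc₀])
      map_smul' := fun a b ↦ hjinj (by
        rw [hc₀, map_smul, ← algebraMap_smul K, map_smul, RingHom.id_apply, map_smul, hc₀,
          algebraMap_smul]) }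
  have hEc : E c = g := hext fun m ↦ by rw [hE]; exact hc₀ m
  refine ⟨c, fun b ↦ hinj ?_, fun c' hc' ↦ ?_⟩
  · rw [hg, hτ, map_mul E, hEc]
  · ext m
    apply hjinj
    refine hev_inj _ _ fun l ↦ ?_
    rw [← hE, ← hE, hEc, ← hrank _ l m rfl, ← hrank _ l m rfl, ← hg, ← map_mul E, ← hτ, hc']

end

section

open CategoryTheory

variable {R : Type u} [CommRing R] {M : Type u} [AddCommGroup M] [Module R M]

/-- Precomposition, as a linear map of modules over the endomorphism ring of the target. -/
def endLcomp {L L' : Type u} [AddCommGroup L] [Module R L] [AddCommGroup L'] [Module R L']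
    (f : L →ₗ[R] L') : (L' →ₗ[R] M) →ₗ[Module.End R M] (L →ₗ[R] M) where
  toFun g := g ∘ₗ f
  map_add' _ _ := rfl
  map_smul' _ _ := rfl

lemma projective_hom_of_retract {L L' : Type u} [AddCommGroup L] [Module R L] [AddCommGroup L']
    [Module R L'] (h : Module.Projective (Module.End R M) (L' →ₗ[R] M))
    (i : L →ₗ[R] L') (p : L' →ₗ[R] L) (hip : p ∘ₗ i = LinearMap.id) :
    Module.Projective (Module.End R M) (L →ₗ[R] M) := by
  refine Module.Projective.of_split (endLcomp p) (endLcomp i) ?_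
  ext g x
  simpa [endLcomp] using congrArg g (LinearMap.congr_fun hip x)

lemma projective_hom_of_isCompl {L : Type u} [AddCommGroup L] [Module R L]
    {U V : Submodule R L} (hUV : IsCompl U V)
    (hU : Module.Projective (Module.End R M) (U →ₗ[R] M))
    (hV : Module.Projective (Module.End R M) (V →ₗ[R] M)) :
    Module.Projective (Module.End R M) (L →ₗ[R] M) := by
  refine Module.Projective.of_split
    (M := (U →ₗ[R] M) × (V →ₗ[R] M))
    ((endLcomp (M := M) U.subtype).prod (endLcomp V.subtype))
    ((endLcomp (Submodule.projectionOnto U V hUV)).coprod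
      (endLcomp (Submodule.projectionOnto V U hUV.symm))) ?_
  ext g x
  have := LinearMap.congr_fun (Submodule.projection_add_projection_eq_id hUV) x
  conv_rhs => rw [LinearMap.id_apply, ← LinearMap.id_apply (R := R) x, ← this,
    LinearMap.add_apply, map_add]
  rfl

/-- If every indecomposable member of a class of finite modules closed under retracts is a
direct summand of `M`, then `Hom(L, M)` is projective over `End M` for each `L` in the class. -/
theorem projective_hom_of_forall_indecomposable [IsNoetherianRing R]
    (C : ∀ (L : Type u) [AddCommGroup L] [Module R L], Prop)
    (hC : ∀ (L L' : Type u) [AddCommGroup L] [Module R L] [AddCommGroup L'] [Module R L']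
      (i : L →ₗ[R] L') (p : L' →ₗ[R] L), p ∘ₗ i = LinearMap.id → C L' → C L)
    (hM : ∀ (L : Type u) [AddCommGroup L] [Module R L], Module.Finite R L → C L →
      IndecomposableModule R L → IsDirectSummand R L M)
    (L : Type u) [AddCommGroup L] [Module R L] [Module.Finite R L] (hL : C L) :
    Module.Projective (Module.End R M) (L →ₗ[R] M) := by
  by_contra hbad
  let T : Set (Submodule R L) := {K | ∃ (W : ModuleCat.{u} R) (π : L →ₗ[R] W) (s : W →ₗ[R] L),
    π ∘ₗ s = LinearMap.id ∧ LinearMap.ker π = K ∧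
      ¬ Module.Projective (Module.End R M) (W →ₗ[R] M)}
  have hT : T.Nonempty :=
    ⟨_, ModuleCat.of R L, LinearMap.id, LinearMap.id, rfl, rfl, hbad⟩
  obtain ⟨K, ⟨W, π, s, hπs, hK, hW⟩, hmax⟩ := set_has_maximal_iff_noetherian.mpr
    (inferInstance : IsNoetherian R L) T hT
  have hπsurj : Function.Surjective π := fun w ↦ ⟨s w, LinearMap.congr_fun hπs w⟩
  have hWfin : Module.Finite R W := Module.Finite.of_surjective π hπsurj
  have hCW : C W := hC W L s π hπs hL
  have key (U V : Submodule R W) (hUV : IsCompl U V) (hU : U ≠ ⊥) :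
      Module.Projective (Module.End R M) (V →ₗ[R] M) := by
    by_contra hV
    let q := Submodule.projectionOnto V U hUV.symm
    refine hmax (LinearMap.ker (q ∘ₗ π)) ⟨ModuleCat.of R V, q ∘ₗ π, s ∘ₗ V.subtype, ?_, rfl, hV⟩
      ?_
    · refine LinearMap.ext fun v ↦ ?_
      have := LinearMap.congr_fun hπs (V.subtype v)
      rw [LinearMap.comp_apply, LinearMap.id_apply] at this
      change q (π (s (V.subtype v))) = v
      rw [this]
      exact Submodule.projectionOnto_apply_left hUV.symm v
    · rw [← hK]
      refine lt_of_le_of_ne (LinearMap.ker_le_ker_comp π q) fun h ↦ hU ?_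
      rw [eq_bot_iff]
      intro u hu
      obtain ⟨l, rfl⟩ := hπsurj u
      have : l ∈ LinearMap.ker (q ∘ₗ π) := by
        exact (Submodule.projectionOnto_apply_eq_zero_iff hUV.symm).mpr hu
      rw [← h] at this
      simpa using this
  have hWnt : Nontrivial W := by
    by_contra h
    rw [not_nontrivial_iff_subsingleton] at h
    have : Subsingleton (W →ₗ[R] M) :=
      ⟨fun f g ↦ LinearMap.ext fun x ↦ by rw [Subsingleton.elim x 0, map_zero, map_zero]⟩
    exact hW inferInstance
  by_cases hind : IndecomposableModule R W
  · obtain ⟨i, p, hip⟩ := hM W hWfin hCW hind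
    refine hW (projective_hom_of_retract ?_ i p hip)
    exact (inferInstance : Module.Projective (Module.End R M) (Module.End R M))
  · simp only [IndecomposableModule, hWnt, true_and, not_forall, not_or] at hind
    obtain ⟨U, V, hUV, hU, hV⟩ := hind
    exact hW (projective_hom_of_isCompl hUV (key V U hUV.symm hV) (key U V hUV hU))

lemma endLcomp_eval_bijective {K : Type u} [AddCommGroup K] [Module R K]
    [Module.IsReflexive R M] [Module.IsReflexive R (Module.Dual R K)] :
    Function.Bijective (endLcomp (M := M) (Module.Dual.eval R K)) := by
  constructor
  · rw [injective_iff_map_eq_zero]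
    intro g hg
    ext x
    apply (Module.bijective_dual_eval R M).1
    ext l
    obtain ⟨k, hk⟩ := (Module.bijective_dual_eval R (Module.Dual R K)).2 (l ∘ₗ g)
    have hk0 : k = 0 := by
      ext y
      have h1 := LinearMap.congr_fun hk (Module.Dual.eval R K y)
      have h2 : g (Module.Dual.eval R K y) = 0 := LinearMap.congr_fun hg y
      simpa [h2] using h1
    have h3 := LinearMap.congr_fun hk x
    rw [hk0] at h3
    simpa using h3.symm
  · intro f
    refine ⟨(Module.evalEquiv R M).symm.toLinearMap ∘ₗ f.dualMap.dualMap, ?_⟩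
    ext x
    change (Module.evalEquiv R M).symm (f.dualMap.dualMap (Module.Dual.eval R K x)) = f x
    rw [LinearEquiv.symm_apply_eq]
    rfl

/-- The kernel of a map between finite free modules over `End M` is a `Hom` module. -/
lemma exists_hom_equiv_ker [Module.Finite R M] {a b : ℕ}
    (F : (Fin b → Module.End R M) →ₗ[Module.End R M] (Fin a → Module.End R M)) :
    ∃ (K : ModuleCat.{u} R) (_ : Module.Finite R K),
      Nonempty ((K →ₗ[R] M) ≃ₗ[Module.End R M] LinearMap.ker F) := by
  let θ : (Fin a → M) →ₗ[R] (Fin b → M) :=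
    LinearMap.pi fun i ↦ ∑ j, F (Pi.single i 1) j ∘ₗ LinearMap.proj j
  have hF (x : Fin b → Module.End R M) (j : Fin a) (m : M) :
      F x j m = ∑ i, x i (F (Pi.single i 1) j m) := by
    have : x = ∑ i, x i • (Pi.single i 1 : Fin b → Module.End R M) := by
      ext1 i
      simp [Finset.sum_apply, Pi.single_apply]
    conv_lhs => rw [this]
    simp [Finset.sum_apply, LinearMap.sum_apply]
  let G (g : ((Fin b → M) ⧸ LinearMap.range θ) →ₗ[R] M) : Fin b → Module.End R M :=
    fun i ↦ g ∘ₗ (LinearMap.range θ).mkQ ∘ₗ LinearMap.single R (fun _ ↦ M) i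
  have hG (g : ((Fin b → M) ⧸ LinearMap.range θ) →ₗ[R] M) : F (G g) = 0 := by
    ext j m
    rw [hF]
    simp only [G, LinearMap.comp_apply, ← map_sum]
    have h1 : ∑ i, LinearMap.single R (fun _ ↦ M) i (F (Pi.single i 1) j m) =
        θ (Pi.single j m) := by
      ext i
      simp only [θ, LinearMap.pi_apply, LinearMap.sum_apply, LinearMap.comp_apply,
        LinearMap.proj_apply, Finset.sum_apply]
      rw [Finset.sum_eq_single j (fun k _ hk ↦ by simp [hk]) (by simp),
        Finset.sum_eq_single i (fun k _ hk ↦ by simp [hk.symm]) (by simp)]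
      simp
    rw [h1, (LinearMap.range θ).mkQ_apply,
      (Submodule.Quotient.mk_eq_zero _).mpr (LinearMap.mem_range_self θ _), map_zero]
    rfl
  let E : (((Fin b → M) ⧸ LinearMap.range θ) →ₗ[R] M) →ₗ[Module.End R M] LinearMap.ker F :=
    { toFun := fun g ↦ ⟨G g, hG g⟩
      map_add' := fun _ _ ↦ rfl
      map_smul' := fun _ _ ↦ rfl }
  refine ⟨ModuleCat.of R ((Fin b → M) ⧸ LinearMap.range θ), inferInstanceAs
    (Module.Finite R ((Fin b → M) ⧸ LinearMap.range θ)), ⟨LinearEquiv.ofBijective E ⟨?_, ?_⟩⟩⟩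
  · intro g g' h
    have h1 : G g = G g' := congrArg Subtype.val h
    refine Submodule.linearMap_qext _ (LinearMap.pi_ext' fun i ↦ ?_)
    exact congrFun h1 i
  · rintro ⟨x, hx⟩
    let y : (Fin b → M) →ₗ[R] M := ∑ i, x i ∘ₗ LinearMap.proj i
    have hy : LinearMap.range θ ≤ LinearMap.ker y := by
      rintro _ ⟨m, rfl⟩
      have h2 (j : Fin a) : ∑ i, x i (F (Pi.single i 1) j (m j)) = 0 := by
        rw [← hF, LinearMap.mem_ker.mp hx]; rfl
      simp only [LinearMap.mem_ker, y, θ, LinearMap.sum_apply, LinearMap.comp_apply,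
        LinearMap.proj_apply, LinearMap.pi_apply, map_sum]
      rw [Finset.sum_comm]
      exact Finset.sum_eq_zero fun j _ ↦ h2 j
    refine ⟨(LinearMap.range θ).liftQ y hy, Subtype.ext (funext fun i ↦ ?_)⟩
    ext m
    change y (Pi.single i m) = x i m
    simp only [y, LinearMap.sum_apply, LinearMap.comp_apply, LinearMap.proj_apply]
    rw [Finset.sum_eq_single i] <;> simp +contextual



/-- If `M` contains every indecomposable finite module of Gorenstein dimension zero as a direct
summand, then `Hom(K, M)` is projective over `End M` as soon as it has Gorenstein dimension zero
over the base. -/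
theorem projective_hom_of_isGP [IsNoetherianRing R] [Module.Finite R M] {n : ℕ}
    (hn : ExtVanishAbove R n) (hM : IsGP R M) (hRM : IsDirectSummand R R M)
    (hind : ∀ (L : Type u) [AddCommGroup L] [Module R L], Module.Finite R L → IsGP R L →
      IndecomposableModule R L → IsDirectSummand R L M)
    (K : Type u) [AddCommGroup K] [Module R K] [Module.Finite R K]
    (hK : IsGP R (K →ₗ[R] M)) : Module.Projective (Module.End R M) (K →ₗ[R] M) := by
  obtain ⟨i, p, hip⟩ := hRM
  have hdual : IsGP R (Module.Dual R K) := by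
    refine hK.of_retract (LinearMap.compRight R i) (LinearMap.compRight R p) ?_
    ext f x
    exact LinearMap.congr_fun hip (f x)
  have := hM.isReflexive hn
  have := hdual.isReflexive hn
  have hproj := projective_hom_of_forall_indecomposable (fun L _ _ ↦ IsGP R L)
    (fun L L' _ _ _ _ i p hip h ↦ h.of_retract i p hip) hind
    (Module.Dual R (Module.Dual R K)) (hdual.dual hn)
  exact Module.Projective.of_equiv (LinearEquiv.ofBijective _
    (endLcomp_eval_bijective (R := R) (M := M) (K := K)))

theorem projective_ker_of_isGP [IsNoetherianRing R] [Module.Finite R M] {n : ℕ}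
    (hn : ExtVanishAbove R n) (hM : IsGP R M) (hRM : IsDirectSummand R R M)
    (hind : ∀ (L : Type u) [AddCommGroup L] [Module R L], Module.Finite R L → IsGP R L →
      IndecomposableModule R L → IsDirectSummand R L M) {a b : ℕ}
    (F : (Fin b → Module.End R M) →ₗ[Module.End R M] (Fin a → Module.End R M))
    (hF : IsGP R (LinearMap.ker F)) : Module.Projective (Module.End R M) (LinearMap.ker F) := by
  obtain ⟨K, hKfin, ⟨e⟩⟩ := exists_hom_equiv_ker F
  have hHom : IsGP R (K →ₗ[R] M) := hF.of_equiv (e.restrictScalars R)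
  have := projective_hom_of_isGP hn hM hRM hind K hHom
  exact Module.Projective.of_equiv e

end

section

open CategoryTheory

variable {A : Type u} [Ring A]

lemma hasProjectiveDimensionLE_zero_iff {X : Type u} [AddCommGroup X] [Module A X] :
    HasProjectiveDimensionLE (ModuleCat.of A X) 0 ↔ Module.Projective A X := by
  rw [← projective_iff_hasProjectiveDimensionLE_zero, IsProjective.iff_projective]

section

variable {X Y : Type u} [AddCommGroup X] [AddCommGroup Y] [Module A X] [Module A Y]
  {f : Y →ₗ[A] X} {n : ℕ}

lemma hasProjectiveDimensionLE_succ_of_ker (hY : Module.Projective A Y)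
    (hf : Function.Surjective f)
    (h : HasProjectiveDimensionLE (ModuleCat.of A (LinearMap.ker f)) n) :
    HasProjectiveDimensionLE (ModuleCat.of A X) (n + 1) := by
  have : Projective (ModuleCat.of A Y) := inferInstance
  have h1 : HasProjectiveDimensionLT (ModuleCat.of A Y) 1 := inferInstance
  exact (shortExact_shortComplexOfExact (LinearMap.exact_subtype_ker_map f)
    Subtype.val_injective hf).hasProjectiveDimensionLT_X₃ (n + 1) h
    (hasProjectiveDimensionLT_of_ge _ 1 (n + 1 + 1) (by omega))

lemma hasProjectiveDimensionLE_ker (hY : Module.Projective A Y)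
    (hf : Function.Surjective f)
    (h : HasProjectiveDimensionLE (ModuleCat.of A X) (n + 1)) :
    HasProjectiveDimensionLE (ModuleCat.of A (LinearMap.ker f)) n := by
  have : Projective (ModuleCat.of A Y) := inferInstance
  have h1 : HasProjectiveDimensionLT (ModuleCat.of A Y) 1 := inferInstance
  exact (shortExact_shortComplexOfExact (LinearMap.exact_subtype_ker_map f)
    Subtype.val_injective hf).hasProjectiveDimensionLT_X₁ (n + 1)
    (hasProjectiveDimensionLT_of_ge _ 1 (n + 1) (by omega)) h

end

lemma PDLE_iff_hasProjectiveDimensionLE (n : ℕ) : ∀ (X : Type u) [AddCommGroup X] [Module A X],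
    PDLE A n X ↔ HasProjectiveDimensionLE (ModuleCat.of A X) n := by
  induction n with
  | zero => exact fun X _ _ ↦ hasProjectiveDimensionLE_zero_iff.symm
  | succ n ih =>
    intro X _ _
    constructor
    · rintro (h | ⟨ι, f, hf, h⟩)
      · have := hasProjectiveDimensionLE_zero_iff.mpr h
        exact hasProjectiveDimensionLT_of_ge _ 1 (n + 1 + 1) (by omega)
      · exact hasProjectiveDimensionLE_succ_of_ker inferInstance hf ((ih _).mp h)
    · intro h
      refine Or.inr ⟨X, Finsupp.linearCombination A id, fun x ↦ ⟨Finsupp.single x 1, by simp⟩, ?_⟩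
      exact (ih _).mpr (hasProjectiveDimensionLE_ker inferInstance
        (fun x ↦ ⟨Finsupp.single x 1, by simp⟩) h)

variable {R : Type u} [CommRing R] [Algebra R A] [IsNoetherianRing A]

theorem hasProjectiveDimensionLE_ker_of_extVanish (hA : IsGP R A)
    (hP : ∀ (a b : ℕ) (F : (Fin b → A) →ₗ[A] (Fin a → A)), IsGP R (LinearMap.ker F) →
      Module.Projective A (LinearMap.ker F)) (n : ℕ) :
    ∀ {a b : ℕ} (F : (Fin b → A) →ₗ[A] (Fin a → A)),
      (∀ i, n < i → ExtVanish R i (LinearMap.ker F)) →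
      HasProjectiveDimensionLE (ModuleCat.of A (LinearMap.ker F)) n := by
  induction n with
  | zero => exact fun F hF ↦ hasProjectiveDimensionLE_zero_iff.mpr (hP _ _ F fun i hi ↦ hF i hi)
  | succ n ih =>
    intro a b F hF
    obtain ⟨c, π, hπ⟩ := Module.Finite.exists_fin' A (LinearMap.ker F)
    refine hasProjectiveDimensionLE_succ_of_ker inferInstance hπ ?_
    have hker : LinearMap.ker ((LinearMap.ker F).subtype ∘ₗ π) = LinearMap.ker π :=
      LinearMap.ker_comp_of_ker_eq_bot _ (Submodule.ker_subtype _)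
    rw [← hker]
    refine ih _ fun i hi ↦ ?_
    rw [hker]
    exact ExtVanish.of_middle_of_right (f := (LinearMap.ker π).subtype.restrictScalars R)
      (g := π.restrictScalars R) (LinearMap.exact_subtype_ker_map π) Subtype.val_injective hπ
      (hA.pi c i (by omega)) (hF (i + 1) (by omega))

theorem hasProjectiveDimensionLE_add_two [Module.Finite R A] [IsNoetherianRing R] {d : ℕ}
    (hd : ExtVanishAbove R d) (hA : IsGP R A)
    (hP : ∀ (a b : ℕ) (F : (Fin b → A) →ₗ[A] (Fin a → A)), IsGP R (LinearMap.ker F) →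
      Module.Projective A (LinearMap.ker F))
    (X : Type u) [AddCommGroup X] [Module A X] [Module.Finite A X] :
    HasProjectiveDimensionLE (ModuleCat.of A X) (d + 2) := by
  obtain ⟨a, π, hπ⟩ := Module.Finite.exists_fin' A X
  refine hasProjectiveDimensionLE_succ_of_ker inferInstance hπ ?_
  obtain ⟨b, ρ, hρ⟩ := Module.Finite.exists_fin' A (LinearMap.ker π)
  refine hasProjectiveDimensionLE_succ_of_ker inferInstance hρ ?_
  have hker : LinearMap.ker ((LinearMap.ker π).subtype ∘ₗ ρ) = LinearMap.ker ρ :=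
    LinearMap.ker_comp_of_ker_eq_bot _ (Submodule.ker_subtype _)
  rw [← hker]
  refine hasProjectiveDimensionLE_ker_of_extVanish hA hP d _ fun i hi ↦ hd _ ?_ i hi
  have : IsNoetherian R (Fin b → A) := inferInstance
  exact Module.Finite.of_injective
    ((LinearMap.ker ((LinearMap.ker π).subtype ∘ₗ ρ)).subtype.restrictScalars R)
    Subtype.val_injective

end

section

open CategoryTheory

variable {R : Type u} [CommRing R] (W : Submonoid R) {A B : Type u} [Ring A] [Ring B]
  [Algebra R A] [Algebra R B] (φ : A →ₐ[R] B)

/-- `ψ` exhibits the `B`-module `X` as the localization of the `A`-module `Y`. -/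
structure IsSemilinearLocalization {Y X : Type u} [AddCommGroup Y] [AddCommGroup X] [Module R Y]
    [Module A Y] [Module R X] [Module B X] (ψ : Y →ₗ[R] X) : Prop where
  isLocalizedModule : IsLocalizedModule W ψ
  map_smul : ∀ (a : A) (y : Y), ψ (a • y) = φ a • ψ y

namespace IsSemilinearLocalization

variable {W φ}
variable {Y X Y' X' : Type u} [AddCommGroup Y] [AddCommGroup X] [Module R Y]
  [Module A Y] [Module R X] [Module B X] [AddCommGroup Y'] [AddCommGroup X'] [Module R Y']
  [Module A Y'] [Module R X'] [Module B X'] {ψ : Y →ₗ[R] X} {ψ' : Y' →ₗ[R] X'}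

lemma smul_injective (h : IsSemilinearLocalization W φ ψ) (w : W) {x y : X}
    (hxy : (w : R) • x = (w : R) • y) : x = y := by
  have := h.isLocalizedModule
  exact IsLocalizedModule.smul_injective ψ w hxy

lemma pi (h : IsSemilinearLocalization W φ ψ) (n : ℕ) :
    IsSemilinearLocalization W φ (LinearMap.pi fun i : Fin n ↦ ψ ∘ₗ LinearMap.proj i) where
  isLocalizedModule := by
    have := h.isLocalizedModule
    infer_instance
  map_smul a y := by
    ext i
    exact h.map_smul a (y i)

variable [IsScalarTower R B X] [IsScalarTower R B X']

lemma ext (h : IsSemilinearLocalization W φ ψ) (h' : IsSemilinearLocalization W φ ψ')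
    {F G : X →ₗ[B] X'} (hFG : ∀ y, F (ψ y) = G (ψ y)) : F = G := by
  have := h.isLocalizedModule
  have := h'.isLocalizedModule
  ext x
  obtain ⟨⟨y, v⟩, hv⟩ := IsLocalizedModule.surj W ψ x
  change (v : R) • x = ψ y at hv
  refine h'.smul_injective v ?_
  rw [← F.map_smul_of_tower, ← G.map_smul_of_tower, hv, hFG]

variable [IsScalarTower R A Y] [IsScalarTower R A Y']

/-- The extension of an `A`-linear map to the localizations, as a `B`-linear map. -/
lemma exists_map (hφ : IsLocalizedModule W φ.toLinearMap) (h : IsSemilinearLocalization W φ ψ)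
    (h' : IsSemilinearLocalization W φ ψ') (f : Y →ₗ[A] Y') :
    ∃ F : X →ₗ[B] X', ∀ y, F (ψ y) = ψ' (f y) := by
  have := h.isLocalizedModule
  have := h'.isLocalizedModule
  let F₀ := IsLocalizedModule.map W ψ ψ' (f.restrictScalars R)
  have hF₀ (y : Y) : F₀ (ψ y) = ψ' (f y) := IsLocalizedModule.map_apply _ _ _ _ _
  refine ⟨{ F₀ with map_smul' := fun β x ↦ ?_ }, hF₀⟩
  obtain ⟨⟨a, w⟩, hw⟩ := IsLocalizedModule.surj W φ.toLinearMap β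
  obtain ⟨⟨y, v⟩, hv⟩ := IsLocalizedModule.surj W ψ x
  change (w : R) • β = φ a at hw
  change (v : R) • x = ψ y at hv
  change F₀ (β • x) = β • F₀ x
  refine h'.smul_injective (w * v) ?_
  have h1 : ((w * v : W) : R) • β • x = ψ (a • y) := by
    rw [h.map_smul, ← hw, ← hv, Submonoid.coe_mul, mul_smul, smul_comm (v : R) β x, smul_assoc]
  rw [← F₀.map_smul, h1, hF₀, f.map_smul, h'.map_smul, ← hF₀, ← hv, F₀.map_smul, ← hw,
    Submonoid.coe_mul, mul_smul, smul_comm (v : R) β (F₀ x), smul_assoc]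

lemma exists_ker (h : IsSemilinearLocalization W φ ψ) (h' : IsSemilinearLocalization W φ ψ')
    (f : Y →ₗ[A] Y') (F : X →ₗ[B] X') (hF : ∀ y, F (ψ y) = ψ' (f y)) :
    ∃ ψ₀ : LinearMap.ker f →ₗ[R] LinearMap.ker F, IsSemilinearLocalization W φ ψ₀ := by
  have := h.isLocalizedModule
  have := h'.isLocalizedModule
  let ψ₀ : LinearMap.ker f →ₗ[R] LinearMap.ker F :=
    { toFun := fun z ↦ ⟨ψ z, by rw [LinearMap.mem_ker, hF, LinearMap.mem_ker.mp z.2, map_zero]⟩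
      map_add' := fun _ _ ↦ Subtype.ext (by simp)
      map_smul' := fun _ _ ↦ Subtype.ext (by simp) }
  refine ⟨ψ₀, ⟨fun v ↦ ?_, fun x ↦ ?_, fun {a b} hab ↦ ?_⟩, fun a y ↦ Subtype.ext ?_⟩
  · rw [Module.End.isUnit_iff]
    refine ⟨fun x y hxy ↦ Subtype.ext (h.smul_injective v (congrArg Subtype.val hxy)), fun x ↦ ?_⟩
    obtain ⟨z, hz⟩ := ((Module.End.isUnit_iff _).mp (IsLocalizedModule.map_units ψ v)).2 x
    change (v : R) • z = x at hz
    refine ⟨⟨z, LinearMap.mem_ker.mpr (h'.smul_injective v ?_)⟩, Subtype.ext hz⟩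
    rw [← F.map_smul_of_tower, hz, smul_zero]
    exact x.2
  · obtain ⟨⟨y, v⟩, hv⟩ := IsLocalizedModule.surj W ψ (x : X)
    change (v : R) • (x : X) = ψ y at hv
    obtain ⟨w, hw⟩ := IsLocalizedModule.exists_of_eq (S := W) (f := ψ') (x₁ := f y) (x₂ := 0) (by
      rw [← hF, ← hv, F.map_smul_of_tower, LinearMap.mem_ker.mp x.2, smul_zero, map_zero])
    change (w : R) • f y = (w : R) • (0 : Y') at hw
    refine ⟨(⟨(w : R) • y, ?_⟩, w * v), Subtype.ext ?_⟩
    · rw [LinearMap.mem_ker, f.map_smul_of_tower, hw, smul_zero]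
    · change ((w : R) * (v : R)) • (x : X) = ψ ((w : R) • y)
      rw [mul_smul, hv, ψ.map_smul]
  · obtain ⟨w, hw⟩ := IsLocalizedModule.exists_of_eq (S := W) (f := ψ) (congrArg Subtype.val hab)
    exact ⟨w, Subtype.ext hw⟩
  · exact h.map_smul a y

lemma self (hφ : IsLocalizedModule W φ.toLinearMap) :
    IsSemilinearLocalization W φ φ.toLinearMap :=
  ⟨hφ, fun a y ↦ by simp⟩

lemma projective (hφ : IsLocalizedModule W φ.toLinearMap) (h : IsSemilinearLocalization W φ ψ)
    [Module.Finite A Y] (hY : Module.Projective A Y) : Module.Projective B X := by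
  obtain ⟨n, π, hπ⟩ := Module.Finite.exists_fin' A Y
  obtain ⟨s, hs⟩ := Module.projective_lifting_property π LinearMap.id hπ
  have hn := (self hφ).pi n
  obtain ⟨P, hP⟩ := exists_map hφ hn h π
  obtain ⟨S, hS⟩ := exists_map hφ h hn s
  refine Module.Projective.of_split S P (ext h h fun y ↦ ?_)
  rw [LinearMap.comp_apply, hS, hP]
  exact congrArg ψ (LinearMap.congr_fun hs y)

lemma hasProjectiveDimensionLE (hφ : IsLocalizedModule W φ.toLinearMap) [IsNoetherianRing A]
    (n : ℕ) : ∀ {Y X : Type u} [AddCommGroup Y] [AddCommGroup X] [Module R Y]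
      [Module A Y] [Module R X] [Module B X] [IsScalarTower R A Y] [IsScalarTower R B X]
      {ψ : Y →ₗ[R] X}, IsSemilinearLocalization W φ ψ → Module.Finite A Y →
      HasProjectiveDimensionLE (ModuleCat.of A Y) n →
      HasProjectiveDimensionLE (ModuleCat.of B X) n := by
  induction n with
  | zero =>
    intro Y X _ _ _ _ _ _ _ _ ψ h hY hpd
    rw [hasProjectiveDimensionLE_zero_iff] at hpd ⊢
    exact h.projective hφ hpd
  | succ n ih =>
    intro Y X _ _ _ _ _ _ _ _ ψ h hY hpd
    obtain ⟨n, π, hπ⟩ := Module.Finite.exists_fin' A Y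
    have hn := (self hφ).pi n
    obtain ⟨P, hP⟩ := exists_map hφ hn h π
    have := hn.isLocalizedModule
    have := h.isLocalizedModule
    have hPsurj : Function.Surjective P := by
      intro x
      obtain ⟨⟨y, v⟩, hv⟩ := IsLocalizedModule.surj W ψ x
      change (v : R) • x = ψ y at hv
      obtain ⟨z, rfl⟩ := hπ y
      obtain ⟨z', hz'⟩ := ((Module.End.isUnit_iff _).mp
        (IsLocalizedModule.map_units (LinearMap.pi fun i : Fin n ↦
          φ.toLinearMap ∘ₗ LinearMap.proj i) v)).2
          ((LinearMap.pi fun i : Fin n ↦ φ.toLinearMap ∘ₗ LinearMap.proj i) z)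
      refine ⟨z', h.smul_injective v ?_⟩
      rw [hv, ← P.map_smul_of_tower, ← hP]
      exact congrArg P hz'
    obtain ⟨ψ₀, h₀⟩ := exists_ker hn h π P hP
    exact hasProjectiveDimensionLE_succ_of_ker inferInstance hPsurj
      (ih h₀ inferInstance (hasProjectiveDimensionLE_ker inferInstance hπ hpd))

lemma exists_of_finite (hφ : IsLocalizedModule W φ.toLinearMap) (X : Type u)
    [AddCommGroup X] [Module R X] [Module B X] [IsScalarTower R B X] [Module.Finite B X] :
    ∃ (Y : ModuleCat.{u} A) (_ : Module R Y) (_ : IsScalarTower R A Y) (_ : Module.Finite A Y)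
      (ψ : Y →ₗ[R] X), IsSemilinearLocalization W φ ψ := by
  obtain ⟨n, π, hπ⟩ := Module.Finite.exists_fin' B X
  have hn := (self hφ).pi n
  have := hn.isLocalizedModule
  set θ := LinearMap.pi fun i : Fin n ↦ φ.toLinearMap ∘ₗ LinearMap.proj i
  let N : Submodule A (Fin n → A) :=
    { carrier := {y | π (θ y) = 0}
      add_mem' := fun {a b} ha hb ↦ by
        simp only [Set.mem_ofPred_eq] at ha hb ⊢
        rw [map_add, map_add, ha, hb, add_zero]
      zero_mem' := by simp
      smul_mem' := fun a y hy ↦ by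
        simp only [Set.mem_ofPred_eq] at hy ⊢
        rw [hn.map_smul, π.map_smul, hy, smul_zero] }
  let ψ : ((Fin n → A) ⧸ N) →ₗ[R] X :=
    (N.restrictScalars R).liftQ (π.restrictScalars R ∘ₗ θ) fun y hy ↦ hy
  have hψ (y : Fin n → A) : ψ (N.mkQ y) = π (θ y) := rfl
  have hψinj : Function.Injective ψ := by
    rw [injective_iff_map_eq_zero]
    intro y hy
    obtain ⟨y, rfl⟩ := N.mkQ_surjective y
    exact (Submodule.Quotient.mk_eq_zero N).mpr hy
  have hB (w : W) : ∃ b : B, ∀ x : X, (w : R) • b • x = x := by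
    obtain ⟨b, hb⟩ := ((Module.End.isUnit_iff _).mp
      (IsLocalizedModule.map_units φ.toLinearMap w)).2 1
    change (w : R) • b = 1 at hb
    exact ⟨b, fun x ↦ by rw [← smul_assoc, hb, one_smul]⟩
  refine ⟨ModuleCat.of A ((Fin n → A) ⧸ N), inferInstanceAs (Module R ((Fin n → A) ⧸ N)),
    inferInstanceAs (IsScalarTower R A ((Fin n → A) ⧸ N)),
    inferInstanceAs (Module.Finite A ((Fin n → A) ⧸ N)), ψ, ⟨fun w ↦ ?_, fun x ↦ ?_,
      fun {a b} hab ↦ ⟨1, by rw [hψinj hab]⟩⟩, fun a y ↦ ?_⟩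
  · rw [Module.End.isUnit_iff]
    obtain ⟨b, hb⟩ := hB w
    refine ⟨fun x y hxy ↦ ?_, fun x ↦ ⟨b • x, hb x⟩⟩
    change (w : R) • x = (w : R) • y at hxy
    rw [← hb x, ← hb y, smul_comm, hxy, smul_comm]
  · obtain ⟨z, rfl⟩ := hπ x
    obtain ⟨⟨y, v⟩, hv⟩ := IsLocalizedModule.surj W θ z
    change (v : R) • z = θ y at hv
    refine ⟨(N.mkQ y, v), ?_⟩
    change (v : R) • π z = π (θ y)
    rw [← hv, π.map_smul_of_tower]
  · obtain ⟨y, rfl⟩ := N.mkQ_surjective y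
    rw [← N.mkQ.map_smul, hψ, hψ, hn.map_smul, π.map_smul]

theorem forall_hasProjectiveDimensionLE (hφ : IsLocalizedModule W φ.toLinearMap)
    [IsNoetherianRing A] {n : ℕ}
    (hA : ∀ (Y : Type u) [AddCommGroup Y] [Module A Y] [Module.Finite A Y],
      HasProjectiveDimensionLE (ModuleCat.of A Y) n)
    (X : Type u) [AddCommGroup X] [Module B X] [Module.Finite B X] :
    HasProjectiveDimensionLE (ModuleCat.of B X) n := by
  let _ : Module R X := Module.compHom X (algebraMap R B)
  have : IsScalarTower R B X := .of_algebraMap_smul fun _ _ ↦ rfl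
  obtain ⟨Y, _, _, hY, ψ, hψ⟩ := exists_of_finite hφ X
  exact hasProjectiveDimensionLE hφ n hψ hY (hA Y)

end IsSemilinearLocalization

end

section

open CategoryTheory TensorProduct

variable {S : Type u} [CommRing S] {B : Type u} [Ring B] [Algebra S B]

/-- Maps into an algebra with a perfect trace form extend along injections whose cokernel has
vanishing first extension group over the base. -/
lemma exists_extend_of_trace_form {τ : B →ₗ[S] S}
    (hτ : ∀ φ : B →ₗ[S] S, ∃! c : B, ∀ b, φ b = τ (b * c))
    {X Y Z : Type u} [AddCommGroup X] [AddCommGroup Y] [AddCommGroup Z] [Module S X] [Module S Y]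
    [Module S Z] [Module B X] [Module B Y] [Module B Z] [IsScalarTower S B X]
    [IsScalarTower S B Y] [IsScalarTower S B Z] {i : X →ₗ[B] Y} {g : Y →ₗ[B] Z}
    (h : Function.Exact i g) (hi : Function.Injective i) (hg : Function.Surjective g)
    (hZ : ExtVanish S 1 Z) (f : X →ₗ[B] B) : ∃ F : Y →ₗ[B] B, F ∘ₗ i = f := by
  obtain ⟨ψ, hψ⟩ := ExtVanish.exists_extend (f := i.restrictScalars S) (g := g.restrictScalars S)
    h hi hg hZ (τ ∘ₗ f.restrictScalars S)
  let φ (y : Y) : B →ₗ[S] S := ψ ∘ₗ (LinearMap.toSpanSingleton B Y y).restrictScalars S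
  choose c hc using fun y ↦ (hτ (φ y)).exists
  have huniq (y : Y) (b' : B) (hb' : ∀ b : B, ψ (b • y) = τ (b * b')) : c y = b' :=
    (hτ (φ y)).unique (hc y) hb'
  have hc' (y : Y) (b : B) : ψ (b • y) = τ (b * c y) := hc y b
  refine ⟨⟨⟨c, fun y y' ↦ huniq _ _ fun b ↦ ?_⟩, fun a y ↦ huniq _ _ fun b ↦ ?_⟩, ?_⟩
  · rw [smul_add, map_add, hc', hc', mul_add, map_add]
  · rw [smul_smul, hc', RingHom.id_apply, smul_eq_mul, mul_assoc]
  · ext x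
    refine huniq _ _ fun b ↦ ?_
    rw [← i.map_smul]
    have := LinearMap.congr_fun hψ (b • x)
    simpa using this

variable [IsNoetherianRing B]

lemma projective_of_isGP_of_hasProjectiveDimensionLE (hB : IsGP S B) {τ : B →ₗ[S] S}
    (hτ : ∀ φ : B →ₗ[S] S, ∃! c : B, ∀ b, φ b = τ (b * c)) (n : ℕ) :
    ∀ (Z : Type u) [AddCommGroup Z] [Module S Z] [Module B Z] [IsScalarTower S B Z]
      [Module.Finite B Z], IsGP S Z → HasProjectiveDimensionLE (ModuleCat.of B Z) n →
      Module.Projective B Z := by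
  induction n with
  | zero => exact fun Z _ _ _ _ _ _ h ↦ hasProjectiveDimensionLE_zero_iff.mp h
  | succ n ih =>
    intro Z _ _ _ _ _ hZ h
    obtain ⟨a, π, hπ⟩ := Module.Finite.exists_fin' B Z
    have hGP : IsGP S (LinearMap.ker π) :=
      .of_middle_of_right (f := (LinearMap.ker π).subtype.restrictScalars S)
        (g := π.restrictScalars S) (LinearMap.exact_subtype_ker_map π) Subtype.val_injective hπ
        (hB.pi a) hZ
    have hproj := ih (LinearMap.ker π) hGP (hasProjectiveDimensionLE_ker inferInstance hπ h)
    obtain ⟨b, ρ, hρ⟩ := Module.Finite.exists_fin' B (LinearMap.ker π)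
    obtain ⟨s, hs⟩ := Module.projective_lifting_property ρ LinearMap.id hρ
    choose F hF using fun j ↦ exists_extend_of_trace_form hτ (LinearMap.exact_subtype_ker_map π)
      Subtype.val_injective hπ (hZ 1 le_rfl) (LinearMap.proj j ∘ₗ s)
    have hret : (ρ ∘ₗ LinearMap.pi F) ∘ₗ (LinearMap.ker π).subtype = LinearMap.id := by
      rw [← hs, LinearMap.comp_assoc]
      congr 1
      ext x j
      exact LinearMap.congr_fun (hF j) x
    have hsplit : (Function.Surjective π ∧ ∃ l, l ∘ₗ (LinearMap.ker π).subtype = .id) →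
        Function.Injective (LinearMap.ker π).subtype ∧ ∃ l, π ∘ₗ l = .id :=
      ((LinearMap.exact_subtype_ker_map π).split_tfae'.out 1 0).mp
    obtain ⟨-, l, hl⟩ := hsplit ⟨hπ, _, hret⟩
    exact Module.Projective.of_split l π hl

lemma hasProjectiveDimensionLE_of_extVanish (hB : IsGP S B) {τ : B →ₗ[S] S}
    (hτ : ∀ φ : B →ₗ[S] S, ∃! c : B, ∀ b, φ b = τ (b * c)) {n : ℕ}
    (hn : ∀ (Z : Type u) [AddCommGroup Z] [Module B Z] [Module.Finite B Z],
      HasProjectiveDimensionLE (ModuleCat.of B Z) n) (m : ℕ) :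
    ∀ (Z : Type u) [AddCommGroup Z] [Module S Z] [Module B Z] [IsScalarTower S B Z]
      [Module.Finite B Z], (∀ i, m < i → ExtVanish S i Z) →
      HasProjectiveDimensionLE (ModuleCat.of B Z) m := by
  induction m with
  | zero =>
    intro Z _ _ _ _ _ hZ
    exact hasProjectiveDimensionLE_zero_iff.mpr
      (projective_of_isGP_of_hasProjectiveDimensionLE hB hτ n Z (fun i hi ↦ hZ i hi) (hn Z))
  | succ m ih =>
    intro Z _ _ _ _ _ hZ
    obtain ⟨a, π, hπ⟩ := Module.Finite.exists_fin' B Z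
    refine hasProjectiveDimensionLE_succ_of_ker inferInstance hπ (ih _ fun i hi ↦ ?_)
    exact ExtVanish.of_middle_of_right (f := (LinearMap.ker π).subtype.restrictScalars S)
      (g := π.restrictScalars S) (LinearMap.exact_subtype_ker_map π) Subtype.val_injective hπ
      (hB.pi a i (by omega)) (hZ (i + 1) (by omega))

lemma extVanish_of_hasProjectiveDimensionLE (hB : IsGP S B) (k : ℕ) :
    ∀ (Z : Type u) [AddCommGroup Z] [Module S Z] [Module B Z] [IsScalarTower S B Z]
      [Module.Finite B Z], HasProjectiveDimensionLE (ModuleCat.of B Z) k →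
      ∀ i, k < i → ExtVanish S i Z := by
  induction k with
  | zero =>
    intro Z _ _ _ _ _ hZ i hi
    rw [hasProjectiveDimensionLE_zero_iff] at hZ
    obtain ⟨a, π, hπ⟩ := Module.Finite.exists_fin' B Z
    obtain ⟨s, hs⟩ := Module.projective_lifting_property π LinearMap.id hπ
    exact (hB.pi a).of_retract (s.restrictScalars S) (π.restrictScalars S)
      (LinearMap.ext fun z ↦ LinearMap.congr_fun hs z) i hi
  | succ k ih =>
    intro Z _ _ _ _ _ hZ i hi
    obtain ⟨a, π, hπ⟩ := Module.Finite.exists_fin' B Z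
    obtain ⟨i, rfl⟩ : ∃ j, i = j + 1 := ⟨i - 1, by omega⟩
    exact ExtVanish.of_left_of_middle (f := (LinearMap.ker π).subtype.restrictScalars S)
      (g := π.restrictScalars S) (LinearMap.exact_subtype_ker_map π) Subtype.val_injective hπ
      (ih _ (hasProjectiveDimensionLE_ker inferInstance hπ hZ) i (by omega))
      (hB.pi a (i + 1) (by omega))

theorem globalDimLE_iff_of_trace_form [IsLocalRing S] [Module.Finite S B] (hB : IsGP S B)
    {τ : B →ₗ[S] S}
    (hτ : ∀ φ : B →ₗ[S] S, ∃! c : B, ∀ b, φ b = τ (b * c)) {n : ℕ}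
    (hn : ∀ (Z : Type u) [AddCommGroup Z] [Module B Z] [Module.Finite B Z],
      HasProjectiveDimensionLE (ModuleCat.of B Z) n) {t : ℕ} (hS : ExtVanishAbove S t)
    (hk : ¬ ExtVanish S t (S ⧸ IsLocalRing.maximalIdeal S))
    (hSB : IsDirectSummand S S B) (k : ℕ) : GlobalDimLE B k ↔ t ≤ k := by
  constructor
  · intro h
    by_contra! hlt
    let κ := S ⧸ IsLocalRing.maximalIdeal S
    obtain ⟨i, p, hip⟩ := hSB
    have hfin : Module.Finite B (B ⊗[S] κ) := by
      refine Module.Finite.of_surjective (M := B) (LinearMap.toSpanSingleton B (B ⊗[S] κ)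
        (1 ⊗ₜ[S] (1 : κ))) fun x ↦ ?_
      induction x with
      | zero => exact ⟨0, by simp⟩
      | add x y hx hy =>
        obtain ⟨a, rfl⟩ := hx
        obtain ⟨b, rfl⟩ := hy
        exact ⟨a + b, map_add _ _ _⟩
      | tmul b c =>
        obtain ⟨s, rfl⟩ := Ideal.Quotient.mk_surjective c
        refine ⟨s • b, ?_⟩
        have : (Ideal.Quotient.mk (IsLocalRing.maximalIdeal S) s : κ) = s • (1 : κ) := by
          rw [Algebra.smul_def, mul_one]; rfl
        rw [this, TensorProduct.tmul_smul, LinearMap.toSpanSingleton_apply, TensorProduct.smul_tmul',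
          smul_eq_mul, mul_one, TensorProduct.smul_tmul']
    have h1 := extVanish_of_hasProjectiveDimensionLE hB k (B ⊗[S] κ)
      ((PDLE_iff_hasProjectiveDimensionLE k _).mp (h _ hfin)) t hlt
    have h2 : ExtVanish S t (S ⊗[S] κ) :=
      h1.of_retract (LinearMap.rTensor κ i) (LinearMap.rTensor κ p) (by
        rw [← LinearMap.rTensor_comp, hip, LinearMap.rTensor_id])
    exact hk (h2.of_equiv (TensorProduct.lid S κ).symm)
  · intro htk Z _ _ hZ
    let _ : Module S Z := Module.compHom Z (algebraMap S B)
    have : IsScalarTower S B Z := .of_algebraMap_smul fun _ _ ↦ rfl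
    have : Module.Finite S Z := Module.Finite.trans B Z
    exact (PDLE_iff_hasProjectiveDimensionLE k Z).mpr
      (hasProjectiveDimensionLE_of_extVanish hB hτ hn k Z
        fun i hi ↦ hS Z inferInstance i (by omega))

end

section

open CategoryTheory

variable {R : Type u} [CommRing R]

section

variable (W : Submonoid R) {S : Type u} [CommRing S] [Algebra R S]
  [IsLocalization W S] {M N : Type u} [AddCommGroup M] [Module R M] [AddCommGroup N] [Module R N]
  [Module S N] [IsScalarTower R S N] (j : M →ₗ[R] N) [IsLocalizedModule W j]

variable (S) in
/-- Localization of endomorphisms, as an algebra map. -/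
noncomputable def endLocalization : Module.End R M →ₐ[R] Module.End S N :=
  AlgHom.ofLinearMap (IsLocalizedModule.mapExtendScalars W j j S)
    (LinearMap.restrictScalars_injective R (IsLocalizedModule.ext W j
      (IsLocalizedModule.map_units j) (by ext m; exact IsLocalizedModule.map_apply W j j _ m)))
    (fun f g ↦ LinearMap.restrictScalars_injective R (IsLocalizedModule.ext W j
      (IsLocalizedModule.map_units j) (by
        ext m
        have h (f : M →ₗ[R] M) (m : M) :
            IsLocalizedModule.mapExtendScalars W j j S f (j m) = j (f m) :=
          IsLocalizedModule.map_apply W j j f m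
        change IsLocalizedModule.mapExtendScalars W j j S (f * g) (j m) =
          IsLocalizedModule.mapExtendScalars W j j S f
            (IsLocalizedModule.mapExtendScalars W j j S g (j m))
        rw [h, h, h]
        rfl)))

lemma isLocalizedModule_endLocalization [Module.FinitePresentation R M] :
    IsLocalizedModule W (endLocalization W S j).toLinearMap :=
  inferInstanceAs (IsLocalizedModule W (IsLocalizedModule.mapExtendScalars W j j S))

lemma isDirectSummand_end (W : Submonoid R) [IsLocalization W S] (j : M →ₗ[R] N)
    [IsLocalizedModule W j] (hRM : IsDirectSummand R R M) :
    IsDirectSummand S S (Module.End S N) := by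
  obtain ⟨i, p, hip⟩ := hRM
  have : IsLocalizedModule W (Algebra.linearMap R S) := inferInstance
  let p' : N →ₗ[S] S := IsLocalizedModule.mapExtendScalars W j (Algebra.linearMap R S) S p
  have hp' (m : M) : p' (j m) = algebraMap R S (p m) :=
    IsLocalizedModule.map_apply W j (Algebra.linearMap R S) p m
  refine ⟨LinearMap.toSpanSingleton S _ 1, p' ∘ₗ LinearMap.applyₗ (j (i 1)), ?_⟩
  ext
  have : p (i 1) = 1 := LinearMap.congr_fun hip 1
  simp [hp', this]

end

lemma IsGP.of_isLocalizedModule [IsNoetherianRing R] {W : Submonoid R} {Y X : Type u}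
    [AddCommGroup Y] [Module R Y]
    [Module.Finite R Y] (h : IsGP R Y) [AddCommGroup X] [Module R X] [Module (Localization W) X]
    [IsScalarTower R (Localization W) X] (f : Y →ₗ[R] X) [IsLocalizedModule W f] :
    IsGP (Localization W) X :=
  (h.localizedModule W).of_equiv
    ((IsLocalizedModule.iso W f).extendScalarsOfIsLocalization W (Localization W)).symm

theorem exists_ringKrullDim_eq_and_globalDimLE_iff [IsNoetherianRing R] [IsDomain R]
    [IsIntegrallyClosed R] {n : ℕ} (hn : HasInjectiveDimensionLE (ModuleCat.of R R) n) {M : Type u}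
    [AddCommGroup M] [Module R M] [Module.Finite R M] (hRM : IsDirectSummand R R M)
    (hM : IsGP R M) (hA : IsGP R (Module.End R M)) {m : ℕ}
    (hfin : ∀ (Y : Type u) [AddCommGroup Y] [Module (Module.End R M) Y]
      [Module.Finite (Module.End R M) Y],
      HasProjectiveDimensionLE (ModuleCat.of (Module.End R M) Y) m) (p : Ideal R) [p.IsPrime]
    {N : Type u} [AddCommGroup N] [Module R N] [Module (Localization.AtPrime p) N]
    [IsScalarTower R (Localization.AtPrime p) N] (j : M →ₗ[R] N)
    [IsLocalizedModule p.primeCompl j] :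
    ∃ t : ℕ, ringKrullDim (Localization.AtPrime p) = t ∧
      ∀ k, GlobalDimLE (Module.End (Localization.AtPrime p) N) k ↔ t ≤ k := by
  let S := Localization.AtPrime p
  have : IsNoetherianRing S := IsLocalization.isNoetherianRing p.primeCompl S inferInstance
  have : IsDomain S := IsLocalization.isDomain_localization p.primeCompl_le_nonZeroDivisors
  have : IsIntegrallyClosed S :=
    isIntegrallyClosed_of_isLocalization S p.primeCompl p.primeCompl_le_nonZeroDivisors
  obtain ⟨t, ht, hS, hk⟩ := exists_ringKrullDim_eq_and_extVanishAbove
    (extVanishAbove_localization hn p)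
  have : Module.Finite S N := Module.Finite.of_isLocalizedModule p.primeCompl j
  have : Module.FinitePresentation R M := Module.finitePresentation_of_finite R M
  have hφ := isLocalizedModule_endLocalization (S := S) p.primeCompl j
  have hN : IsGP S N := hM.of_isLocalizedModule j
  have hB : IsGP S (Module.End S N) :=
    hA.of_isLocalizedModule (endLocalization p.primeCompl S j).toLinearMap
  have := hN.isReflexive hS
  obtain ⟨τ, hτ⟩ := exists_trace_form S N
  have hBfin : Module.Finite S (Module.End S N) := inferInstance
  have : IsNoetherianRing (Module.End S N) := isNoetherian_of_tower S inferInstance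
  have : IsNoetherianRing (Module.End R M) := isNoetherian_of_tower R inferInstance
  exact ⟨t, ht, globalDimLE_iff_of_trace_form hB hτ
    (IsSemilinearLocalization.forall_hasProjectiveDimensionLE hφ hfin) hS hk
    (isDirectSummand_end p.primeCompl j hRM)⟩

end

/-- Let `R` be a Gorenstein Cohen–Macaulay local normal domain of
dimension `d ≥ 2` with finite Cohen–Macaulay type, `M` a representation generator, and
suppose `A = End_R M` is a maximal Cohen–Macaulay `R`-module.  Then `A` is a
non-commutative crepant resolution of `R`: `M` is finitely generated and reflexive, `A` is
MCM over `R`, and for every prime `p` the localization `A_p = End_{R_p}(M_p)` has global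
dimension equal to `dim R_p`. -/
theorem end_repGenerator_is_NCCR
    (R : Type u) [CommRing R] [IsLocalRing R] [IsNoetherianRing R]
    [IsDomain R] [IsIntegrallyClosed R] (hGor : IsGorensteinLocal R)
    (d : ℕ) (hd : 2 ≤ d) (hCM : IsCMLocal R d) (hfcm : FiniteCMType R d)
    (M : Type u) [AddCommGroup M] [Module R M] (hM : IsRepGenerator R d M)
    (hAmcm : IsMCM R d (Module.End R M)) :
    Module.Finite R M ∧ Module.IsReflexive R M ∧ IsMCM R d (Module.End R M) ∧
      ∀ (p : Ideal R) [p.IsPrime], ∃ n : ℕ,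
        ringKrullDim (Localization.AtPrime p) = n ∧
        GlobalDimLE (Module.End (Localization.AtPrime p)
          (LocalizedModule p.primeCompl M)) n ∧
        ∀ k : ℕ, GlobalDimLE (Module.End (Localization.AtPrime p)
          (LocalizedModule p.primeCompl M)) k → n ≤ k := by
  obtain ⟨hMfin, hRM, hind⟩ := hM
  obtain ⟨-, n, hid⟩ := hGor
  have hn := hasInjectiveDimensionLE_of_IDLE n R hid
  obtain ⟨t, ht, hR, -⟩ :=
    exists_ringKrullDim_eq_and_extVanishAbove (extVanishAbove_of_hasInjectiveDimensionLE hn)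
  obtain rfl : t = d := by exact_mod_cast ht.symm.trans hCM.1
  have hA : IsGP R (Module.End R M) := hAmcm.isGP hR
  have hMGP : IsGP R M := by
    obtain ⟨i, p, hip⟩ := hRM
    refine hA.of_retract (LinearMap.smulRightₗ p) (LinearMap.applyₗ (i 1)) ?_
    ext m
    have : p (i 1) = 1 := LinearMap.congr_fun hip 1
    simp [this]
  have hAnoeth : IsNoetherianRing (Module.End R M) := isNoetherian_of_tower R inferInstance
  refine ⟨hMfin, hMGP.isReflexive hR, hAmcm, fun p _ ↦ ?_⟩
  obtain ⟨s, hs, h⟩ := exists_ringKrullDim_eq_and_globalDimLE_iff hn hRM hMGP hA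
    (hasProjectiveDimensionLE_add_two hR hA fun a b F hF ↦
      projective_ker_of_isGP hR hMGP hRM
        (fun L _ _ _ hL ↦ hind L (hL.isMCM hR hCM.2)) F hF)
    p (LocalizedModule.mkLinearMap p.primeCompl M)
  exact ⟨s, hs, (h s).mpr le_rfl, fun k ↦ (h k).mp⟩
end

section
/- Let Λ be a left Artinian ring with Jacobson radical r satisfying r^n = 0 and r^{n-1} ≠ 0, and set M = ⊕_{i=1}^n Λ/r^i. Then Γ = End_Λ(M)^op has global dimension at most n + 1. -/
set_option synthInstance.maxHeartbeats 1000000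
set_option maxHeartbeats 1000000

universe u

/-- Global dimension at most `n`, computed on finitely presented left `A`-modules
(every finitely presented module is a cokernel of a map of finite free modules). -/
def GlobalDimLEfp (A : Type u) [Ring A] (n : ℕ) : Prop :=
  ∀ (k l : ℕ) (f : (Fin l → A) →ₗ[A] (Fin k → A)),
    PDLE A n ((Fin k → A) ⧸ LinearMap.range f)

/-- The Jacobson radical of a ring, as the intersection of the maximal left ideals. -/
def jacobsonRadical (Λ : Type u) [Ring Λ] : Ideal Λ :=
  sInf {I : Ideal Λ | I.IsMaximal}

/-- Powers of a (two-sided) left ideal: `idealPow Λ J n` is spanned by products of `n`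
elements of `J`. -/
def idealPow (Λ : Type u) [Ring Λ] (J : Ideal Λ) : ℕ → Ideal Λ
  | 0 => ⊤
  | n + 1 => Ideal.span {x : Λ | ∃ a ∈ idealPow Λ J n, ∃ b ∈ J, x = a * b}


open CategoryTheory

section ProjectiveDimension

variable {A : Type u} [Ring A]

theorem PDLE.of_hasProjectiveDimensionLT (n : ℕ) (N : Type u) [AddCommGroup N] [Module A N]
    (h : HasProjectiveDimensionLT (ModuleCat.of A N) (n + 1)) : PDLE A n N := by
  induction n generalizing N with
  | zero =>
    rw [PDLE, IsProjective.iff_projective]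
    exact projective_iff_hasProjectiveDimensionLT_one.mpr h
  | succ n ih =>
    let f : (N →₀ A) →ₗ[A] N := Finsupp.linearCombination A id
    have hf : Function.Surjective f := Finsupp.linearCombination_id_surjective A N
    refine Or.inr ⟨N, f, hf, ih _ ?_⟩
    have : Projective (ModuleCat.of A (N →₀ A)) :=
      (IsProjective.iff_projective (N →₀ A)).mp inferInstance
    exact ((LinearMap.shortExact_shortComplexKer hf).hasProjectiveDimensionLT_X₃_iff n this).mp h

theorem hasProjectiveDimensionLT_succ_of_ker {P N : Type u} [AddCommGroup P] [Module A P]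
    [AddCommGroup N] [Module A N] [Module.Projective A P] (f : P →ₗ[A] N)
    (hf : Function.Surjective f) (n : ℕ)
    (h : HasProjectiveDimensionLT (ModuleCat.of A (LinearMap.ker f)) n) :
    HasProjectiveDimensionLT (ModuleCat.of A N) (n + 1) := by
  have hP : Projective (ModuleCat.of A P) := (IsProjective.iff_projective P).mp inferInstance
  have : HasProjectiveDimensionLT (ModuleCat.of A P) (n + 1) :=
    hasProjectiveDimensionLT_of_ge _ 1 _ (by omega)
  exact (LinearMap.shortExact_shortComplexKer hf).hasProjectiveDimensionLT_X₃ n h this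

theorem hasProjectiveDimensionLT_coker {P N : Type u} [AddCommGroup P] [Module A P]
    [AddCommGroup N] [Module A N] [Module.Projective A P] [Module.Projective A N]
    (f : P →ₗ[A] N) (n : ℕ)
    (h : HasProjectiveDimensionLT (ModuleCat.of A (LinearMap.ker f)) n) :
    HasProjectiveDimensionLT (ModuleCat.of A (N ⧸ LinearMap.range f)) (n + 2) := by
  have hrange : HasProjectiveDimensionLT (ModuleCat.of A (LinearMap.range f)) (n + 1) :=
    hasProjectiveDimensionLT_succ_of_ker f.rangeRestrict f.surjective_rangeRestrict n
      (by rwa [LinearMap.ker_rangeRestrict])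
  exact hasProjectiveDimensionLT_succ_of_ker (LinearMap.range f).mkQ
    (Submodule.mkQ_surjective _) _ (by rwa [Submodule.ker_mkQ])

theorem hasProjectiveDimensionLT_of_linearEquiv {N N' : Type u} [AddCommGroup N] [Module A N]
    [AddCommGroup N'] [Module A N'] (e : N ≃ₗ[A] N') (n : ℕ)
    (h : HasProjectiveDimensionLT (ModuleCat.of A N) n) :
    HasProjectiveDimensionLT (ModuleCat.of A N') n :=
  hasProjectiveDimensionLT_of_iso e.toModuleIso n

end ProjectiveDimension

section HomModule

variable {Λ : Type u} [Ring Λ] {M X Y : Type u} [AddCommGroup M] [Module Λ M]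
  [AddCommGroup X] [Module Λ X] [AddCommGroup Y] [Module Λ Y]

/-- Precomposition makes `Hom(M, X)` a left module over `(End M)ᵐᵒᵖ`. -/
instance homModule : Module (Module.End Λ M)ᵐᵒᵖ (M →ₗ[Λ] X) where
  smul a g := g ∘ₗ a.unop
  one_smul _ := rfl
  mul_smul _ _ _ := rfl
  smul_zero _ := rfl
  smul_add _ _ _ := rfl
  add_smul a b g := by ext m; exact g.map_add _ _
  zero_smul g := by ext m; exact g.map_zero

theorem op_smul_apply (a : (Module.End Λ M)ᵐᵒᵖ) (g : M →ₗ[Λ] X) (m : M) :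
    (a • g) m = g (a.unop m) := rfl

variable (M) in
/-- Postcomposition with `f`, as a map of left modules over `(End M)ᵐᵒᵖ`. -/
def homPostcomp (f : X →ₗ[Λ] Y) : (M →ₗ[Λ] X) →ₗ[(Module.End Λ M)ᵐᵒᵖ] (M →ₗ[Λ] Y) where
  toFun g := f ∘ₗ g
  map_add' g h := LinearMap.comp_add g h f
  map_smul' _ _ := rfl

/-- The functor `Hom(M, -)` commutes with kernels. -/
def homKerEquiv (f : X →ₗ[Λ] Y) :
    (M →ₗ[Λ] LinearMap.ker f) ≃ₗ[(Module.End Λ M)ᵐᵒᵖ] LinearMap.ker (homPostcomp M f) where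
  toFun g := ⟨(LinearMap.ker f).subtype ∘ₗ g, by
    rw [LinearMap.mem_ker]; ext m; exact (g m).2⟩
  map_add' _ _ := rfl
  map_smul' _ _ := rfl
  invFun g := LinearMap.codRestrict _ g.1 fun m => LinearMap.congr_fun (LinearMap.mem_ker.mp g.2) m
  left_inv _ := rfl
  right_inv _ := rfl

variable (Λ M X) in
/-- `Hom(M, X)` is projective over `(End M)ᵐᵒᵖ`; this holds for `X` in `add M`. -/
abbrev HomProjective : Prop := Module.Projective (Module.End Λ M)ᵐᵒᵖ (M →ₗ[Λ] X)

variable (Λ M) in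
theorem homProjective_self : HomProjective Λ M M :=
  Module.Projective.of_equiv' (R := (Module.End Λ M)ᵐᵒᵖ) (M := (Module.End Λ M)ᵐᵒᵖ)
    { toFun := MulOpposite.unop, invFun := MulOpposite.op, map_add' := fun _ _ => rfl,
      map_smul' := fun _ _ => rfl, left_inv := fun _ => rfl, right_inv := fun _ => rfl }

theorem HomProjective.of_retract (h : HomProjective Λ M X) (i : Y →ₗ[Λ] X) (p : X →ₗ[Λ] Y)
    (hpi : p ∘ₗ i = LinearMap.id) : HomProjective Λ M Y :=
  Module.Projective.of_split (homPostcomp M i) (homPostcomp M p) <| by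
    ext g m
    exact LinearMap.congr_fun hpi (g m)

theorem HomProjective.prod (hX : HomProjective Λ M X) (hY : HomProjective Λ M Y) :
    HomProjective Λ M (X × Y) :=
  Module.Projective.of_split (M := (M →ₗ[Λ] X) × (M →ₗ[Λ] Y))
    ((homPostcomp M (LinearMap.fst Λ X Y)).prod (homPostcomp M (LinearMap.snd Λ X Y)))
    ((homPostcomp M (LinearMap.inl Λ X Y)).coprod (homPostcomp M (LinearMap.inr Λ X Y))) <| by
    ext g m <;> simp [homPostcomp]

theorem HomProjective.pi {ι : Type} [Fintype ι] {N : ι → Type u} [∀ i, AddCommGroup (N i)]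
    [∀ i, Module Λ (N i)] (h : ∀ i, HomProjective Λ M (N i)) : HomProjective Λ M (∀ i, N i) := by
  classical
  have := DFinsupp.linearEquivFunOnFintype (R := (Module.End Λ M)ᵐᵒᵖ)
    (M := fun i => M →ₗ[Λ] N i)
  exact Module.Projective.of_equiv' (R := (Module.End Λ M)ᵐᵒᵖ) <| this.trans
    { toFun := LinearMap.pi
      invFun := fun g i => LinearMap.proj i ∘ₗ g
      map_add' := fun _ _ => rfl
      map_smul' := fun _ _ => rfl
      left_inv := fun _ => rfl
      right_inv := fun _ => rfl }

/-- The map of powers of `M` induced by a matrix of endomorphisms. -/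
def endMatrixMap {k l : ℕ} (F : Fin l → Fin k → Module.End Λ M) :
    (Fin l → M) →ₗ[Λ] (Fin k → M) :=
  LinearMap.pi fun j => ∑ i, F i j ∘ₗ LinearMap.proj i

/-- The kernel of a map of finite free modules over `(End M)ᵐᵒᵖ` is `Hom(M, K)` for a kernel `K` of
a map of powers of `M`. -/
theorem exists_ker_equiv_hom {k l : ℕ}
    (f : (Fin l → (Module.End Λ M)ᵐᵒᵖ) →ₗ[(Module.End Λ M)ᵐᵒᵖ] (Fin k → (Module.End Λ M)ᵐᵒᵖ)) :
    ∃ φ : (Fin l → M) →ₗ[Λ] (Fin k → M),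
      Nonempty ((M →ₗ[Λ] LinearMap.ker φ) ≃ₗ[(Module.End Λ M)ᵐᵒᵖ] LinearMap.ker f) := by
  let F : Fin l → Fin k → Module.End Λ M := fun i j => (f (Pi.single i 1) j).unop
  let E (a : ℕ) : (Fin a → (Module.End Λ M)ᵐᵒᵖ) ≃ₗ[(Module.End Λ M)ᵐᵒᵖ] (M →ₗ[Λ] (Fin a → M)) :=
    { toFun := fun v => LinearMap.pi fun i => (v i).unop
      invFun := fun g i => MulOpposite.op (LinearMap.proj i ∘ₗ g)
      map_add' := fun _ _ => rfl
      map_smul' := fun _ _ => rfl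
      left_inv := fun _ => rfl
      right_inv := fun _ => rfl }
  have key : ∀ v, E k (f v) = homPostcomp M (endMatrixMap F) (E l v) := by
    intro v
    ext m j
    conv_lhs => rw [← Finset.univ_sum_single v]
    have : ∀ i, Pi.single i (v i) = v i • (Pi.single i 1 : Fin l → (Module.End Λ M)ᵐᵒᵖ) := by
      intro i; rw [← Pi.single_smul, smul_eq_mul, mul_one]
    simp only [this, map_sum, map_smul, LinearMap.sum_apply, Finset.sum_apply]
    simp only [op_smul_apply, homPostcomp, endMatrixMap, LinearMap.coe_mk, AddHom.coe_mk,
      LinearMap.comp_apply, LinearMap.pi_apply, LinearMap.sum_apply, LinearMap.proj_apply]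
    rfl
  refine ⟨endMatrixMap F, ⟨(homKerEquiv (endMatrixMap F)).trans
    (LinearEquiv.ofSubmodules (E l) (LinearMap.ker f)
      (LinearMap.ker (homPostcomp M (endMatrixMap F))) ?_).symm⟩⟩
  ext g
  rw [Submodule.mem_map_equiv, LinearMap.mem_ker, LinearMap.mem_ker,
    ← (E k).map_eq_zero_iff, key, LinearEquiv.apply_symm_apply]

end HomModule

section Radical

variable (Λ : Type u) [Ring Λ]

theorem jacobsonRadical_eq : jacobsonRadical Λ = Ring.jacobson Λ :=
  (Ring.jacobson_eq_sInf_isMaximal Λ).symm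

instance : (jacobsonRadical Λ).IsTwoSided := by
  rw [jacobsonRadical_eq]
  infer_instance

variable {Λ}

theorem mul_mem_idealPow_succ {J : Ideal Λ} {k : ℕ} {a b : Λ} (ha : a ∈ idealPow Λ J k)
    (hb : b ∈ J) : a * b ∈ idealPow Λ J (k + 1) :=
  Ideal.subset_span ⟨a, ha, b, hb, rfl⟩

instance idealPow_isTwoSided (J : Ideal Λ) [J.IsTwoSided] (k : ℕ) :
    (idealPow Λ J k).IsTwoSided := by
  cases k with
  | zero => exact ⟨fun _ _ => Submodule.mem_top⟩
  | succ k =>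
    refine ⟨fun {x} c hx => ?_⟩
    induction hx using Submodule.span_induction with
    | mem x hx =>
      obtain ⟨a, ha, b, hb, rfl⟩ := hx
      rw [mul_assoc]
      exact mul_mem_idealPow_succ ha (Ideal.mul_mem_right _ _ hb)
    | zero => simp
    | add x y _ _ hx hy => rw [add_mul]; exact add_mem hx hy
    | smul d x _ hx => rw [smul_mul_assoc]; exact Submodule.smul_mem _ d hx

theorem idealPow_antitone (J : Ideal Λ) [J.IsTwoSided] : Antitone (idealPow Λ J) := by
  refine antitone_nat_of_succ_le fun k => Ideal.span_le.mpr ?_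
  rintro _ ⟨a, ha, b, -, rfl⟩
  exact Ideal.mul_mem_right _ _ ha

theorem pow_mem_idealPow {J : Ideal Λ} {b : Λ} (hb : b ∈ J) (k : ℕ) : b ^ k ∈ idealPow Λ J k := by
  induction k with
  | zero => exact Submodule.mem_top
  | succ k ih => rw [pow_succ]; exact mul_mem_idealPow_succ ih hb

end Radical

section Annihilated

variable {Λ : Type u} [Ring Λ] {X Y : Type u} [AddCommGroup X] [Module Λ X]
  [AddCommGroup Y] [Module Λ Y]

variable (X) in
/-- The submodule of elements annihilated by a two-sided ideal. -/
def annihilated (I : Ideal Λ) [I.IsTwoSided] : Submodule Λ X where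
  carrier := {x | ∀ a ∈ I, a • x = 0}
  zero_mem' _ _ := smul_zero _
  add_mem' hx hy a ha := by rw [smul_add, hx a ha, hy a ha, add_zero]
  smul_mem' c x hx a ha := by rw [← mul_smul]; exact hx _ (Ideal.mul_mem_right _ _ ha)

theorem annihilated_le {I I' : Ideal Λ} [I.IsTwoSided] [I'.IsTwoSided] (h : I ≤ I') :
    annihilated X I' ≤ annihilated X I := fun _ hx a ha => hx a (h ha)

theorem map_mem_annihilated {I : Ideal Λ} [I.IsTwoSided] (f : X →ₗ[Λ] Y) {x : X}
    (hx : x ∈ annihilated X I) : f x ∈ annihilated Y I := fun a ha => by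
  rw [← map_smul, hx a ha, map_zero]

theorem quotient_annihilated (I : Ideal Λ) [I.IsTwoSided] : annihilated (Λ ⧸ I) I = ⊤ := by
  refine eq_top_iff.mpr fun x _ a ha => ?_
  obtain ⟨c, rfl⟩ := Submodule.Quotient.mk_surjective _ x
  rw [← Submodule.Quotient.mk_smul, Submodule.Quotient.mk_eq_zero]
  exact Ideal.mul_mem_right _ _ ha

theorem pi_annihilated {ι : Type} {I : Ideal Λ} [I.IsTwoSided] {K : ι → Ideal Λ}
    [∀ j, (K j).IsTwoSided] (h : ∀ j, I ≤ K j) : annihilated (∀ j, Λ ⧸ K j) I = ⊤ := by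
  refine eq_top_iff.mpr fun x _ a ha => funext fun j => ?_
  have : x j ∈ annihilated (Λ ⧸ K j) (K j) := by rw [quotient_annihilated]; trivial
  exact annihilated_le (h j) this a ha

/-- The map from a product of cyclic modules given by elements with suitable annihilators. -/
def cyclicMap {ι : Type} [Fintype ι] (K : ι → Ideal Λ) [∀ j, (K j).IsTwoSided]
    (x : ∀ j, annihilated X (K j)) : (∀ j, Λ ⧸ K j) →ₗ[Λ] X :=
  ∑ j, (K j).liftQ (LinearMap.toSpanSingleton Λ X (x j)) (fun a ha => (x j).2 a ha) ∘ₗ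
    LinearMap.proj j

theorem cyclicMap_mk {ι : Type} [Fintype ι] (K : ι → Ideal Λ) [∀ j, (K j).IsTwoSided]
    (x : ∀ j, annihilated X (K j)) (c : ι → Λ) :
    cyclicMap K x (fun j => Submodule.Quotient.mk (c j)) = ∑ j, c j • (x j : X) := by
  rw [cyclicMap, LinearMap.sum_apply]
  rfl

theorem cyclicMap_single {ι : Type} [Fintype ι] [DecidableEq ι] (K : ι → Ideal Λ)
    [∀ j, (K j).IsTwoSided] (x : ∀ j, annihilated X (K j)) (j : ι) (c : Λ) :
    cyclicMap K x (Pi.single j (Submodule.Quotient.mk c)) = c • (x j : X) := by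
  rw [cyclicMap, LinearMap.sum_apply, Finset.sum_eq_single j]
  · rw [LinearMap.comp_apply, LinearMap.proj_apply, Pi.single_eq_same]
    rfl
  · intro i _ hi
    simp [Pi.single_eq_of_ne hi]
  · simp

/-- Lifting along `f` of elements with prescribed annihilators gives lifting of all maps from a
product of cyclic modules. -/
theorem homPostcomp_surjective {ι : Type} [Fintype ι] (K : ι → Ideal Λ)
    [∀ j, (K j).IsTwoSided] (f : X →ₗ[Λ] Y)
    (h : ∀ j, annihilated Y (K j) ≤ (annihilated X (K j)).map f) :
    Function.Surjective (homPostcomp (∀ j, Λ ⧸ K j) f) := by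
  classical
  intro g
  have hg (j : ι) : g (Pi.single j (Submodule.Quotient.mk 1)) ∈ annihilated Y (K j) := by
    refine map_mem_annihilated g fun a ha => ?_
    rw [← Pi.single_smul, ← Submodule.Quotient.mk_smul, smul_eq_mul, mul_one,
      (Submodule.Quotient.mk_eq_zero _).mpr ha, Pi.single_zero]
  choose y hy hyf using fun j => h j (hg j)
  refine ⟨cyclicMap K fun j => ⟨y j, hy j⟩, LinearMap.pi_ext fun j q => ?_⟩
  obtain ⟨c, rfl⟩ := Submodule.Quotient.mk_surjective _ q
  change f (cyclicMap K _ _) = _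
  rw [cyclicMap_single, map_smul, hyf, ← map_smul, ← Pi.single_smul,
    ← Submodule.Quotient.mk_smul, smul_eq_mul, mul_one]

end Annihilated

section Semisimple

variable {Λ : Type u} [Ring Λ] [IsArtinianRing Λ]

theorem exists_idempotent_of_simple (hJ : ∀ b ∈ Ring.jacobson Λ, IsNilpotent b) {S : Type u}
    [AddCommGroup S] [Module Λ S] [IsSimpleModule Λ S] {y : S} (hy : y ≠ 0) :
    ∃ e : Λ, IsIdempotentElem e ∧ e • y = y ∧
      ∀ a : Λ, (a * e) • y = 0 → a * e ∈ Ring.jacobson Λ := by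
  let J := Ring.jacobson Λ
  let I : Ideal Λ := LinearMap.ker (LinearMap.toSpanSingleton Λ S y)
  have hI : I.IsMaximal := IsSimpleModule.ker_toSpanSingleton_isMaximal Λ hy
  have hJI : J ≤ I := Ring.jacobson_le_of_isMaximal I
  obtain ⟨d, hd, hId⟩ := IsSemisimpleRing.ideal_eq_span_idempotent
    (I.map (Ideal.Quotient.mk J))
  have mem_I {a : Λ} : Ideal.Quotient.mk J a ∈ I.map (Ideal.Quotient.mk J) ↔ a ∈ I :=
    Ideal.mem_quotient_iff_mem hJI
  obtain ⟨e, he, hed⟩ := exists_isIdempotentElem_eq_of_ker_isNilpotent (Ideal.Quotient.mk J)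
    (fun x hx => hJ x (by rwa [Ideal.mk_ker] at hx)) (1 - d)
    (Ideal.Quotient.mk_surjective _) hd.one_sub
  refine ⟨e, he, ?_, fun a ha => ?_⟩
  · have : (1 - e) ∈ I := by
      rw [← mem_I, map_sub, map_one, hed, sub_sub_cancel, hId]
      exact Ideal.mem_span_singleton_self d
    have : (1 - e) • y = 0 := this
    rw [sub_smul, one_smul, sub_eq_zero] at this
    exact this.symm
  · have : a * e ∈ I := ha
    rw [← mem_I, hId, Ideal.mem_span_singleton'] at this
    obtain ⟨c, hc⟩ := this
    rw [← Ideal.Quotient.eq_zero_iff_mem]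
    calc Ideal.Quotient.mk J (a * e) = Ideal.Quotient.mk J (a * e) * Ideal.Quotient.mk J e := by
          rw [← map_mul, mul_assoc, he.eq]
      _ = 0 := by rw [← hc, hed, mul_assoc, mul_sub, mul_one, hd.eq, sub_self, mul_zero]

theorem exists_idempotent_generators (hJ : ∀ b ∈ Ring.jacobson Λ, IsNilpotent b) {Y : Type u}
    [AddCommGroup Y] [Module Λ Y] [Module.Finite Λ Y]
    (hY : ∀ b ∈ Ring.jacobson Λ, ∀ y : Y, b • y = 0) :
    ∃ (s : ℕ) (e : Fin s → Λ) (y : Fin s → Y), (∀ i, IsIdempotentElem (e i)) ∧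
      (∀ i, e i • y i = y i) ∧ (∀ z : Y, ∃ c : Fin s → Λ, ∑ i, c i • y i = z) ∧
      ∀ c : Fin s → Λ, ∑ i, (c i * e i) • y i = 0 → ∀ i, c i * e i ∈ Ring.jacobson Λ := by
  have htors : Module.IsTorsionBySet Λ Y (Ring.jacobson Λ) := fun y b => hY b b.2 y
  have : IsSemisimpleModule Λ Y := by
    let := htors.module
    exact htors.isSemisimpleModule_iff.mp inferInstance
  obtain ⟨s, S, E, hS⟩ := IsSemisimpleModule.exists_linearEquiv_fin_dfinsupp Λ Y
  let E' : Y ≃ₗ[Λ] ∀ i, S i := E.trans (DFinsupp.linearEquivFunOnFintype)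
  have (i : Fin s) : Nontrivial (S i) := IsSimpleModule.nontrivial Λ (S i)
  choose w hw using fun i => exists_ne (0 : S i)
  choose e he hew hann using fun i => exists_idempotent_of_simple hJ (hw i)
  have hE (c : Fin s → Λ) :
      ∑ i, c i • E'.symm (Pi.single i (w i)) = E'.symm fun i => c i • w i := by
    simp_rw [← map_smul, ← map_sum, ← Pi.single_smul]
    rw [Finset.univ_sum_single fun i => c i • w i]
  refine ⟨s, e, fun i => E'.symm (Pi.single i (w i)), he, fun i => ?_, fun z => ?_,
    fun c hc i => hann i _ ?_⟩
  · rw [← map_smul, ← Pi.single_smul, hew]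
  · choose c hc using fun i => IsSimpleModule.toSpanSingleton_surjective Λ (hw i) (E' z i)
    refine ⟨c, ?_⟩
    rw [hE, LinearEquiv.symm_apply_eq]
    exact funext hc
  · rw [hE, LinearEquiv.map_eq_zero_iff] at hc
    exact congr_fun hc i

end Semisimple

section Auslander

variable {Λ : Type u} [Ring Λ]

/-- Right multiplication by `e` on `Λ ⧸ I` for a two-sided ideal `I`. -/
def quotientMulRight (I : Ideal Λ) [I.IsTwoSided] (e : Λ) : (Λ ⧸ I) →ₗ[Λ] (Λ ⧸ I) :=
  I.liftQ (LinearMap.toSpanSingleton Λ (Λ ⧸ I) (Submodule.Quotient.mk e)) fun a ha => by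
    rw [LinearMap.mem_ker, LinearMap.toSpanSingleton_apply, ← Submodule.Quotient.mk_smul,
      Submodule.Quotient.mk_eq_zero]
    exact Ideal.mul_mem_right _ _ ha

/-- The idempotent endomorphism of `(Λ ⧸ I)^s` given by right multiplication by `e i` in the
`i`-th component. -/
def piMulRight (I : Ideal Λ) [I.IsTwoSided] {s : ℕ} (e : Fin s → Λ) :
    (Fin s → Λ ⧸ I) →ₗ[Λ] (Fin s → Λ ⧸ I) :=
  LinearMap.pi fun i => quotientMulRight I (e i) ∘ₗ LinearMap.proj i

theorem piMulRight_mk (I : Ideal Λ) [I.IsTwoSided] {s : ℕ} (e c : Fin s → Λ) :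
    piMulRight I e (fun i => Submodule.Quotient.mk (c i)) =
      fun i => Submodule.Quotient.mk (c i * e i) := rfl

theorem exists_mk_eq (I : Ideal Λ) {s : ℕ} (p : Fin s → Λ ⧸ I) :
    ∃ c : Fin s → Λ, (fun i => Submodule.Quotient.mk (c i)) = p := by
  choose c hc using fun i => Submodule.Quotient.mk_surjective I (p i)
  exact ⟨c, funext hc⟩

theorem homProjective_range_piMulRight {M : Type u} [AddCommGroup M] [Module Λ M]
    (I : Ideal Λ) [I.IsTwoSided] (hM : HomProjective Λ M (Λ ⧸ I)) {s : ℕ} (e : Fin s → Λ)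
    (he : ∀ i, IsIdempotentElem (e i)) :
    HomProjective Λ M (LinearMap.range (piMulRight I e)) := by
  refine (HomProjective.pi fun _ : Fin s => hM).of_retract (Submodule.subtype _)
    (piMulRight I e).rangeRestrict ?_
  refine LinearMap.ext ?_
  rintro ⟨_, p, rfl⟩
  obtain ⟨c, rfl⟩ := exists_mk_eq I p
  refine Subtype.ext ?_
  have : piMulRight I e (piMulRight I e fun i => Submodule.Quotient.mk (c i)) =
      piMulRight I e fun i => Submodule.Quotient.mk (c i) := by
    simp_rw [piMulRight_mk, mul_assoc, (he _).eq]
  exact this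

variable [IsArtinianRing Λ]

/-- Every finite module annihilated by `r^(m+1)` has a right `add M`-approximation with kernel
annihilated by `r^m`, where `M = ⨁ Λ/r^i`. -/
theorem exists_approximation {n : ℕ} (hzero : idealPow Λ (jacobsonRadical Λ) n = ⊥)
    {m : ℕ} (hm : m < n) (X : Type u) [AddCommGroup X] [Module Λ X] [Module.Finite Λ X]
    (hX : annihilated X (idealPow Λ (jacobsonRadical Λ) (m + 1)) = ⊤) :
    ∃ (P : Type u) (_ : AddCommGroup P) (_ : Module Λ P) (_ : Module.Finite Λ P) (f : P →ₗ[Λ] X),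
      HomProjective Λ (∀ i : Fin n, Λ ⧸ idealPow Λ (jacobsonRadical Λ) (i + 1)) P ∧
      Function.Surjective
        (homPostcomp (∀ i : Fin n, Λ ⧸ idealPow Λ (jacobsonRadical Λ) (i + 1)) f) ∧
      LinearMap.ker f ≤ annihilated P (idealPow Λ (jacobsonRadical Λ) m) := by
  classical
  let R := idealPow Λ (jacobsonRadical Λ)
  have hR : Antitone R := idealPow_antitone _
  let M := ∀ i : Fin n, Λ ⧸ R (i + 1)
  have hproj (i : ℕ) (hi : i < n) : HomProjective Λ M (Λ ⧸ R (i + 1)) :=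
    (homProjective_self Λ M).of_retract
      (LinearMap.single Λ (fun i : Fin n => Λ ⧸ R (i + 1)) ⟨i, hi⟩)
      (LinearMap.proj (φ := fun i : Fin n => Λ ⧸ R (i + 1)) ⟨i, hi⟩)
      (LinearMap.proj_comp_single_same Λ (fun i : Fin n => Λ ⧸ R (i + 1)) ⟨i, hi⟩)
  have hnil : ∀ b ∈ Ring.jacobson Λ, IsNilpotent b := fun b hb => ⟨n, by
    rw [← jacobsonRadical_eq] at hb
    have := pow_mem_idealPow hb n
    rwa [hzero] at this⟩
  let Xm := annihilated X (R m)
  obtain ⟨s, e, y, he, hey, hspan, hann⟩ := exists_idempotent_generators hnil (Y := X ⧸ Xm) (by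
    intro b hb z
    obtain ⟨x, rfl⟩ := Submodule.Quotient.mk_surjective _ z
    rw [← Submodule.Quotient.mk_smul, Submodule.Quotient.mk_eq_zero]
    intro a ha
    have : x ∈ annihilated X (R (m + 1)) := hX ▸ Submodule.mem_top
    rw [← mul_smul]
    exact this _ (mul_mem_idealPow_succ ha (jacobsonRadical_eq Λ ▸ hb)))
  choose x₀ hx₀ using fun i => Submodule.Quotient.mk_surjective _ (y i)
  let x (i : Fin s) : annihilated X (R (m + 1)) := ⟨e i • x₀ i, hX ▸ Submodule.mem_top⟩
  have hx (i : Fin s) : Xm.mkQ (x i) = y i := by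
    change Submodule.Quotient.mk (e i • x₀ i) = _
    rw [Submodule.Quotient.mk_smul, hx₀, hey]
  let F := cyclicMap (fun _ : Fin s => R (m + 1)) x
  have hF (c : Fin s → Λ) :
      Xm.mkQ (F fun i => Submodule.Quotient.mk (c i)) = ∑ i, c i • y i := by
    simp only [F, cyclicMap_mk, map_sum, map_smul, hx]
  have hgen (i : ℕ) := Module.Finite.exists_fin (R := Λ) (M := annihilated X (R i))
  choose k g hg using fun i : Fin m => hgen (i + 1)
  let ι := Σ i : Fin m, Fin (k i)
  let G := cyclicMap (X := X) (fun j : ι => R (j.1 + 1)) fun j => g j.1 j.2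
  let Q := LinearMap.range (piMulRight (R (m + 1)) e)
  let N := ∀ j : ι, Λ ⧸ R (j.1 + 1)
  have hNm : annihilated N (R m) = ⊤ := pi_annihilated fun j => hR j.1.2
  have hQ : annihilated Q (R (m + 1)) = ⊤ := eq_top_iff.mpr fun q _ a ha => Subtype.ext <| by
    have : (q : Fin s → Λ ⧸ R (m + 1)) ∈ annihilated (Fin s → Λ ⧸ R (m + 1)) (R (m + 1)) := by
      rw [pi_annihilated fun _ => le_rfl]; trivial
    exact this a ha
  let f : (Q × N) →ₗ[Λ] X := (F ∘ₗ Q.subtype).coprod G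
  have hprod (I : Ideal Λ) [I.IsTwoSided] (p : Q × N) (h₁ : p.1 ∈ annihilated Q I)
      (h₂ : p.2 ∈ annihilated N I) : p ∈ annihilated (Q × N) I :=
    fun a ha => Prod.ext (h₁ a ha) (h₂ a ha)
  have hlow (i : Fin m) :
      annihilated X (R (i + 1)) ≤ (annihilated (Q × N) (R (i + 1))).map f := by
    have : annihilated X (R (i + 1)) =
        Submodule.span Λ (Set.range fun j => (g i j : X)) := by
      rw [Set.range_comp' Subtype.val, ← Submodule.coe_subtype, Submodule.span_image, hg,
        Submodule.map_top, Submodule.range_subtype]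
    rw [this, Submodule.span_le]
    rintro _ ⟨j, rfl⟩
    refine ⟨(0, Pi.single ⟨i, j⟩ (Submodule.Quotient.mk 1)), hprod _ _ (zero_mem _) ?_, ?_⟩
    · intro a ha
      rw [← Pi.single_smul, ← Submodule.Quotient.mk_smul, smul_eq_mul, mul_one,
        (Submodule.Quotient.mk_eq_zero _).mpr ha, Pi.single_zero]
    · simp only [f, LinearMap.coprod_apply, map_zero, zero_add]
      rw [cyclicMap_single, one_smul]
  have hXm : Xm ≤ LinearMap.range f := by
    rcases m with - | m
    · intro z hz
      have : z = 0 := by simpa using hz 1 Submodule.mem_top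
      exact this ▸ zero_mem _
    · exact (hlow (Fin.last m)).trans LinearMap.map_le_range
  have hsurj : LinearMap.range f = ⊤ := by
    refine eq_top_iff.mpr fun z _ => ?_
    obtain ⟨c, hc⟩ := hspan (Xm.mkQ z)
    let q : Q := ⟨_, LinearMap.mem_range_self _ fun i => Submodule.Quotient.mk (c i)⟩
    have hq : z - f (q, 0) ∈ Xm := by
      rw [← Submodule.ker_mkQ Xm, LinearMap.mem_ker, map_sub, sub_eq_zero]
      simp only [f, LinearMap.coprod_apply, map_zero, add_zero, LinearMap.comp_apply, q,
        Submodule.subtype_apply, piMulRight_mk, hF, mul_smul, hey, hc]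
    simpa using add_mem (hXm hq) (LinearMap.mem_range_self f (q, 0))
  refine ⟨Q × N, inferInstance, inferInstance, inferInstance, f, ?_, ?_, ?_⟩
  · exact (homProjective_range_piMulRight _ (hproj m hm) e he).prod
      (HomProjective.pi fun j => hproj j.1 (j.1.2.trans hm))
  · refine homPostcomp_surjective _ f fun i => ?_
    by_cases hi : (i : ℕ) < m
    · exact hlow ⟨i, hi⟩
    · have htop : annihilated (Q × N) (R (i + 1)) = ⊤ := eq_top_iff.mpr fun p _ =>
        annihilated_le (hR (by omega)) <| hprod (R (m + 1)) p (hQ ▸ Submodule.mem_top)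
          (annihilated_le (hR (Nat.le_succ m)) (hNm ▸ Submodule.mem_top))
      change _ ≤ (annihilated (Q × N) (R (i + 1))).map f
      rw [htop, Submodule.map_top, hsurj]
      exact le_top
  · rintro ⟨⟨_, p, rfl⟩, q⟩ hpq
    obtain ⟨c, rfl⟩ := exists_mk_eq _ p
    have hq : q ∈ annihilated N (R m) := hNm ▸ Submodule.mem_top
    refine hprod _ _ (fun a ha => Subtype.ext ?_) hq
    have hGq : Xm.mkQ (G q) = 0 := by
      rw [← LinearMap.mem_ker, Submodule.ker_mkQ]
      exact map_mem_annihilated G hq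
    have hsum : ∑ i, (c i * e i) • y i = 0 := by
      have := congr_arg Xm.mkQ (LinearMap.mem_ker.mp hpq)
      rw [LinearMap.coprod_apply, map_add, hGq, add_zero, map_zero] at this
      rw [← hF]
      exact this
    refine funext fun i => ?_
    change a • (Submodule.Quotient.mk (c i * e i) : Λ ⧸ R (m + 1)) = 0
    rw [← Submodule.Quotient.mk_smul, Submodule.Quotient.mk_eq_zero]
    exact mul_mem_idealPow_succ ha (jacobsonRadical_eq Λ ▸ hann c hsum i)

theorem hasProjectiveDimensionLT_hom {n : ℕ} (hzero : idealPow Λ (jacobsonRadical Λ) n = ⊥)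
    {m : ℕ} (hm : m ≤ n) (X : Type u) [AddCommGroup X] [Module Λ X] [Module.Finite Λ X]
    (hX : annihilated X (idealPow Λ (jacobsonRadical Λ) m) = ⊤) :
    HasProjectiveDimensionLT
      (ModuleCat.of (Module.End Λ (∀ i : Fin n, Λ ⧸ idealPow Λ (jacobsonRadical Λ) (i + 1)))ᵐᵒᵖ
        ((∀ i : Fin n, Λ ⧸ idealPow Λ (jacobsonRadical Λ) (i + 1)) →ₗ[Λ] X)) m := by
  induction m generalizing X with
  | zero =>
    have : Subsingleton X := subsingleton_of_forall_eq 0 fun x => by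
      have hx : x ∈ annihilated X (idealPow Λ (jacobsonRadical Λ) 0) := hX ▸ Submodule.mem_top
      simpa using hx 1 Submodule.mem_top
    refine (ModuleCat.isZero_of_subsingleton _).hasProjectiveDimensionLT_zero
  | succ m ih =>
    obtain ⟨P, _, _, _, f, hP, hf, hker⟩ := exists_approximation hzero hm X hX
    have : IsNoetherian Λ P := isNoetherian_of_isNoetherianRing_of_finite Λ P
    refine hasProjectiveDimensionLT_succ_of_ker _ hf m ?_
    refine hasProjectiveDimensionLT_of_linearEquiv (homKerEquiv f) m (ih (by omega) _ ?_)
    exact eq_top_iff.mpr fun x _ a ha => Subtype.ext (hker x.2 a ha)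

end Auslander

/-- **Auslander.** Let `Λ` be a left Artinian ring with Jacobson radical
`r` satisfying `r^n = 0`, `r^(n-1) ≠ 0`, and set `M = ⊕_{i=1}^n Λ/r^i`.  Then
`Γ = (End_Λ M)ᵒᵖ` has global dimension at most `n + 1`. -/
theorem auslander_gldim_le
    (Λ : Type u) [Ring Λ] [IsArtinianRing Λ] (n : ℕ) (hn : 1 ≤ n)
    (hzero : idealPow Λ (jacobsonRadical Λ) n = ⊥)
    (hne : idealPow Λ (jacobsonRadical Λ) (n - 1) ≠ ⊥) :
    GlobalDimLEfp
      ((Module.End Λ (∀ i : Fin n, Λ ⧸ idealPow Λ (jacobsonRadical Λ) (i + 1)))ᵐᵒᵖ)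
      (n + 1) := by
  intro k l f
  obtain ⟨φ, ⟨E⟩⟩ := exists_ker_equiv_hom f
  have hK := hasProjectiveDimensionLT_hom hzero le_rfl (LinearMap.ker φ) <|
    eq_top_iff.mpr fun x _ a ha => by
      rw [hzero] at ha
      rw [(Submodule.mem_bot Λ).mp ha, zero_smul]
  have hker := hasProjectiveDimensionLT_of_linearEquiv (N' := LinearMap.ker f) E n hK
  exact PDLE.of_hasProjectiveDimensionLT _ _ (hasProjectiveDimensionLT_coker f n hker)
end
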